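/- Let G be a finite simple graph on vertex set Fin n, with scalar node features in [0,1], whose maximal cliques are C_1, …, C_m. Let f : [0,1]^n → [0,1] be G-compatible with clique functions θ_{C_j} : [0,1]^{|C_j|} → [0,1], each 1-Lipschitz with respect to the sup norm. Then there exists a constant c, depending only on the multiset of clique sizes {|C_1|, …, |C_m|}, such that for every ε ∈ (0,1) there exist shallow ReLU networks g_1, …, g_m, where g_j takes as input the features (x_v)_{v ∈ C_j} and has N_j units, with sup_{x ∈ [0,1]^n} |f(x) − Σ_{j=1}^m g_j(x_{C_j})| < ε and total unit count Σ_{j=1}^m N_j ≤ c · Σ_{j=1}^m (ε/m)^{−|C_j|}; in particular, if every maximal clique of G has at most k+1 vertices, the total number of parameters needed for an ε-approximation of f grows linearly in the number m of maximal cliques and exponentially only in k. -/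

import Mathlib

open Finset

open Classical in
/-- The finite set of maximal cliques of a simple graph on `Fin n`. -/
noncomputable def maxCliques (n : ℕ) (G : SimpleGraph (Fin n)) : Finset (Finset (Fin n)) :=
  Finset.univ.filter fun C => Maximal (fun s : Finset (Fin n) => G.IsClique (s : Set (Fin n))) C

section

open MeasureTheory

/-- The sign `±1` attached to a Boolean. -/
def boolSign (b : Bool) : ℝ := if b then 1 else -1

lemma sum_exp_signed_sum_le {I : Type*} [Fintype I] [DecidableEq I] (r : I → ℝ) :
    ∑ e : I → Bool, Real.exp (∑ i, boolSign (e i) * r i)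
      ≤ 2 ^ Fintype.card I * Real.exp ((∑ i, r i ^ 2) / 2) := by
  have h1 : ∑ e : I → Bool, Real.exp (∑ i, boolSign (e i) * r i)
      = ∏ i, ∑ b : Bool, Real.exp (boolSign b * r i) := by
    rw [Finset.prod_univ_sum, Fintype.piFinset_univ]
    exact Finset.sum_congr rfl fun e _ => Real.exp_sum _ _
  have h2 : ∀ i, ∑ b : Bool, Real.exp (boolSign b * r i) ≤ 2 * Real.exp (r i ^ 2 / 2) := by
    intro i
    have := Real.cosh_le_exp_half_sq (r i)
    rw [Real.cosh_eq] at this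
    simp only [Fintype.sum_bool, boolSign, if_true, one_mul, Bool.false_eq_true, if_false, neg_mul]
    linarith
  rw [h1]
  calc _ ≤ ∏ i, 2 * Real.exp (r i ^ 2 / 2) :=
        Finset.prod_le_prod (fun i _ => Finset.sum_nonneg fun b _ => (Real.exp_pos _).le)
          fun i _ => h2 i
    _ = _ := by
        rw [Finset.prod_mul_distrib, ← Real.exp_sum, Finset.sum_div]
        simp

lemma sum_abs_signed_sum_pow_le {I : Type*} [Fintype I] [DecidableEq I] (r : I → ℝ) {t : ℝ}
    (ht : 0 ≤ t) (hr : ∑ i, r i ^ 2 ≤ t ^ 2) {q : ℕ} (hq : 1 ≤ q) :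
    ∑ e : I → Bool, |∑ i, boolSign (e i) * r i| ^ q
      ≤ 4 * q.factorial * t ^ q * 2 ^ Fintype.card I := by
  rcases ht.eq_or_lt with rfl | ht
  · have h0 : ∀ i, r i = 0 := by
      intro i
      have h := Finset.single_le_sum (f := fun i => r i ^ 2) (fun i _ => sq_nonneg _) (mem_univ i)
      have : r i ^ 2 ≤ 0 := by simpa using h.trans hr
      exact pow_eq_zero_iff (two_ne_zero) |>.1 (le_antisymm this (sq_nonneg _))
    simp [h0, show q ≠ 0 by omega]
  have hsq : ∀ σ : ℝ, σ ^ 2 = 1 → ∑ i, (σ * (r i / t)) ^ 2 ≤ 1 := by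
    intro σ hσ
    simp only [mul_pow, hσ, one_mul, div_pow]
    rw [← Finset.sum_div, div_le_one (by positivity)]
    exact hr
  have hexp : Real.exp (1 / 2) ≤ 2 := by
    have h := Real.exp_one_lt_d9
    have h2 : Real.exp (1 / 2) ^ 2 = Real.exp 1 := by rw [← Real.exp_nat_mul]; norm_num
    nlinarith [Real.exp_pos (1 / 2 : ℝ)]
  have hone : ∀ σ : ℝ, σ ^ 2 = 1 →
      ∑ e : I → Bool, Real.exp (σ * ((∑ i, boolSign (e i) * r i) / t))
        ≤ 2 * 2 ^ Fintype.card I := by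
    intro σ hσ
    have h := sum_exp_signed_sum_le fun i => σ * (r i / t)
    have h' : ∑ e : I → Bool, Real.exp (σ * ((∑ i, boolSign (e i) * r i) / t))
        = ∑ e : I → Bool, Real.exp (∑ i, boolSign (e i) * (σ * (r i / t))) := by
      refine Finset.sum_congr rfl fun e _ => ?_
      rw [Finset.sum_div, Finset.mul_sum]
      congr 1
      exact Finset.sum_congr rfl fun i _ => by ring
    rw [h']
    refine h.trans ?_
    rw [mul_comm]
    gcongr
    refine le_trans (Real.exp_le_exp.2 ?_) hexp
    have := hsq σ hσ
    linarith
  have hpt : ∀ e : I → Bool, |∑ i, boolSign (e i) * r i| ^ q ≤ q.factorial * t ^ q *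
      (Real.exp (1 * ((∑ i, boolSign (e i) * r i) / t))
        + Real.exp ((-1) * ((∑ i, boolSign (e i) * r i) / t))) := by
    intro e
    set y := (∑ i, boolSign (e i) * r i) / t with hy
    have hS : |∑ i, boolSign (e i) * r i| = |y| * t := by
      rw [hy, abs_div, abs_of_pos ht]; field_simp
    rw [hS, mul_pow]
    have h1 := Real.pow_div_factorial_le_exp (|y|) (abs_nonneg y) q
    rw [div_le_iff₀ (by positivity)] at h1
    have h2 : Real.exp |y| ≤ Real.exp (1 * y) + Real.exp ((-1) * y) := by
      rcases abs_cases y with ⟨h, _⟩ | ⟨h, _⟩ <;> rw [h]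
      · simp [Real.exp_nonneg]
      · simp [Real.exp_nonneg]
    have : |y| ^ q ≤ (Real.exp (1 * y) + Real.exp ((-1) * y)) * q.factorial := by
      refine h1.trans ?_
      gcongr
    calc _ ≤ (Real.exp (1 * y) + Real.exp ((-1) * y)) * q.factorial * t ^ q := by gcongr
      _ = _ := by ring
  calc _ ≤ _ := Finset.sum_le_sum fun e _ => hpt e
    _ = q.factorial * t ^ q * (∑ e : I → Bool, Real.exp (1 * ((∑ i, boolSign (e i) * r i) / t))
        + ∑ e : I → Bool, Real.exp ((-1) * ((∑ i, boolSign (e i) * r i) / t))) := by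
        rw [← Finset.mul_sum, Finset.sum_add_distrib]
    _ ≤ q.factorial * t ^ q * (2 * 2 ^ Fintype.card I + 2 * 2 ^ Fintype.card I) := by
        gcongr
        · exact hone 1 (by norm_num)
        · exact hone (-1) (by norm_num)
    _ = _ := by ring

lemma abs_round_le_pow (y : ℝ) {q : ℕ} (hq : 1 ≤ q) : |(round y : ℝ)| ≤ (2 * |y|) ^ q := by
  have h := abs_sub_round y
  have h1 : |(round y : ℝ)| ≤ |y| + 1 / 2 := by
    have := abs_sub_abs_le_abs_sub (round y : ℝ) y
    rw [abs_sub_comm] at this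
    linarith
  rcases lt_or_ge |y| (1 / 2) with hy | hy
  · have : round y = 0 := by
      have h2 : |(round y : ℝ)| < 1 := by linarith
      have h3 : |round y| < 1 := by exact_mod_cast h2
      exact Int.abs_lt_one_iff.1 h3
    rw [this]; simp
  · have h2 : (1 : ℝ) ≤ 2 * |y| := by linarith
    calc |(round y : ℝ)| ≤ 2 * |y| := by linarith
      _ ≤ (2 * |y|) ^ q := le_self_pow₀ h2 (by omega)

lemma sum_exp_neg_mul_abs_le {s : ℝ} (hs : 1 ≤ s) (M : ℕ) :
    ∑ z ∈ Finset.Icc (-(M : ℤ)) M, Real.exp (-(s * |(z : ℝ)|))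
      ≤ Real.exp (4 * Real.exp (-s)) := by
  set u := Real.exp (-s) with hu
  have hu0 : 0 < u := Real.exp_pos _
  have hu1 : u ≤ 1 / 2 := by
    have h1 : u ≤ Real.exp (-1) := Real.exp_le_exp.2 (by linarith)
    have h2 : Real.exp (-1) ≤ 1 / 2 := by
      rw [Real.exp_neg, inv_le_comm₀ (Real.exp_pos _) (by norm_num)]
      have := Real.exp_one_gt_d9; norm_num; linarith
    linarith
  have hz : ∀ m : ℕ, Real.exp (-(s * (m : ℝ))) = u ^ m := by
    intro m; rw [hu, ← Real.exp_nat_mul]; ring_nf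
  have key : ∀ M : ℕ, ∑ z ∈ Finset.Icc (-(M : ℤ)) M, Real.exp (-(s * |(z : ℝ)|))
      = 1 + 2 * ∑ m ∈ Finset.range M, u ^ (m + 1) := by
    intro M
    induction M with
    | zero => simp
    | succ M ih =>
      have hset : Finset.Icc (-((M + 1 : ℕ) : ℤ)) ((M + 1 : ℕ) : ℤ)
          = insert (-((M + 1 : ℕ) : ℤ)) (insert ((M + 1 : ℕ) : ℤ) (Finset.Icc (-(M : ℤ)) M)) := by
        ext z; simp only [Finset.mem_Icc, Finset.mem_insert]; push_cast; omega
      rw [hset, Finset.sum_insert, Finset.sum_insert, ih, Finset.sum_range_succ]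
      · have a1 : |(((-((M + 1 : ℕ) : ℤ)) : ℤ) : ℝ)| = ((M + 1 : ℕ) : ℝ) := by
          push_cast; rw [abs_neg, abs_of_nonneg (by positivity)]
        have a2 : |((((M + 1 : ℕ) : ℤ) : ℤ) : ℝ)| = ((M + 1 : ℕ) : ℝ) := by
          push_cast; rw [abs_of_nonneg (by positivity)]
        rw [a1, a2, hz]; ring
      · simp
      · simp only [Finset.mem_insert, Finset.mem_Icc]; push_cast; omega
  rw [key]
  have hg : ∑ m ∈ Finset.range M, u ^ (m + 1) ≤ 2 * u := by
    have h1 : ∑ m ∈ Finset.range M, u ^ (m + 1) = u * ∑ m ∈ Finset.range M, u ^ m := by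
      rw [Finset.mul_sum]; exact Finset.sum_congr rfl fun _ _ => by ring
    have h2 : ∑ m ∈ Finset.range M, u ^ m ≤ 2 := by
      have h3 : ∑ m ∈ Finset.range M, u ^ m ≤ ∑ m ∈ Finset.range M, (1 / 2 : ℝ) ^ m :=
        Finset.sum_le_sum fun m _ => pow_le_pow_left₀ hu0.le hu1 m
      have h4 : ∑ m ∈ Finset.range M, (1 / 2 : ℝ) ^ m ≤ 2 := sum_geometric_two_le M
      linarith
    rw [h1]; nlinarith
  have := Real.add_one_le_exp (4 * u)
  linarith

lemma card_hamming_ball_le {I : Type*} [Fintype I] [DecidableEq I] (e₀ : I → Bool)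
    (F : Finset (I → Bool)) {R : ℝ} (hF : ∀ e ∈ F, (#{i | e i ≠ e₀ i} : ℝ) ≤ R) :
    (#F : ℝ) ≤ Real.exp R * (1 + Real.exp (-1)) ^ Fintype.card I := by
  have hprod : ∑ e : I → Bool, Real.exp (-(#{i | e i ≠ e₀ i} : ℝ))
      = (1 + Real.exp (-1)) ^ Fintype.card I := by
    have h1 : ∀ e : I → Bool, Real.exp (-(#{i | e i ≠ e₀ i} : ℝ))
        = ∏ i, (if e i ≠ e₀ i then Real.exp (-1) else 1) := by
      intro e
      rw [Finset.prod_ite]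
      simp [← Real.exp_nat_mul]
    simp_rw [h1]
    have h2 := Finset.prod_univ_sum (ι := I) (fun _ => (univ : Finset Bool))
      (fun i (b : Bool) => if b ≠ e₀ i then Real.exp (-1) else 1)
    rw [Fintype.piFinset_univ] at h2
    rw [← h2]
    have h3 : ∀ i, ∑ b : Bool, (if b ≠ e₀ i then Real.exp (-1) else 1) = 1 + Real.exp (-1) := by
      intro i
      cases e₀ i <;> simp [add_comm]
    rw [Finset.prod_congr rfl fun i _ => h3 i]
    simp
  rw [← hprod, Finset.mul_sum]
  calc (#F : ℝ) = ∑ e ∈ F, (1 : ℝ) := by simp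
    _ ≤ ∑ e ∈ F, Real.exp R * Real.exp (-(#{i | e i ≠ e₀ i} : ℝ)) := by
        refine Finset.sum_le_sum fun e he => ?_
        rw [← Real.exp_add]
        exact Real.one_le_exp (by linarith [hF e he])
    _ ≤ _ := Finset.sum_le_univ_sum_of_nonneg fun e => by positivity

lemma card_image_le_exp {A C : Type*} [Fintype C] [DecidableEq C]
    (z : A → C → ℤ) (s : C → ℝ) (hs : ∀ c, 1 ≤ s c) (g : Finset A) {b : ℝ}
    (hb : ∀ e ∈ g, ∑ c, s c * |(z e c : ℝ)| ≤ b) :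
    (#(g.image z) : ℝ) ≤ Real.exp (b + ∑ c, 4 * Real.exp (-(s c))) := by
  classical
  obtain ⟨M, hM⟩ : ∃ M : ℕ, ∀ e ∈ g, ∀ c, z e c ∈ Finset.Icc (-(M : ℤ)) M := by
    refine ⟨∑ e ∈ g, ∑ c, (z e c).natAbs, fun e he c => ?_⟩
    have h1 : (z e c).natAbs ≤ ∑ c, (z e c).natAbs :=
      Finset.single_le_sum (f := fun c => (z e c).natAbs) (fun _ _ => Nat.zero_le _) (mem_univ c)
    have h2 := Finset.single_le_sum (f := fun e => ∑ c, (z e c).natAbs)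
      (fun _ _ => Nat.zero_le _) he
    rw [Finset.mem_Icc]
    omega
  have hsub : g.image z ⊆ Fintype.piFinset fun _ : C => Finset.Icc (-(M : ℤ)) M := by
    intro y hy
    obtain ⟨e, he, rfl⟩ := Finset.mem_image.1 hy
    exact Fintype.mem_piFinset.2 fun c => hM e he c
  calc (#(g.image z) : ℝ) = ∑ y ∈ g.image z, (1 : ℝ) := by simp
    _ ≤ ∑ y ∈ g.image z, Real.exp b * ∏ c, Real.exp (-(s c * |(y c : ℝ)|)) := by
        refine Finset.sum_le_sum fun y hy => ?_
        obtain ⟨e, he, rfl⟩ := Finset.mem_image.1 hy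
        rw [← Real.exp_sum, ← Real.exp_add, Finset.sum_neg_distrib]
        exact Real.one_le_exp (by linarith [hb e he])
    _ ≤ ∑ y ∈ Fintype.piFinset fun _ : C => Finset.Icc (-(M : ℤ)) M,
          Real.exp b * ∏ c, Real.exp (-(s c * |(y c : ℝ)|)) :=
        Finset.sum_le_sum_of_subset_of_nonneg hsub fun y _ _ => by positivity
    _ = Real.exp b * ∏ c, ∑ z ∈ Finset.Icc (-(M : ℤ)) M, Real.exp (-(s c * |(z : ℝ)|)) := by
        rw [← Finset.mul_sum, Finset.prod_univ_sum]
    _ ≤ Real.exp b * ∏ c, Real.exp (4 * Real.exp (-(s c))) := by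
        refine mul_le_mul_of_nonneg_left (Finset.prod_le_prod (fun c _ => by positivity)
          fun c _ => sum_exp_neg_mul_abs_le (hs c) M) (by positivity)
    _ = _ := by rw [← Real.exp_sum, ← Real.exp_add]

/-- Beck's partial colouring lemma with explicit entropy costs. -/
lemma exists_partial_coloring {I C : Type*} [Fintype I] [DecidableEq I] [Fintype C] (r : C → I → ℝ)
    (Δ τ s : C → ℝ) (q : C → ℕ) (hΔ : ∀ c, 0 < Δ c) (hτ : ∀ c, 0 ≤ τ c) (hs : ∀ c, 1 ≤ s c)
    (hq : ∀ c, 1 ≤ q c) (hr : ∀ c, ∑ i, r c i ^ 2 ≤ (τ c * Δ c) ^ 2)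
    (hcost : ∑ c, (4 * (q c).factorial * s c * τ c ^ q c + 4 * Real.exp (-(s c)))
      ≤ Fintype.card I / 100) (hI : 4 ≤ Fintype.card I) :
    ∃ χ : I → ℝ, (∀ i, χ i = -1 ∨ χ i = 0 ∨ χ i = 1) ∧
      Fintype.card I ≤ 8 * #{i | χ i ≠ 0} ∧ ∀ c, |∑ i, χ i * r c i| ≤ Δ c := by
  classical
  set n := Fintype.card I with hn
  set B := ∑ c, 4 * (q c).factorial * s c * τ c ^ q c with hB
  set E := ∑ c, 4 * Real.exp (-(s c)) with hE
  have hBE : B + E ≤ n / 100 := by rw [hB, hE, ← Finset.sum_add_distrib]; exact hcost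
  have hE0 : 0 ≤ E := Finset.sum_nonneg fun c _ => by positivity
  have hB0 : 0 ≤ B := Finset.sum_nonneg fun c _ => by
    have := hτ c; have := hs c; positivity
  let z : (I → Bool) → C → ℤ := fun e c => round ((∑ i, boolSign (e i) * r c i) / (2 * Δ c))
  let W : (I → Bool) → ℝ := fun e => ∑ c, s c * |(z e c : ℝ)|
  have hW0 : ∀ e, 0 ≤ W e := fun e => Finset.sum_nonneg fun c _ => by
    have := hs c; positivity
  have hWsum : ∑ e, W e ≤ B * 2 ^ n := by
    rw [Finset.sum_comm, hB, Finset.sum_mul]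
    refine Finset.sum_le_sum fun c _ => ?_
    have h1 := sum_abs_signed_sum_pow_le (r c) (mul_nonneg (hτ c) (hΔ c).le) (hr c) (hq c)
    have h2 : ∀ e, |(z e c : ℝ)| ≤ |∑ i, boolSign (e i) * r c i| ^ q c / Δ c ^ q c := by
      intro e
      refine (abs_round_le_pow _ (hq c)).trans (le_of_eq ?_)
      rw [← div_pow, abs_div, abs_of_pos (by have := hΔ c; positivity : 0 < 2 * Δ c)]
      congr 1; have := hΔ c; field_simp
    rw [← Finset.mul_sum]
    have h3 : ∑ e, |(z e c : ℝ)| ≤ 4 * (q c).factorial * τ c ^ q c * 2 ^ n := by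
      refine (Finset.sum_le_sum fun e _ => h2 e).trans ?_
      rw [← Finset.sum_div, div_le_iff₀ (pow_pos (hΔ c) _)]
      refine h1.trans (le_of_eq ?_)
      rw [mul_pow]; ring
    have h4 : 0 ≤ s c := by linarith [hs c]
    calc _ ≤ s c * (4 * (q c).factorial * τ c ^ q c * 2 ^ n) := by gcongr
      _ = _ := by ring
  set g : Finset (I → Bool) := {e | W e ≤ 2 * B} with hg
  have hgcard : (2 : ℝ) ^ n ≤ 2 * #g := by
    have hcompl : (#g : ℝ) + #{e | ¬ W e ≤ 2 * B} = 2 ^ n := by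
      have := Finset.card_filter_add_card_filter_not (s := (univ : Finset (I → Bool)))
        (fun e => W e ≤ 2 * B)
      rw [hg]
      have h2 : #(univ : Finset (I → Bool)) = 2 ^ n := by simp [hn]
      rw [h2] at this
      exact_mod_cast this
    set b : Finset (I → Bool) := {e | ¬ W e ≤ 2 * B} with hb
    have hmk : (#b : ℝ) * (2 * B) ≤ B * 2 ^ n := by
      refine le_trans ?_ hWsum
      calc (#b : ℝ) * (2 * B) = ∑ e ∈ b, 2 * B := by simp
        _ ≤ ∑ e ∈ b, W e := Finset.sum_le_sum fun e he => by
            rw [hb, Finset.mem_filter] at he; exact (not_le.1 he.2).le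
        _ ≤ _ := Finset.sum_le_univ_sum_of_nonneg hW0
    rcases hB0.eq_or_lt with h0 | hpos
    · have : b = ∅ := by
        rw [hb, Finset.filter_eq_empty_iff]
        intro e _
        rw [not_not]
        have h1 := Finset.single_le_sum (f := W) (fun e _ => hW0 e) (mem_univ e)
        rw [← h0] at hWsum ⊢
        linarith
      rw [this] at hcompl
      simp at hcompl
      have : (0 : ℝ) < 2 ^ n := by positivity
      linarith
    · have : (#b : ℝ) * 2 ≤ 2 ^ n := by
        refine le_of_mul_le_mul_right ?_ hpos
        linarith
      linarith
  have himg : (#(g.image z) : ℝ) ≤ Real.exp (n / 50) := by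
    refine (card_image_le_exp z s hs g (b := 2 * B) fun e he => ?_).trans ?_
    · rw [hg, Finset.mem_filter] at he; exact he.2
    · exact Real.exp_le_exp.2 (by linarith)
  have hgne : g.Nonempty := by
    rw [← Finset.card_pos]
    have : (0 : ℝ) < 2 ^ n := by positivity
    have h : (0 : ℝ) < #g := by linarith
    exact_mod_cast h
  obtain ⟨y, hy, hfib⟩ : ∃ y ∈ g.image z, (2 : ℝ) ^ n ≤
      2 * (Real.exp (n / 50) * #(g.filter fun e => z e = y)) := by
    by_contra! hcon
    have h1 : (#g : ℝ) = ∑ y ∈ g.image z, (#(g.filter fun e => z e = y) : ℝ) := by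
      exact_mod_cast Finset.card_eq_sum_card_image z g
    have h2 : ∑ y ∈ g.image z, 2 * (Real.exp (n / 50) * #(g.filter fun e => z e = y))
        < ∑ y ∈ g.image z, (2 : ℝ) ^ n :=
      Finset.sum_lt_sum_of_nonempty (hgne.image z) fun y hy => hcon y hy
    rw [← Finset.mul_sum, ← Finset.mul_sum, ← h1] at h2
    simp only [sum_const, nsmul_eq_mul] at h2
    have h3 : (#(g.image z) : ℝ) * 2 ^ n ≤ Real.exp (n / 50) * (2 * #g) := by gcongr
    linarith
  set F := g.filter fun e => z e = y with hF
  obtain ⟨e₀, he₀g, he₀⟩ := Finset.mem_image.1 hy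
  obtain ⟨e, heF, hdist⟩ : ∃ e ∈ F, (n : ℝ) / 8 < #{i | e i ≠ e₀ i} := by
    by_contra! hcon
    have h1 := card_hamming_ball_le e₀ F hcon
    rw [← hn] at h1
    have h2 : (2 : ℝ) ^ n ≤ 2 * (8 / 5) ^ n := by
      refine hfib.trans ?_
      have h3 : Real.exp (n / 50) * (Real.exp (n / 8) * (1 + Real.exp (-1)) ^ n)
          = (Real.exp (29 / 200) * (1 + Real.exp (-1))) ^ n := by
        rw [mul_pow, ← Real.exp_nat_mul, ← mul_assoc, ← Real.exp_add]
        congr 2; ring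
      have h4 : Real.exp (29 / 200) * (1 + Real.exp (-1)) ≤ 8 / 5 := by
        have h5 := Real.exp_neg_one_lt_d9
        have h6 : Real.exp (29 / 200) ≤ 200 / 171 := by
          have := Real.one_sub_le_exp_neg (29 / 200)
          rw [Real.exp_neg] at this
          have h7 := Real.exp_pos (29 / 200)
          rw [le_inv_comm₀ (by norm_num) h7] at this
          refine this.trans (by norm_num)
        calc Real.exp (29 / 200) * (1 + Real.exp (-1)) ≤ 200 / 171 * (1 + 0.3678794412) := by gcongr
          _ ≤ 8 / 5 := by norm_num
      have h5 : Real.exp (n / 50) * #F ≤ (8 / 5) ^ n := by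
        calc _ ≤ Real.exp (n / 50) * (Real.exp (n / 8) * (1 + Real.exp (-1)) ^ n) := by gcongr
          _ = _ := h3
          _ ≤ _ := by gcongr
      linarith
    have h3 : (2 : ℝ) ^ n = (5 / 4) ^ n * (8 / 5) ^ n := by rw [← mul_pow]; norm_num
    have h4 : (5 / 4 : ℝ) ^ 4 ≤ (5 / 4) ^ n := pow_le_pow_right₀ (by norm_num) hI
    have h5 : (0 : ℝ) < (8 / 5) ^ n := by positivity
    rw [h3] at h2
    have h6 := le_of_mul_le_mul_right h2 h5
    norm_num at h4
    linarith
  have hze : z e = z e₀ := by rw [hF, Finset.mem_filter] at heF; rw [heF.2, he₀]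
  refine ⟨fun i => (boolSign (e i) - boolSign (e₀ i)) / 2, fun i => ?_, ?_, fun c => ?_⟩
  · rcases Bool.eq_false_or_eq_true (e i) with h | h <;>
      rcases Bool.eq_false_or_eq_true (e₀ i) with h' | h' <;> norm_num [boolSign, h, h']
  · have h1 : (univ.filter fun i => (boolSign (e i) - boolSign (e₀ i)) / 2 ≠ 0)
        = univ.filter fun i => e i ≠ e₀ i := by
      ext i
      simp only [Finset.mem_filter, mem_univ, true_and]
      cases e i <;> cases e₀ i <;> norm_num [boolSign]
    rw [h1]
    have : (n : ℝ) ≤ ((8 * #{i | e i ≠ e₀ i} : ℕ) : ℝ) := by push_cast; linarith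
    exact_mod_cast this
  · have h1 : z e c = z e₀ c := congrFun hze c
    have h2 := abs_sub_round ((∑ i, boolSign (e i) * r c i) / (2 * Δ c))
    have h3 := abs_sub_round ((∑ i, boolSign (e₀ i) * r c i) / (2 * Δ c))
    have h4 : round ((∑ i, boolSign (e i) * r c i) / (2 * Δ c))
      = round ((∑ i, boolSign (e₀ i) * r c i) / (2 * Δ c)) := h1
    rw [h4] at h2
    set k : ℝ := (round ((∑ i, boolSign (e₀ i) * r c i) / (2 * Δ c)) : ℝ)
    set u := ∑ i, boolSign (e i) * r c i
    set v := ∑ i, boolSign (e₀ i) * r c i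
    have h5 : ∑ i, (boolSign (e i) - boolSign (e₀ i)) / 2 * r c i
        = Δ c * ((u / (2 * Δ c) - k) - (v / (2 * Δ c) - k)) := by
      have : Δ c ≠ 0 := (hΔ c).ne'
      have h6 : ∑ i, (boolSign (e i) - boolSign (e₀ i)) / 2 * r c i = (u - v) / 2 := by
        simp only [u, v]
        rw [← Finset.sum_sub_distrib, Finset.sum_div]
        exact Finset.sum_congr rfl fun i _ => by ring
      rw [h6]; field_simp; ring
    rw [h5, abs_mul, abs_of_pos (hΔ c)]
    have h7 := abs_sub (u / (2 * Δ c) - k) (v / (2 * Δ c) - k)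
    have : |(u / (2 * Δ c) - k) - (v / (2 * Δ c) - k)| ≤ 1 := by linarith
    nlinarith [hΔ c]

/-- One halving step: either the support shrinks by a factor `19/20`, while the preserved
functionals `h` and the value functionals `g` move by controlled amounts. -/
lemma exists_sparser {I B Γ : Type*} [Fintype I] [DecidableEq I] [Fintype B] [Fintype Γ]
    {h : B → I → ℝ} {ρ : B → ℝ} {b₀ : B} (hh : ∀ b i, h b i ∈ Set.Icc (0 : ℝ) 1)
    (hb₀ : ∀ i, h b₀ i = 1) (hρ₀ : ρ b₀ = 1) (hρ : ∀ b, 0 < ρ b)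
    {g : Γ → I → ℝ} {π : Γ → B} {κ η : Γ → ℝ} (hg : ∀ γ i, g γ i ^ 2 ≤ κ γ ^ 2 * h (π γ) i)
    (hη : ∀ γ, 0 < η γ) {Z : ℝ} (hZ : 0 < Z) {N : ℕ} (hN : 8 ≤ N)
    {τ s : Γ → ℝ} {q : Γ → ℕ} (hτ : ∀ γ, 0 ≤ τ γ) (hs : ∀ γ, 1 ≤ s γ) (hq : ∀ γ, 1 ≤ q γ)
    {τ' s' : B → ℝ} {q' : B → ℕ} (hτ' : ∀ γ, 0 ≤ τ' γ) (hs' : ∀ γ, 1 ≤ s' γ) (hq' : ∀ γ, 1 ≤ q' γ)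
    (hv : ∀ γ, 32 * κ γ ^ 2 * ρ (π γ) ≤ τ γ ^ 2 * η γ ^ 2 * N)
    (hp : ∀ b, 204800 ≤ τ' b ^ 2 * ρ b * N)
    (hcost : ∑ γ, (4 * (q γ).factorial * s γ * τ γ ^ q γ + 4 * Real.exp (-(s γ)))
      + ∑ b, (4 * (q' b).factorial * s' b * τ' b ^ q' b + 4 * Real.exp (-(s' b))) ≤ N / 200)
    {y : I → ℝ} (hy : ∀ i, 0 ≤ y i) (hyh : ∀ b, ∑ i, y i * h b i ≤ 2 * Z * ρ b)
    {u : ℕ} (hu : N ≤ (#{i | y i ≠ 0} : ℝ) * (79 / 80) ^ (4 * u)) :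
    ∃ y' : I → ℝ, (∀ i, 0 ≤ y' i) ∧ (#{i | y' i ≠ 0} : ℝ) ≤ 19 / 20 * #{i | y i ≠ 0} ∧
      (∀ b, ∑ i, y' i * h b i ≤ ∑ i, y i * h b i + Z * ρ b * (1 / 80 * (79 / 80) ^ u)) ∧
      ∀ γ, |∑ i, (y i - y' i) * g γ i| ≤ η γ * Z * (79 / 80) ^ (2 * u) := by
  classical
  set n := #{i | y i ≠ 0} with hn
  have hζ0 : (0 : ℝ) < (79 / 80) ^ u := by positivity
  have hNn : (N : ℝ) ≤ n := by
    refine hu.trans (mul_le_of_le_one_right (by positivity)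
      (pow_le_one₀ (by norm_num) (by norm_num)))
  have hN0 : (8 : ℝ) ≤ N := by exact_mod_cast hN
  have hn0 : (0 : ℝ) < n := by linarith
  set A : Finset I := {i | y i ≠ 0 ∧ y i ≤ 16 * Z / n} with hA
  have hsum : ∑ i, y i ≤ 2 * Z := by
    have := hyh b₀
    simpa [hb₀, hρ₀] using this
  have hAcard : 7 / 8 * (n : ℝ) ≤ #A := by
    set A' : Finset I := {i | y i ≠ 0 ∧ ¬ y i ≤ 16 * Z / n} with hA'
    have h1 : #A + #A' = n := by
      rw [hA, hA', hn, ← Finset.filter_filter, ← Finset.filter_filter]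
      exact Finset.card_filter_add_card_filter_not _
    have h2 : (#A' : ℝ) * (16 * Z / n) ≤ 2 * Z := by
      refine le_trans ?_ hsum
      calc (#A' : ℝ) * (16 * Z / n) = ∑ i ∈ A', 16 * Z / n := by simp
        _ ≤ ∑ i ∈ A', y i := Finset.sum_le_sum fun i hi => by
            rw [hA', Finset.mem_filter] at hi; exact (not_le.1 hi.2.2).le
        _ ≤ _ := Finset.sum_le_univ_sum_of_nonneg hy
    have h3 : (#A' : ℝ) * 8 ≤ n := by
      have : (#A' : ℝ) * (16 * Z / n) = (#A' * 8 / n) * (2 * Z) := by ring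
      rw [this] at h2
      have h4 : (#A' * 8 / n : ℝ) ≤ 1 := by
        refine le_of_mul_le_mul_right ?_ (by positivity : 0 < 2 * Z); linarith
      rwa [div_le_one hn0] at h4
    have h5 : (#A : ℝ) + #A' = n := by exact_mod_cast h1
    linarith
  let r : Γ ⊕ B → A → ℝ := Sum.elim (fun γ i => y i * g γ i) (fun b i => y i * h b i)
  have hsq : ∀ (b : B) (f : I → ℝ) (k : ℝ), 0 ≤ k → (∀ i, f i ^ 2 ≤ k * h b i) →
      ∑ i : A, (y i * f i) ^ 2 ≤ 32 * Z ^ 2 * k * ρ b / n := by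
    intro b f k hk hf
    calc ∑ i : A, (y i * f i) ^ 2 ≤ ∑ i : A, (16 * Z / n * k) * (y i * h b i) := by
          refine Finset.sum_le_sum fun i _ => ?_
          have hi := (Finset.mem_filter.1 i.2).2.2
          have h1 : 0 ≤ k * h b i := mul_nonneg hk (hh b i).1
          calc (y i * f i) ^ 2 = y i * (y i * f i ^ 2) := by ring
            _ ≤ (16 * Z / n) * (y i * (k * h b i)) := by
                have := hy i; have := hf i
                gcongr
            _ = _ := by ring
      _ = (16 * Z / n * k) * ∑ i : A, y i * h b i := by rw [Finset.mul_sum]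
      _ ≤ (16 * Z / n * k) * (2 * Z * ρ b) := by
          refine mul_le_mul_of_nonneg_left (le_trans ?_ (hyh b)) (by positivity)
          rw [Finset.sum_coe_sort A (fun i => y i * h b i)]
          exact Finset.sum_le_univ_sum_of_nonneg fun i => mul_nonneg (hy i) (hh b i).1
      _ = _ := by ring
  obtain ⟨χ, hχ, hχn, hχr⟩ := exists_partial_coloring r
    (Sum.elim (fun γ => η γ * Z * (79 / 80) ^ (2 * u))
      (fun b => Z * ρ b * (1 / 80 * (79 / 80) ^ u)))
    (Sum.elim τ τ') (Sum.elim s s') (Sum.elim q q')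
    (by rintro (γ | b)
        · have := hη γ; simp only [Sum.elim_inl]; positivity
        · have := hρ b; simp only [Sum.elim_inr]; positivity)
    (by rintro (γ | b); exacts [hτ γ, hτ' b])
    (by rintro (γ | b); exacts [hs γ, hs' b])
    (by rintro (γ | b); exacts [hq γ, hq' b])
    (by
      rintro (γ | b)
      · refine (hsq (π γ) (g γ) (κ γ ^ 2) (sq_nonneg _) (hg γ)).trans ?_
        simp only [Sum.elim_inl]
        rw [div_le_iff₀ hn0]
        calc 32 * Z ^ 2 * κ γ ^ 2 * ρ (π γ) = Z ^ 2 * (32 * κ γ ^ 2 * ρ (π γ)) := by ring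
          _ ≤ Z ^ 2 * (τ γ ^ 2 * η γ ^ 2 * (n * (79 / 80) ^ (4 * u))) := by
              refine mul_le_mul_of_nonneg_left ((hv γ).trans ?_) (by positivity)
              gcongr
          _ = _ := by rw [show 4 * u = 2 * u * 2 by ring, pow_mul _ (2 * u)]; ring
      · refine (hsq b (h b) 1 zero_le_one fun i => ?_).trans ?_
        · have := hh b i
          rw [one_mul, sq]
          exact mul_le_of_le_one_right this.1 this.2
        simp only [Sum.elim_inr]
        rw [div_le_iff₀ hn0]
        have h1 : (N : ℝ) ≤ n * (79 / 80) ^ (2 * u) := by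
          refine hu.trans ?_
          gcongr ?_ * ?_
          exact pow_le_pow_of_le_one (by norm_num) (by norm_num) (by omega)
        have h2 : 204800 ≤ τ' b ^ 2 * ρ b * (n * (79 / 80) ^ (2 * u)) := by
          refine (hp b).trans ?_
          have := hρ b
          gcongr
        calc 32 * Z ^ 2 * 1 * ρ b = Z ^ 2 * ρ b / 6400 * 204800 := by ring
          _ ≤ Z ^ 2 * ρ b / 6400 * (τ' b ^ 2 * ρ b * (n * (79 / 80) ^ (2 * u))) := by
              have := hρ b
              gcongr
          _ = _ := by rw [mul_comm 2 u, pow_mul]; ring)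
    (by
      rw [Fintype.sum_sum_type]
      simp only [Sum.elim_inl, Sum.elim_inr, Fintype.card_coe]
      linarith)
    (by
      rw [Fintype.card_coe]
      have : (4 : ℝ) ≤ #A := by linarith
      exact_mod_cast this)
  rw [Fintype.card_coe] at hχn
  -- choose the sign for which at least half of the colours are `-1`
  obtain ⟨χ, hχ, hχn, hχr⟩ : ∃ χ : A → ℝ, (∀ i, χ i = -1 ∨ χ i = 0 ∨ χ i = 1) ∧
      #A ≤ 16 * #{i | χ i = -1} ∧ ∀ c, |∑ i, χ i * r c i| ≤
        (Sum.elim (fun γ => η γ * Z * (79 / 80) ^ (2 * u))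
      (fun b => Z * ρ b * (1 / 80 * (79 / 80) ^ u)) : Γ ⊕ B → ℝ) c := by
    have h1 : #{i | χ i ≠ 0} ≤ #{i | χ i = -1} + #{i | χ i = 1} := by
      refine (Finset.card_le_card ?_).trans (Finset.card_union_le _ _)
      intro i hi
      simp only [Finset.mem_filter, mem_univ, true_and, Finset.mem_union] at hi ⊢
      rcases hχ i with h | h | h
      · exact Or.inl h
      · exact absurd h hi
      · exact Or.inr h
    rcases le_total #{i | χ i = 1} #{i | χ i = -1} with h2 | h2
    · exact ⟨χ, hχ, by omega, hχr⟩
    · refine ⟨fun i => -χ i, fun i => ?_, ?_, fun c => ?_⟩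
      · rcases hχ i with h | h | h <;> simp [h]
      · have : (univ.filter fun i => -χ i = -1) = univ.filter fun i => χ i = 1 := by
          ext i; simp
        rw [this]; omega
      · simpa [Finset.sum_neg_distrib] using hχr c
  let X : I → ℝ := fun i => if hi : i ∈ A then χ ⟨i, hi⟩ else 0
  have hXsum : ∀ f : I → ℝ, ∑ i, X i * (y i * f i) = ∑ i : A, χ i * (y i * f i) := by
    intro f
    rw [← Finset.sum_subset (Finset.subset_univ A), ← Finset.sum_coe_sort]
    · exact Finset.sum_congr rfl fun i _ => by simp [X]
    · intro i _ hi; simp [X, hi]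
  refine ⟨fun i => y i * (1 + X i), fun i => mul_nonneg (hy i) ?_, ?_, fun b => ?_, fun γ => ?_⟩
  · by_cases hi : i ∈ A
    · rcases hχ ⟨i, hi⟩ with h | h | h <;> simp [X, hi, h]
    · simp [X, hi]
  · set K : Finset I := {i | y i ≠ 0 ∧ X i = -1} with hK
    have h1 : #{i : A | χ i = -1} = #K := by
      refine Finset.card_bij (fun i _ => i.1) ?_ ?_ ?_
      · intro i hi
        have h2 := (Finset.mem_filter.1 hi).2
        refine Finset.mem_filter.2 ⟨mem_univ _, (Finset.mem_filter.1 i.2).2.1, ?_⟩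
        simp [X, h2]
      · intro i _ j _ hij; exact Subtype.ext hij
      · intro i hi
        have h2 := (Finset.mem_filter.1 hi).2
        by_cases hiA : i ∈ A
        · refine ⟨⟨i, hiA⟩, ?_, rfl⟩
          have := h2.2
          simp only [X, hiA, dif_pos] at this
          simp [this]
        · have := h2.2
          simp only [X, hiA, dif_neg, not_false_eq_true] at this
          norm_num at this
    have h2 : #{i | y i * (1 + X i) ≠ 0} + #K ≤ n := by
      rw [← Finset.card_union_of_disjoint, hn]
      · refine Finset.card_le_card fun i hi => ?_
        simp only [Finset.mem_union, Finset.mem_filter, mem_univ, true_and, hK] at hi ⊢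
        rcases hi with h | h
        · exact left_ne_zero_of_mul h
        · exact h.1
      · rw [Finset.disjoint_left]
        intro i hi hi'
        simp only [Finset.mem_filter, mem_univ, true_and, hK] at hi hi'
        apply hi; rw [hi'.2]; ring
    have h3 : (#A : ℝ) ≤ 16 * #K := by rw [h1] at hχn; exact_mod_cast hχn
    have h4 : (#{i | y i * (1 + X i) ≠ 0} : ℝ) + #K ≤ n := by exact_mod_cast h2
    linarith
  · have h1 := hχr (Sum.inr b)
    simp only [Sum.elim_inr, r] at h1
    rw [← hXsum] at h1
    have h2 : ∑ i, y i * (1 + X i) * h b i = ∑ i, y i * h b i + ∑ i, X i * (y i * h b i) := by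
      rw [← Finset.sum_add_distrib]; exact Finset.sum_congr rfl fun i _ => by ring
    rw [h2]
    linarith [le_abs_self (∑ i, X i * (y i * h b i))]
  · have h1 := hχr (Sum.inl γ)
    simp only [Sum.elim_inl, r] at h1
    rw [← hXsum] at h1
    have h2 : ∑ i, (y i - y i * (1 + X i)) * g γ i = -∑ i, X i * (y i * g γ i) := by
      rw [← Finset.sum_neg_distrib]; exact Finset.sum_congr rfl fun i _ => by ring
    rw [h2, abs_neg]
    exact h1

/-- Sparsification of a nonnegative combination by iterated partial colouring. -/
lemma exists_sparse {I B Γ : Type*} [Fintype I] [DecidableEq I] [Fintype B] [Fintype Γ]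
    {h : B → I → ℝ} {ρ : B → ℝ} {b₀ : B} (hh : ∀ b i, h b i ∈ Set.Icc (0 : ℝ) 1)
    (hb₀ : ∀ i, h b₀ i = 1) (hρ₀ : ρ b₀ = 1) (hρ : ∀ b, 0 < ρ b)
    {g : Γ → I → ℝ} {π : Γ → B} {κ η : Γ → ℝ} (hg : ∀ γ i, g γ i ^ 2 ≤ κ γ ^ 2 * h (π γ) i)
    (hη : ∀ γ, 0 < η γ) {Z : ℝ} (hZ : 0 < Z) {N : ℕ} (hN : 8 ≤ N)
    {τ s : Γ → ℝ} {q : Γ → ℕ} (hτ : ∀ γ, 0 ≤ τ γ) (hs : ∀ γ, 1 ≤ s γ) (hq : ∀ γ, 1 ≤ q γ)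
    {τ' s' : B → ℝ} {q' : B → ℕ} (hτ' : ∀ γ, 0 ≤ τ' γ) (hs' : ∀ γ, 1 ≤ s' γ) (hq' : ∀ γ, 1 ≤ q' γ)
    (hv : ∀ γ, 32 * κ γ ^ 2 * ρ (π γ) ≤ τ γ ^ 2 * η γ ^ 2 * N)
    (hp : ∀ b, 204800 ≤ τ' b ^ 2 * ρ b * N)
    (hcost : ∑ γ, (4 * (q γ).factorial * s γ * τ γ ^ q γ + 4 * Real.exp (-(s γ)))
      + ∑ b, (4 * (q' b).factorial * s' b * τ' b ^ q' b + 4 * Real.exp (-(s' b))) ≤ N / 200)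
    {x : I → ℝ} (hx : ∀ i, 0 ≤ x i) (hxh : ∀ b, ∑ i, x i * h b i ≤ Z * ρ b) :
    ∃ x' : I → ℝ, (∀ i, 0 ≤ x' i) ∧ #{i | x' i ≠ 0} ≤ N ∧
      (∀ b, ∑ i, x' i * h b i ≤ 2 * Z * ρ b) ∧
      ∀ γ, |∑ i, (x i - x' i) * g γ i| ≤ 80 * η γ * Z := by
  classical
  have key : ∀ t : ℕ, ∀ y : I → ℝ, (∀ i, 0 ≤ y i) →
      (#{i | y i ≠ 0} : ℝ) * (19 / 20) ^ t ≤ N →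
      (∀ b, ∑ i, y i * h b i ≤ Z * ρ b * (1 + (79 / 80) ^ t)) →
      ∃ x' : I → ℝ, (∀ i, 0 ≤ x' i) ∧ #{i | x' i ≠ 0} ≤ N ∧
        (∀ b, ∑ i, x' i * h b i ≤ 2 * Z * ρ b) ∧
        ∀ γ, |∑ i, (y i - x' i) * g γ i| ≤ η γ * Z * ∑ u ∈ range t, (79 / 80 : ℝ) ^ (2 * u) := by
    intro t
    induction t with
    | zero =>
      intro y hy hyN hyh
      refine ⟨y, hy, ?_, fun b => (hyh b).trans (le_of_eq ?_), fun γ => ?_⟩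
      · simpa using hyN
      · ring
      · simp
    | succ t ih =>
      intro y hy hyN hyh
      rcases le_or_gt ((#{i | y i ≠ 0} : ℝ) * (19 / 20) ^ t) N with hle | hlt
      · obtain ⟨x', h1, h2, h3, h4⟩ := ih y hy hle fun b => (hyh b).trans <| by
          have := hρ b
          gcongr ?_ * (1 + ?_)
          exact pow_le_pow_of_le_one (by norm_num) (by norm_num) (by omega)
        refine ⟨x', h1, h2, h3, fun γ => (h4 γ).trans ?_⟩
        have := hη γ
        rw [Finset.sum_range_succ]
        gcongr
        linarith [show (0 : ℝ) < (79 / 80) ^ (2 * t) by positivity]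
      · obtain ⟨y', h1, h2, h3, h4⟩ := exists_sparser hh hb₀ hρ₀ hρ hg hη hZ hN hτ hs hq
          hτ' hs' hq' hv hp hcost hy (u := t) (fun b => (hyh b).trans <| by
            have := hρ b
            have h1 : (79 / 80 : ℝ) ^ (t + 1) ≤ 1 := pow_le_one₀ (by norm_num) (by norm_num)
            nlinarith [mul_pos hZ this])
          (hlt.le.trans <| by
            rw [pow_mul]
            gcongr
            norm_num)
        obtain ⟨x', g1, g2, g3, g4⟩ := ih y' h1
          (by
            rw [pow_succ] at hyN
            calc _ ≤ 19 / 20 * (#{i | y i ≠ 0} : ℝ) * (19 / 20) ^ t := by gcongr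
              _ ≤ _ := by linarith)
          (fun b => (h3 b).trans <| by
            have := hyh b
            rw [pow_succ] at this
            linarith)
        refine ⟨x', g1, g2, g3, fun γ => ?_⟩
        have h5 : ∑ i, (y i - x' i) * g γ i
            = ∑ i, (y' i - x' i) * g γ i + ∑ i, (y i - y' i) * g γ i := by
          rw [← Finset.sum_add_distrib]; exact Finset.sum_congr rfl fun i _ => by ring
        rw [h5, Finset.sum_range_succ, mul_add]
        exact (abs_add_le _ _).trans (add_le_add (g4 γ) (h4 γ))
  obtain ⟨t, ht⟩ : ∃ t : ℕ, (19 / 20 : ℝ) ^ t * (#{i | x i ≠ 0} + 1) < N := by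
    have hN0 : (0 : ℝ) < N := by exact_mod_cast (by omega : 0 < N)
    obtain ⟨t, ht⟩ := exists_pow_lt_of_lt_one (y := (19 / 20 : ℝ))
      (show (0 : ℝ) < N / (#{i | x i ≠ 0} + 1) by positivity) (by norm_num)
    exact ⟨t, by rwa [lt_div_iff₀ (by positivity)] at ht⟩
  obtain ⟨x', h1, h2, h3, h4⟩ := key t x hx
    (by have : (0 : ℝ) < (19 / 20) ^ t := by positivity
        nlinarith)
    (fun b => (hxh b).trans <| by
      have := hρ b
      have h0 : (0 : ℝ) < (79 / 80) ^ t := by positivity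
      nlinarith [mul_pos (mul_pos hZ this) h0])
  refine ⟨x', h1, h2, h3, fun γ => (h4 γ).trans ?_⟩
  have hgeo : ∑ u ∈ range t, (79 / 80 : ℝ) ^ (2 * u) ≤ 80 := by
    have h5 : ∑ u ∈ range t, (79 / 80 : ℝ) ^ (2 * u) ≤ ∑ u ∈ range t, (79 / 80 : ℝ) ^ u :=
      Finset.sum_le_sum fun u _ => pow_le_pow_of_le_one (by norm_num) (by norm_num) (by omega)
    rw [geom_sum_eq (by norm_num)] at h5
    have h6 : (0 : ℝ) < (79 / 80) ^ t := by positivity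
    have h7 : ((79 / 80 : ℝ) ^ t - 1) / (79 / 80 - 1) = 80 * (1 - (79 / 80) ^ t) := by ring
    rw [h7] at h5; linarith
  have := hη γ
  calc _ ≤ η γ * Z * 80 := by gcongr
    _ = _ := by ring

/-- The index of the dyadic cell of side `2⁻ʲ` of the unit cube containing `X`. -/
noncomputable def cellIndex {d : ℕ} (j : ℕ) (X : Fin d → ℝ) (a : Fin d) : ℕ :=
  min ⌊2 ^ j * X a⌋₊ (2 ^ j - 1)

/-- The lower corner of a dyadic cell. -/
noncomputable def cellCorner {d : ℕ} (j : ℕ) (q : Fin d → ℕ) (a : Fin d) : ℝ := q a / 2 ^ j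

/-- The slope at `y` of the ridge `σ(w·X - β)`. -/
noncomputable def ridgeAct {d : ℕ} (w : Fin d → ℝ) (β : ℝ) (y : Fin d → ℝ) : ℝ :=
  if 0 < w ⬝ᵥ y - β then 1 else 0

/-- Indicator that the hyperplane `w·X = β` passes within `2⁻ʲ` of `y`. -/
noncomputable def crossing {d : ℕ} (w : Fin d → ℝ) (β : ℝ) (j : ℕ) (y : Fin d → ℝ) : ℝ :=
  if |w ⬝ᵥ y - β| ≤ (1 / 2) ^ j then 1 else 0

lemma crossing_mem {d : ℕ} (w : Fin d → ℝ) (β : ℝ) (j : ℕ) (y : Fin d → ℝ) :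
    crossing w β j y ∈ Set.Icc (0 : ℝ) 1 := by
  unfold crossing; split_ifs <;> simp

lemma cellIndex_lt {d : ℕ} (j : ℕ) (X : Fin d → ℝ) (a : Fin d) : cellIndex j X a < 2 ^ j := by
  have : 0 < 2 ^ j := by positivity
  unfold cellIndex; omega

lemma cellIndex_succ_div_two {d : ℕ} (j : ℕ) (X : Fin d → ℝ) (a : Fin d) :
    cellIndex (j + 1) X a / 2 = cellIndex j X a := by
  unfold cellIndex
  have h : ⌊2 ^ (j + 1) * X a⌋₊ / 2 = ⌊2 ^ j * X a⌋₊ := by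
    have := Nat.floor_div_natCast (2 ^ (j + 1) * X a) 2
    rw [← this]
    congr 1; push_cast; rw [pow_succ]; ring
  have : 0 < 2 ^ j := by positivity
  rw [← h, pow_succ]
  omega

lemma sub_cellCorner_mem {d : ℕ} (j : ℕ) {X : Fin d → ℝ} (hX : X ∈ Set.Icc (0 : Fin d → ℝ) 1)
    (a : Fin d) : X a - cellCorner j (cellIndex j X) a ∈ Set.Icc (0 : ℝ) ((1 / 2) ^ j) := by
  have h0 : 0 ≤ X a := hX.1 a
  have h1 : X a ≤ 1 := hX.2 a
  have hP : (0 : ℝ) < 2 ^ j := by positivity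
  have hPn : 1 ≤ 2 ^ j := Nat.one_le_two_pow
  unfold cellCorner cellIndex
  set m := ⌊2 ^ j * X a⌋₊ with hm
  have hle : (m : ℝ) ≤ 2 ^ j * X a := Nat.floor_le (by positivity)
  have hlt : 2 ^ j * X a < m + 1 := Nat.lt_floor_add_one _
  have e1 : X a - ((min m (2 ^ j - 1) : ℕ) : ℝ) / 2 ^ j
      = (2 ^ j * X a - ((min m (2 ^ j - 1) : ℕ) : ℝ)) * (1 / 2) ^ j := by
    rw [one_div, inv_pow]; field_simp
  have e2 : (((min m (2 ^ j - 1)) : ℕ) : ℝ) ≤ 2 ^ j * X a := by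
    refine le_trans ?_ hle
    exact_mod_cast min_le_left _ _
  have e3 : 2 ^ j * X a ≤ ((min m (2 ^ j - 1) : ℕ) : ℝ) + 1 := by
    rcases le_total m (2 ^ j - 1) with h | h
    · rw [min_eq_left h]; exact hlt.le
    · rw [min_eq_right h, Nat.cast_sub hPn]
      push_cast
      nlinarith
  rw [e1]
  have hh : (0 : ℝ) < (1 / 2) ^ j := by positivity
  constructor
  · exact mul_nonneg (by linarith) hh.le
  · nlinarith

lemma cellCorner_child_sub_mem {d : ℕ} (j : ℕ) (q : Fin d → ℕ) (a : Fin d) :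
    |cellCorner (j + 1) q a - cellCorner j (fun a => q a / 2) a| ≤ (1 / 2) ^ j := by
  unfold cellCorner
  have hP : (0 : ℝ) < 2 ^ j := by positivity
  have e1 : (q a : ℝ) / 2 ^ (j + 1) - ((q a / 2 : ℕ) : ℝ) / 2 ^ j
      = ((q a % 2 : ℕ) : ℝ) / 2 * (1 / 2) ^ j := by
    have : (q a : ℝ) = 2 * ((q a / 2 : ℕ) : ℝ) + ((q a % 2 : ℕ) : ℝ) := by
      exact_mod_cast (Nat.div_add_mod (q a) 2).symm
    rw [this, one_div, inv_pow, pow_succ]; field_simp; ring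
  have hle : ((q a % 2 : ℕ) : ℝ) ≤ 1 := by
    have : q a % 2 ≤ 1 := by omega
    exact_mod_cast this
  rw [e1, abs_of_nonneg (by positivity)]
  have hh : (0 : ℝ) < (1 / 2) ^ j := by positivity
  nlinarith

lemma abs_dotProduct_sub_le {d : ℕ} {w : Fin d → ℝ} (hw : ∑ a, |w a| ≤ 1) {y y' : Fin d → ℝ} {r : ℝ}
    (hy : ∀ a, |y' a - y a| ≤ r) (hr : 0 ≤ r) : |w ⬝ᵥ y' - w ⬝ᵥ y| ≤ r := by
  rw [← dotProduct_sub]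
  unfold dotProduct
  calc |∑ a, w a * (y' - y) a| ≤ ∑ a, |w a * (y' - y) a| := Finset.abs_sum_le_sum_abs _ _
    _ ≤ ∑ a, |w a| * r := by
        refine Finset.sum_le_sum fun a _ => ?_
        rw [abs_mul]
        exact mul_le_mul_of_nonneg_left (hy a) (abs_nonneg _)
    _ ≤ r := by rw [← Finset.sum_mul]; nlinarith

lemma ridgeAct_sub_bounds {d : ℕ} {w : Fin d → ℝ} (hw : ∑ a, |w a| ≤ 1) (β : ℝ)
    {y y' : Fin d → ℝ} {j : ℕ} (hy : ∀ a, |y' a - y a| ≤ (1 / 2) ^ j) :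
    |ridgeAct w β y' - ridgeAct w β y| ≤ crossing w β j y ∧
      |(ridgeAct w β y' - ridgeAct w β y) * (w ⬝ᵥ y' - β)| ≤ (1 / 2) ^ j * crossing w β j y := by
  have h0 : (0 : ℝ) < (1 / 2) ^ j := by positivity
  have h := abs_le.1 (abs_dotProduct_sub_le hw hy h0.le)
  unfold ridgeAct crossing
  split_ifs with h1 h2 h3 h3 h2 h3 h3 <;> simp only [sub_self, abs_zero, zero_mul, sub_zero,
    zero_sub, abs_neg, abs_one, one_mul, mul_one, mul_zero, neg_mul, le_refl, and_self, zero_le_one,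
    true_and, h0.le]
  all_goals first
    | (rw [abs_le]; constructor <;> linarith)
    | (exfalso; apply h3; rw [abs_le]; constructor <;> linarith)

lemma abs_relu_sub_jet_le {d : ℕ} {w : Fin d → ℝ} (hw : ∑ a, |w a| ≤ 1) (β : ℝ)
    {y X : Fin d → ℝ} {j : ℕ} (hy : ∀ a, |X a - y a| ≤ (1 / 2) ^ j) :
    |max 0 (w ⬝ᵥ X - β) - ridgeAct w β y * (w ⬝ᵥ X - β)| ≤ (1 / 2) ^ j * crossing w β j y := by
  have h := (ridgeAct_sub_bounds hw β hy).2
  have h1 : max 0 (w ⬝ᵥ X - β) = ridgeAct w β X * (w ⬝ᵥ X - β) := by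
    unfold ridgeAct
    split_ifs with h
    · rw [max_eq_right h.le, one_mul]
    · rw [max_eq_left (not_lt.1 h), zero_mul]
  rwa [h1, ← sub_mul]

lemma sum_range_pow_dist_le {r : ℝ} (h0 : 0 ≤ r) (h1 : r < 1) (K n : ℕ) :
    ∑ j ∈ range n, r ^ ((K - j) + (j - K)) ≤ 2 / (1 - r) := by
  have hgeo : ∀ m, ∑ i ∈ range m, r ^ i ≤ 1 / (1 - r) := fun m => by
    have h2 : 0 < 1 - r := by linarith
    rw [le_div_iff₀ h2, geom_sum_mul_neg]
    linarith [pow_nonneg h0 m]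
  calc ∑ j ∈ range n, r ^ ((K - j) + (j - K)) ≤ ∑ j ∈ range (K + n), r ^ ((K - j) + (j - K)) :=
        Finset.sum_le_sum_of_subset_of_nonneg (by simp) fun _ _ _ => by positivity
    _ = ∑ j ∈ range K, r ^ (j + 1) + ∑ i ∈ range n, r ^ i := by
        rw [Finset.sum_range_add, ← Finset.sum_range_reflect]
        congr 1
        · refine Finset.sum_congr rfl fun j hj => ?_
          rw [Finset.mem_range] at hj
          congr 1; omega
        · refine Finset.sum_congr rfl fun j hj => ?_
          congr 1; omega
    _ ≤ ∑ j ∈ range K, r ^ j + ∑ i ∈ range n, r ^ i := by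
        gcongr ?_ + _
        exact Finset.sum_le_sum fun j _ => pow_le_pow_of_le_one h0 h1.le (by omega)
    _ ≤ 1 / (1 - r) + 1 / (1 - r) := add_le_add (hgeo _) (hgeo _)
    _ = _ := by ring

/-- Deviation scale, in standard deviations, allowed at level `j` around the critical level `K`. -/
noncomputable def levelDev (K j : ℕ) : ℝ := (17 / 5) ^ (K - j) * (7 / 8) ^ (j - K)

/-- Entropy weight at level `j`. -/
noncomputable def levelWeight (d K j : ℕ) : ℝ := 1 + (d + 1) * ((j - K : ℕ) : ℝ)

/-- Moment used at level `j`. -/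
def levelMoment (d K j : ℕ) : ℕ := if j < K then 1 else 6 * (d + 3)

/-- Entropy cost at level `j`. -/
noncomputable def levelCost (d K j : ℕ) : ℝ :=
  4 * (levelMoment d K j).factorial * levelWeight d K j * levelDev K j ^ levelMoment d K j
    + 4 * Real.exp (-(levelWeight d K j))

lemma two_pow_mul_levelCost_le {d : ℕ} (hd : 2 ≤ d) (K j : ℕ) :
    2 ^ (d * (j + 1)) * levelCost d K j ≤ 2 ^ (d * K) *
      (2 ^ d * (8 + 4 * (6 * (d + 3)).factorial * (d + 2) + 4)) *
        (17 / 20) ^ ((K - j) + (j - K)) := by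
  have hd2 : (4 : ℝ) ≤ 2 ^ d := by
    calc (4 : ℝ) = 2 ^ 2 := by norm_num
      _ ≤ 2 ^ d := pow_le_pow_right₀ (by norm_num) hd
  unfold levelCost levelMoment levelWeight levelDev
  split_ifs with hj
  · obtain ⟨l, rfl⟩ := Nat.exists_eq_add_of_lt hj
    have e1 : j + l + 1 - j = l + 1 := by omega
    have e2 : j - (j + l + 1) = 0 := by omega
    rw [e1, e2]
    simp only [Nat.factorial_one, Nat.cast_one, mul_one, Nat.cast_zero, mul_zero, add_zero,
        pow_zero,
      pow_one]
    have h1 : Real.exp (-1) ≤ 1 := Real.exp_le_one_iff.2 (by norm_num)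
    have h2 : (1 : ℝ) ≤ (17 / 5) ^ (l + 1) := one_le_pow₀ (by norm_num)
    have h3 : (17 / 5 : ℝ) ^ (l + 1) ≤ (2 ^ d * (17 / 20)) ^ (l + 1) := by
      refine pow_le_pow_left₀ (by norm_num) ?_ _; linarith
    calc (2 : ℝ) ^ (d * (j + 1)) * (4 * (17 / 5) ^ (l + 1) + 4 * Real.exp (-1))
        ≤ 2 ^ (d * (j + 1)) * (8 * (2 ^ d * (17 / 20)) ^ (l + 1)) := by gcongr; linarith
      _ = 2 ^ (d * (j + l + 1)) * (2 ^ d * 8) * (17 / 20) ^ (l + 1) := by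
          rw [mul_pow, ← pow_mul]; ring
      _ ≤ _ := by
          gcongr
          have : (0 : ℝ) ≤ 4 * (6 * (d + 3)).factorial * (d + 2) := by positivity
          linarith
  · obtain ⟨l, rfl⟩ := Nat.exists_eq_add_of_le (not_lt.1 hj)
    have e1 : K - (K + l) = 0 := by omega
    have e2 : K + l - K = l := by omega
    rw [e1, e2]
    simp only [pow_zero, one_mul, zero_add]
    have h1 : ((7 / 8 : ℝ) ^ l) ^ (6 * (d + 3)) ≤ (1 / 2) ^ ((d + 3) * l) := by
      have : ((7 / 8 : ℝ) ^ l) ^ (6 * (d + 3)) = ((7 / 8) ^ 6) ^ ((d + 3) * l) := by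
        rw [← pow_mul, ← pow_mul]; congr 1; ring
      rw [this]
      exact pow_le_pow_left₀ (by norm_num) (by norm_num) _
    have h2 : (1 + (d + 1) * (l : ℝ)) ≤ (d + 2) * 2 ^ l := by
      have h3 : (l : ℝ) ≤ 2 ^ l := by exact_mod_cast Nat.lt_two_pow_self.le
      have h4 : (1 : ℝ) ≤ 2 ^ l := one_le_pow₀ (by norm_num)
      nlinarith [(Nat.cast_nonneg d : (0 : ℝ) ≤ d)]
    have h3 : Real.exp (-(1 + (d + 1) * (l : ℝ))) ≤ (1 / 2) ^ ((d + 1) * l) := by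
      have h5 : Real.exp (-1) ≤ 1 / 2 := by
        have := Real.exp_neg_one_lt_d9
        norm_num at this ⊢
        linarith
      calc Real.exp (-(1 + (d + 1) * (l : ℝ))) ≤ Real.exp (((d + 1) * l : ℕ) * (-1)) := by
            apply Real.exp_le_exp.2; push_cast; linarith
        _ = Real.exp (-1) ^ ((d + 1) * l) := Real.exp_nat_mul _ _
        _ ≤ _ := pow_le_pow_left₀ (Real.exp_pos _).le h5 _
    have h4 : (2 : ℝ) ^ l * (1 / 2) ^ ((d + 3) * l) ≤ (1 / 2) ^ ((d + 1) * l) := by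
      have : (2 : ℝ) ^ l * (1 / 2) ^ ((d + 3) * l) = (1 / 2) ^ ((d + 2) * l) := by
        rw [show (d + 3) * l = l + (d + 2) * l by ring, pow_add, ← mul_assoc, ← mul_pow]; norm_num
      rw [this]
      exact pow_le_pow_of_le_one (by norm_num) (by norm_num) (by nlinarith)
    have h6 : (2 : ℝ) ^ (d * (K + l + 1)) * (1 / 2) ^ ((d + 1) * l) =
        2 ^ (d * K) * 2 ^ d * (1 / 2) ^ l := by
      rw [show d * (K + l + 1) = d * K + d + d * l by ring, show (d + 1) * l = d * l + l by ring,
        pow_add, pow_add, pow_add, mul_assoc, ← mul_assoc (2 ^ (d * l)), ← mul_pow]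
      norm_num
    calc (2 : ℝ) ^ (d * (K + l + 1)) * (4 * (6 * (d + 3)).factorial * (1 + (d + 1) * (l : ℝ)) *
            ((7 / 8) ^ l) ^ (6 * (d + 3)) + 4 * Real.exp (-(1 + (d + 1) * (l : ℝ))))
        ≤ 2 ^ (d * (K + l + 1)) * (4 * (6 * (d + 3)).factorial * ((d + 2) * 2 ^ l) *
            (1 / 2) ^ ((d + 3) * l) + 4 * (1 / 2) ^ ((d + 1) * l)) := by gcongr
      _ = 2 ^ (d * (K + l + 1)) * (4 * (6 * (d + 3)).factorial * (d + 2) * (2 ^ l *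
            (1 / 2) ^ ((d + 3) * l)) + 4 * (1 / 2) ^ ((d + 1) * l)) := by ring
      _ ≤ 2 ^ (d * (K + l + 1)) * (4 * (6 * (d + 3)).factorial * (d + 2) *
            (1 / 2) ^ ((d + 1) * l) + 4 * (1 / 2) ^ ((d + 1) * l)) := by gcongr
      _ = (2 ^ (d * (K + l + 1)) * (1 / 2) ^ ((d + 1) * l)) *
            (4 * (6 * (d + 3)).factorial * (d + 2) + 4) := by ring
      _ = 2 ^ (d * K) * (2 ^ d * (4 * (6 * (d + 3)).factorial * (d + 2) + 4)) * (1 / 2) ^ l := by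
          rw [h6]; ring
      _ ≤ _ := by
          gcongr ?_ * (2 ^ d * ?_) * ?_ ^ l
          · linarith
          · norm_num

lemma le_levelDev_sq (K j : ℕ) :
    (1 / 8 : ℝ) ^ j ≤ levelDev K j ^ 2 * ((5 / 6) ^ ((K - j) + (j - K))) ^ 2 * (1 / 8) ^ K := by
  unfold levelDev
  rcases le_total j K with hj | hj
  · obtain ⟨l, rfl⟩ := Nat.exists_eq_add_of_le hj
    have e1 : j + l - j = l := by omega
    have e2 : j - (j + l) = 0 := by omega
    rw [e1, e2]
    have : ((17 / 5 : ℝ) ^ l * (7 / 8) ^ 0) ^ 2 * ((5 / 6) ^ (l + 0)) ^ 2 * (1 / 8) ^ (j + l)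
        = ((17 / 5) ^ 2 * (5 / 6) ^ 2 * (1 / 8)) ^ l * (1 / 8) ^ j := by
      rw [pow_zero, mul_one, add_zero, mul_pow, mul_pow, pow_add, ← pow_mul, ← pow_mul,
        ← pow_mul, ← pow_mul, mul_comm l 2]
      ring
    rw [this]
    have h1 : (1 : ℝ) ≤ ((17 / 5) ^ 2 * (5 / 6) ^ 2 * (1 / 8)) ^ l := one_le_pow₀ (by norm_num)
    have h2 : (0 : ℝ) < (1 / 8) ^ j := by positivity
    nlinarith
  · obtain ⟨l, rfl⟩ := Nat.exists_eq_add_of_le hj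
    have e1 : K - (K + l) = 0 := by omega
    have e2 : K + l - K = l := by omega
    rw [e1, e2]
    have : ((17 / 5 : ℝ) ^ 0 * (7 / 8) ^ l) ^ 2 * ((5 / 6) ^ (0 + l)) ^ 2 * (1 / 8) ^ K
        = ((7 / 8) ^ 2 * (5 / 6) ^ 2) ^ l * (1 / 8) ^ K := by
      rw [pow_zero, one_mul, zero_add, mul_pow, ← pow_mul, ← pow_mul,
        ← pow_mul, ← pow_mul, mul_comm l 2]
    rw [this, pow_add, mul_comm]
    gcongr
    norm_num

lemma two_pow_le_levelDev_sq {d κ j : ℕ} (hd : 2 ≤ d) (hj : j ≤ 6 * κ + 2 * κ * d) :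
    (2 : ℝ) ^ j ≤ levelDev (6 * κ) j ^ 2 * 2 ^ (6 * κ * d) := by
  unfold levelDev
  rcases le_total j (6 * κ) with h | h
  · have e2 : j - 6 * κ = 0 := by omega
    rw [e2, pow_zero, mul_one]
    have h1 : (1 : ℝ) ≤ ((17 / 5) ^ (6 * κ - j)) ^ 2 :=
      one_le_pow₀ (one_le_pow₀ (by norm_num))
    have h2 : (2 : ℝ) ^ j ≤ 2 ^ (6 * κ * d) :=
      pow_le_pow_right₀ (by norm_num) (by nlinarith)
    have h3 : (0 : ℝ) < 2 ^ (6 * κ * d) := by positivity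
    nlinarith
  · obtain ⟨l, rfl⟩ := Nat.exists_eq_add_of_le h
    have e1 : 6 * κ - (6 * κ + l) = 0 := by omega
    have e2 : 6 * κ + l - 6 * κ = l := by omega
    rw [e1, e2, pow_zero, one_mul]
    have hl : 3 * l ≤ 2 * (6 * κ * (d - 1)) := by
      obtain ⟨e, rfl⟩ := Nat.exists_eq_add_of_le hd
      have : 2 + e - 1 = e + 1 := by omega
      rw [this]
      nlinarith
    have h3 : (2 : ℝ) ^ l ≤ ((7 / 8) ^ l) ^ 2 * 2 ^ (6 * κ * (d - 1)) := by
      refine le_of_sq_le_sq ?_ (by positivity)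
      calc ((2 : ℝ) ^ l) ^ 2 = 4 ^ l := by rw [← pow_mul, mul_comm, pow_mul]; norm_num
        _ ≤ ((7 / 8) ^ 4 * 8) ^ l := pow_le_pow_left₀ (by norm_num) (by norm_num) _
        _ = (((7 / 8) ^ l) ^ 2) ^ 2 * 2 ^ (3 * l) := by
            rw [mul_pow, ← pow_mul, ← pow_mul, ← pow_mul, pow_mul 2 3]; norm_num
            rw [mul_comm 4 l]
        _ ≤ (((7 / 8) ^ l) ^ 2) ^ 2 * 2 ^ (2 * (6 * κ * (d - 1))) := by
            gcongr
            norm_num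
        _ = _ := by rw [mul_pow, ← pow_mul 2, mul_comm 2 (6 * κ * (d - 1))]
    have e3 : 6 * κ * d = 6 * κ * (d - 1) + 6 * κ := by
      obtain ⟨e, rfl⟩ := Nat.exists_eq_add_of_le hd
      have : 2 + e - 1 = e + 1 := by omega
      rw [this]; ring
    rw [e3, pow_add, pow_add]
    have h4 : (0 : ℝ) < 2 ^ (6 * κ) := by positivity
    nlinarith

lemma levelWeight_ge_one (d K j : ℕ) : 1 ≤ levelWeight d K j := by
  unfold levelWeight
  have : (0 : ℝ) ≤ (d + 1) * ((j - K : ℕ) : ℝ) := by positivity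
  linarith

lemma levelMoment_ge_one (d K j : ℕ) : 1 ≤ levelMoment d K j := by
  unfold levelMoment; split_ifs <;> omega

lemma levelDev_nonneg (K j : ℕ) : 0 ≤ levelDev K j := by
  unfold levelDev; positivity

lemma levelCost_nonneg (d K j : ℕ) : 0 ≤ levelCost d K j := by
  have := levelWeight_ge_one d K j
  have := levelDev_nonneg K j
  unfold levelCost; positivity

/-- Expansion of a ridge along the dyadic cells containing `X`. -/
lemma exists_relu_telescope {d : ℕ} {w : Fin d → ℝ} (hw : ∑ a, |w a| ≤ 1) (β : ℝ)
    {X : Fin d → ℝ} (hX : X ∈ Set.Icc (0 : Fin d → ℝ) 1) (J : ℕ) :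
    ∃ R : ℝ, |R| ≤ (1 / 2) ^ J * crossing w β J (cellCorner J (cellIndex J X)) ∧
      max 0 (w ⬝ᵥ X - β) = ridgeAct w β 0 * (w ⬝ᵥ X - β) + R +
        ∑ j ∈ range J, (ridgeAct w β (cellCorner (j + 1) (cellIndex (j + 1) X))
          - ridgeAct w β (cellCorner j (cellIndex j X))) * (w ⬝ᵥ X - β) := by
  refine ⟨max 0 (w ⬝ᵥ X - β) - ridgeAct w β (cellCorner J (cellIndex J X)) * (w ⬝ᵥ X - β),
    abs_relu_sub_jet_le hw β fun a => ?_, ?_⟩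
  · have := sub_cellCorner_mem J hX a
    rw [abs_of_nonneg this.1]; exact this.2
  · rw [← Finset.sum_mul,
        Finset.sum_range_sub (fun j => ridgeAct w β (cellCorner j (cellIndex j X)))]
    have : cellCorner 0 (cellIndex 0 X) = 0 := by
      ext a; simp [cellCorner, cellIndex]
    rw [this]; ring

lemma exists_sparse_ridge {d : ℕ} (hd : 2 ≤ d) : ∃ M : ℕ, ∀ (κ : ℕ) (I : Type) [Fintype I]
    (w : I → Fin d → ℝ) (β u x : I → ℝ) (Z : ℝ), 0 < Z → (∀ i, ∑ a, |w i a| ≤ 1) →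
    (∀ i, |u i| ≤ 1) → (∀ i, 0 ≤ x i) → ∑ i, x i ≤ Z →
    (∀ j ≤ 6 * κ + 2 * κ * d, ∀ q : Fin d → ℕ, (∀ a, q a < 2 ^ j) →
      ∑ i, x i * (u i ^ 2 * crossing (w i) (β i) j (cellCorner j q)) ≤ Z * (1 / 2) ^ j) →
    ∃ (x' : I → ℝ) (v : Fin d → ℝ) (v₀ : ℝ), #{i | x' i ≠ 0} ≤ M * 2 ^ (6 * κ * d) ∧
      ∀ X ∈ Set.Icc (0 : Fin d → ℝ) 1,
        |∑ i, x i * u i * max 0 (w i ⬝ᵥ X - β i) - ∑ i, x' i * u i * max 0 (w i ⬝ᵥ X - β i)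
          - (v ⬝ᵥ X + v₀)| ≤ (3 + 960 * (d + 1)) * Z * (1 / 2) ^ (9 * κ + 3 * κ * d) := by
  classical
  set D : ℝ := 2 ^ d * (8 + 4 * (6 * (d + 3)).factorial * (d + 2) + 4) with hD
  have hD0 : 0 ≤ D := by positivity
  obtain ⟨M, hM1, hM2, hM3⟩ : ∃ M : ℕ, (204800 : ℝ) ≤ M ∧ 200 * (8 + (d + 2) * D * (40 / 3)) ≤ M ∧
      8 ≤ M := by
    refine ⟨⌈200 * (8 + (d + 2) * D * (40 / 3)) + 204800⌉₊, ?_, ?_, ?_⟩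
    · refine le_trans ?_ (Nat.le_ceil _)
      have : 0 ≤ 200 * (8 + (d + 2) * D * (40 / 3)) := by positivity
      linarith
    · refine le_trans ?_ (Nat.le_ceil _)
      linarith
    · have h1 : (8 : ℝ) ≤ 200 * (8 + (d + 2) * D * (40 / 3)) + 204800 := by
        have : 0 ≤ 200 * (8 + (d + 2) * D * (40 / 3)) := by positivity
        linarith
      exact_mod_cast h1.trans (Nat.le_ceil _)
  refine ⟨M, ?_⟩
  intro κ I _ w β u x Z hZ hw hu hx hxZ hxc
  set K := 6 * κ with hK
  set J := K + 2 * κ * d with hJ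
  set η₀ : ℝ := (1 / 2) ^ (9 * κ + 3 * κ * d) with hη₀
  have hη₀pos : 0 < η₀ := by positivity
  set N : ℕ := M * 2 ^ (K * d) with hN
  have hNcast : (N : ℝ) = M * 2 ^ (K * d) := by rw [hN]; push_cast; ring
  let h : Option ((j : Fin (J + 1)) × (Fin d → Fin (2 ^ (j : ℕ)))) → I → ℝ := fun b i =>
    b.elim 1 fun c => u i ^ 2 * crossing (w i) (β i) c.1 (cellCorner c.1 fun a => (c.2 a : ℕ))
  let ρ : Option ((j : Fin (J + 1)) × (Fin d → Fin (2 ^ (j : ℕ)))) → ℝ := fun b =>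
    b.elim 1 fun c => (1 / 2) ^ (c.1 : ℕ)
  let e : (j : ℕ) → (Fin d → ℕ) → I → ℝ := fun j q i =>
    ridgeAct (w i) (β i) (cellCorner (j + 1) q)
      - ridgeAct (w i) (β i) (cellCorner j fun a => q a / 2)
  let m : (j : ℕ) → (Fin d → ℕ) → Option (Fin d) → I → ℝ := fun j q o i =>
    o.elim (w i ⬝ᵥ cellCorner (j + 1) q - β i) fun a => (1 / 2) ^ j * w i a
  let g : ((j : Fin J) × ((Fin d → Fin (2 ^ ((j : ℕ) + 1))) × Option (Fin d))) → I → ℝ :=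
    fun γ i => u i * (e γ.1 (fun a => (γ.2.1 a : ℕ)) i * m γ.1 (fun a => (γ.2.1 a : ℕ)) γ.2.2 i)
  let π : ((j : Fin J) × ((Fin d → Fin (2 ^ ((j : ℕ) + 1))) × Option (Fin d))) →
      Option ((j : Fin (J + 1)) × (Fin d → Fin (2 ^ (j : ℕ)))) :=
    fun γ => some ⟨γ.1.castSucc, fun a => ⟨(γ.2.1 a : ℕ) / 2, by
      have := (γ.2.1 a).2
      have h' : 2 ^ ((γ.1 : ℕ) + 1) = 2 ^ (γ.1 : ℕ) * 2 := pow_succ _ _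
      simp only [Fin.val_castSucc]
      omega⟩⟩
  have hu2 : ∀ i, u i ^ 2 ≤ 1 := fun i => (sq_le_one_iff_abs_le_one _).2 (hu i)
  have hem : ∀ j q o i, |e j q i * m j q o i| ≤
      (1 / 2) ^ j * crossing (w i) (β i) j (cellCorner j fun a => q a / 2) := by
    intro j q o i
    have h1 := ridgeAct_sub_bounds (hw i) (β i) (cellCorner_child_sub_mem j q)
    rcases o with _ | a
    · exact h1.2
    · have h2 : |w i a| ≤ 1 :=
        (Finset.single_le_sum (f := fun a => |w i a|) (fun a _ => abs_nonneg _) (mem_univ a)).trans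
          (hw i)
      simp only [m, Option.elim]
      rw [abs_mul, abs_mul, abs_of_nonneg (by positivity : (0 : ℝ) ≤ (1 / 2) ^ j)]
      have h3 := h1.1
      have h4 := (crossing_mem (w i) (β i) j (cellCorner j fun a => q a / 2)).1
      calc |e j q i| * ((1 / 2) ^ j * |w i a|)
          ≤ crossing (w i) (β i) j (cellCorner j fun a => q a / 2) * ((1 / 2) ^ j * 1) := by gcongr
        _ = _ := by ring
  have hsumlevel : ∀ n, ∑ j ∈ range n, 2 ^ (d * (j + 1)) * levelCost d K j
      ≤ 2 ^ (d * K) * D * (40 / 3) := by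
    intro n
    calc _ ≤ ∑ j ∈ range n, 2 ^ (d * K) * D * (17 / 20) ^ ((K - j) + (j - K)) :=
          Finset.sum_le_sum fun j _ => two_pow_mul_levelCost_le hd K j
      _ ≤ 2 ^ (d * K) * D * (2 / (1 - 17 / 20)) := by
          rw [← Finset.mul_sum]
          exact mul_le_mul_of_nonneg_left (sum_range_pow_dist_le (by norm_num) (by norm_num) K n)
            (by positivity)
      _ = _ := by norm_num
  obtain ⟨x', hx', hx'N, hx'h, hx'g⟩ := exists_sparse (h := h) (ρ := ρ) (b₀ := none) (g := g)
    (π := π) (κ := fun γ => (1 / 2) ^ (γ.1 : ℕ))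
    (η := fun γ => η₀ * (5 / 6) ^ ((K - (γ.1 : ℕ)) + ((γ.1 : ℕ) - K))) (Z := Z) (N := N)
    (τ := fun γ => levelDev K γ.1) (s := fun γ => levelWeight d K γ.1)
    (q := fun γ => levelMoment d K γ.1)
    (τ' := fun b => b.elim 1 fun c => levelDev K c.1)
    (s' := fun b => b.elim 1 fun c => levelWeight d K c.1)
    (q' := fun b => b.elim 1 fun c => levelMoment d K c.1) (x := x)
    (by
      rintro (_ | c) i
      · simp [h]
      · have h1 := crossing_mem (w i) (β i) c.1 (cellCorner c.1 fun a => (c.2 a : ℕ))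
        exact ⟨mul_nonneg (sq_nonneg _) h1.1, mul_le_one₀ (hu2 i) h1.1 h1.2⟩)
    (fun i => rfl) rfl
    (by rintro (_ | c) <;> simp [ρ])
    (by
      intro γ i
      have h1 := hem γ.1 (fun a => (γ.2.1 a : ℕ)) γ.2.2 i
      simp only [g, h, π, Option.elim, Fin.val_castSucc]
      set cr := crossing (w i) (β i) γ.1 (cellCorner γ.1 fun a => (γ.2.1 a : ℕ) / 2) with hcr
      have h2 : cr * cr = cr := by
        rw [hcr]; unfold crossing; split_ifs <;> norm_num
      have h3 := sq_le_sq' (neg_le_of_abs_le h1) (le_of_abs_le h1)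
      rw [mul_pow]
      calc _ ≤ u i ^ 2 * ((1 / 2) ^ (γ.1 : ℕ) * cr) ^ 2 := by gcongr
        _ = ((1 / 2) ^ (γ.1 : ℕ)) ^ 2 * (u i ^ 2 * (cr * cr)) := by ring
        _ = _ := by rw [h2])
    (fun γ => by positivity) hZ
    (by
      rw [hN]
      have : 1 ≤ 2 ^ (K * d) := Nat.one_le_two_pow
      nlinarith)
    (fun γ => levelDev_nonneg _ _) (fun γ => levelWeight_ge_one _ _ _)
    (fun γ => levelMoment_ge_one _ _ _)
    (by rintro (_ | c); exacts [zero_le_one, levelDev_nonneg _ _])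
    (by rintro (_ | c); exacts [le_rfl, levelWeight_ge_one _ _ _])
    (by rintro (_ | c); exacts [le_rfl, levelMoment_ge_one _ _ _])
    (by
      intro γ
      simp only [ρ, π, Option.elim, Fin.val_castSucc]
      set j : ℕ := (γ.1 : ℕ)
      have h1 := le_levelDev_sq K j
      have h2 : η₀ ^ 2 * 2 ^ (K * d) = (1 / 8) ^ K := by
        rw [hη₀, ← pow_mul, hK, show (9 * κ + 3 * κ * d) * 2 = 3 * (6 * κ) + 6 * κ * d by ring,
          pow_add, pow_mul _ 3, mul_assoc, ← mul_pow _ _ (6 * κ * d)]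
        norm_num
      have h3 : (32 : ℝ) ≤ M := by linarith
      have h4 : ((1 / 2 : ℝ) ^ j) ^ 2 * (1 / 2) ^ j = (1 / 8) ^ j := by
        rw [← pow_succ, ← pow_mul, mul_comm, pow_mul]; norm_num
      calc 32 * ((1 / 2 : ℝ) ^ j) ^ 2 * (1 / 2) ^ j = 32 * (1 / 8) ^ j := by rw [mul_assoc, h4]
        _ ≤ M * (levelDev K j ^ 2 * ((5 / 6) ^ ((K - j) + (j - K))) ^ 2 * (1 / 8) ^ K) := by
            gcongr
        _ = _ := by rw [hNcast, ← h2]; ring)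
    (by
      rintro (_ | c)
      · simp only [ρ, Option.elim]
        have : (1 : ℝ) ≤ 2 ^ (K * d) := one_le_pow₀ (by norm_num)
        rw [hNcast]
        nlinarith
      · simp only [ρ, Option.elim]
        set j : ℕ := (c.1 : ℕ) with hj
        have h1 := two_pow_le_levelDev_sq (d := d) (κ := κ) (j := j) hd (by have := c.1.2; omega)
        rw [hNcast, ← hK] at *
        have h2 : (2 : ℝ) ^ j * (1 / 2) ^ j = 1 := by rw [← mul_pow]; norm_num
        calc (204800 : ℝ) = 204800 * (2 ^ j * (1 / 2) ^ j) := by rw [h2, mul_one]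
          _ ≤ M * ((levelDev K j ^ 2 * 2 ^ (K * d)) * (1 / 2) ^ j) := by gcongr
          _ = _ := by ring)
    (by
      rw [Fintype.sum_option, Fintype.sum_sigma, Fintype.sum_sigma]
      simp only [Option.elim, Finset.sum_const, Finset.card_univ, nsmul_eq_mul]
      simp only [Fintype.card_prod, Fintype.card_pi, Fintype.card_fin, Finset.prod_const,
        Finset.card_univ, Fintype.card_option, Nat.factorial_one]
      have e1 : ∑ j : Fin J, (((2 ^ ((j : ℕ) + 1)) ^ d * (d + 1) : ℕ) : ℝ) *
          (4 * ((levelMoment d K j).factorial : ℝ) * levelWeight d K j *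
            levelDev K j ^ levelMoment d K j + 4 * Real.exp (-levelWeight d K j))
          ≤ (d + 1) * ∑ j ∈ range (J + 1), 2 ^ (d * (j + 1)) * levelCost d K j := by
        rw [Finset.sum_range_succ, Finset.sum_range, mul_add, Finset.mul_sum]
        have h0 := levelCost_nonneg d K J
        have h1 : (0 : ℝ) ≤ (d + 1) * (2 ^ (d * (J + 1)) * levelCost d K J) := by positivity
        refine le_trans (le_of_eq (Finset.sum_congr rfl fun j _ => ?_)) (le_add_of_nonneg_right h1)
        unfold levelCost
        push_cast
        rw [← pow_mul, mul_comm _ d]; ring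
      have e2 : ∑ j : Fin (J + 1), (((2 ^ (j : ℕ)) ^ d : ℕ) : ℝ) *
          (4 * ((levelMoment d K j).factorial : ℝ) * levelWeight d K j *
            levelDev K j ^ levelMoment d K j + 4 * Real.exp (-levelWeight d K j))
          ≤ ∑ j ∈ range (J + 1), 2 ^ (d * (j + 1)) * levelCost d K j := by
        rw [Finset.sum_range]
        refine Finset.sum_le_sum fun j _ => ?_
        have h0 := levelCost_nonneg d K j
        change _ * levelCost d K j ≤ _
        push_cast
        rw [← pow_mul, mul_comm _ d]
        gcongr
        · norm_num
        · omega
      have e3 := hsumlevel (J + 1)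
      have e4 : Real.exp (-1) ≤ 1 := Real.exp_le_one_iff.2 (by norm_num)
      have e5 : (1 : ℝ) ≤ 2 ^ (K * d) := one_le_pow₀ (by norm_num)
      rw [mul_comm d K] at e3
      have e6 : (d + 2) * ∑ j ∈ range (J + 1), 2 ^ (d * (j + 1)) * levelCost d K j
          ≤ (d + 2) * (2 ^ (K * d) * D * (40 / 3)) := by gcongr
      have e7 : 200 * (8 + (d + 2) * D * (40 / 3)) * 2 ^ (K * d) ≤ (N : ℝ) := by
        rw [hNcast]; gcongr
      norm_num at e1 e2 ⊢
      nlinarith)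
    hx
    (by
      rintro (_ | c)
      · simpa [h, ρ] using hxZ
      · exact hxc c.1 (by have := c.1.2; omega) _ fun a => (c.2 a).2)
  refine ⟨x', fun a => ∑ i, (x i - x' i) * u i * ridgeAct (w i) (β i) 0 * w i a,
    -∑ i, (x i - x' i) * u i * ridgeAct (w i) (β i) 0 * β i, hx'N, fun X hX => ?_⟩
  choose R hR hRX using fun i => exists_relu_telescope (hw i) (β i) hX J
  have hlin : (fun a => ∑ i, (x i - x' i) * u i * ridgeAct (w i) (β i) 0 * w i a) ⬝ᵥ X
      + -∑ i, (x i - x' i) * u i * ridgeAct (w i) (β i) 0 * β i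
      = ∑ i, (x i - x' i) * u i * (ridgeAct (w i) (β i) 0 * (w i ⬝ᵥ X - β i)) := by
    unfold dotProduct
    simp_rw [Finset.sum_mul]
    rw [Finset.sum_comm, ← sub_eq_add_neg, ← Finset.sum_sub_distrib]
    refine Finset.sum_congr rfl fun i _ => ?_
    rw [mul_sub, mul_sub, Finset.mul_sum, Finset.mul_sum]
    congr 1
    · exact Finset.sum_congr rfl fun a _ => by ring
    · ring
  set T : ℕ → ℝ := fun j => ∑ i, (x i - x' i) * (u i * (e j (cellIndex (j + 1) X) i *
    (w i ⬝ᵥ X - β i))) with hT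
  have hdecomp : ∑ i, x i * u i * max 0 (w i ⬝ᵥ X - β i) - ∑ i, x' i * u i * max 0 (w i ⬝ᵥ X - β i)
      - ((fun a => ∑ i, (x i - x' i) * u i * ridgeAct (w i) (β i) 0 * w i a) ⬝ᵥ X
        + -∑ i, (x i - x' i) * u i * ridgeAct (w i) (β i) 0 * β i)
      = ∑ i, (x i - x' i) * u i * R i + ∑ j ∈ range J, T j := by
    rw [hlin, hT, Finset.sum_comm, ← Finset.sum_sub_distrib, ← Finset.sum_sub_distrib,
      ← Finset.sum_add_distrib]
    refine Finset.sum_congr rfl fun i _ => ?_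
    have h1 : ∑ j ∈ range J, (x i - x' i) * (u i * (e j (cellIndex (j + 1) X) i *
        (w i ⬝ᵥ X - β i))) = (x i - x' i) * u i *
        ∑ j ∈ range J, (ridgeAct (w i) (β i) (cellCorner (j + 1) (cellIndex (j + 1) X))
          - ridgeAct (w i) (β i) (cellCorner j (cellIndex j X))) * (w i ⬝ᵥ X - β i) := by
      rw [Finset.mul_sum]
      refine Finset.sum_congr rfl fun j _ => ?_
      have h2 : (fun a => cellIndex (j + 1) X a / 2) = cellIndex j X :=
        funext fun a => cellIndex_succ_div_two j X a
      simp only [e, h2]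
      ring
    rw [h1, hRX i]; ring
  have hTbound : ∀ j ∈ range J, |T j| ≤
      80 * (d + 1) * Z * η₀ * (5 / 6) ^ ((K - j) + (j - K)) := by
    intro j hj
    rw [Finset.mem_range] at hj
    set q := cellIndex (j + 1) X with hq
    let γ : Option (Fin d) → ((j : Fin J) × ((Fin d → Fin (2 ^ ((j : ℕ) + 1))) × Option (Fin d))) :=
      fun o => ⟨⟨j, hj⟩, (fun a => ⟨q a, cellIndex_lt (j + 1) X a⟩, o)⟩
    set ηj := η₀ * (5 / 6 : ℝ) ^ ((K - j) + (j - K)) with hηj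
    have hηj0 : 0 < ηj := by positivity
    have hS : ∀ o, |∑ i, (x i - x' i) * (u i * (e j q i * m j q o i))| ≤ 80 * ηj * Z :=
      fun o => hx'g (γ o)
    have hTeq : T j = ∑ i, (x i - x' i) * (u i * (e j q i * m j q none i))
        + ∑ a, (X a - cellCorner (j + 1) q a) * 2 ^ j *
          ∑ i, (x i - x' i) * (u i * (e j q i * m j q (some a) i)) := by
      simp_rw [Finset.mul_sum]
      rw [Finset.sum_comm, hT, ← Finset.sum_add_distrib]
      refine Finset.sum_congr rfl fun i _ => ?_
      have h1 : w i ⬝ᵥ X - β i = (w i ⬝ᵥ cellCorner (j + 1) q - β i)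
          + ∑ a, w i a * (X a - cellCorner (j + 1) q a) := by
        unfold dotProduct
        simp_rw [mul_sub]
        rw [Finset.sum_sub_distrib]; ring
      rw [h1, mul_add, mul_add, mul_add, Finset.mul_sum, Finset.mul_sum, Finset.mul_sum]
      congr 1
      refine Finset.sum_congr rfl fun a _ => ?_
      have h2 : (2 : ℝ) ^ j * (1 / 2) ^ j = 1 := by rw [← mul_pow]; norm_num
      simp only [m, Option.elim]
      calc _ = (x i - x' i) * (u i * (e j q i * (w i a * (X a - cellCorner (j + 1) q a))))
            * (2 ^ j * (1 / 2) ^ j) := by rw [h2, mul_one]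
        _ = _ := by ring
    rw [hTeq]
    calc _ ≤ 80 * ηj * Z + ∑ a : Fin d, 80 * ηj * Z := by
          refine (abs_add_le _ _).trans (add_le_add (hS none) ?_)
          refine (Finset.abs_sum_le_sum_abs _ _).trans (Finset.sum_le_sum fun a _ => ?_)
          rw [abs_mul]
          have h3 := sub_cellCorner_mem (j + 1) hX a
          have h4 : |(X a - cellCorner (j + 1) q a) * 2 ^ j| ≤ 1 := by
            rw [abs_of_nonneg (mul_nonneg h3.1 (by positivity))]
            calc _ ≤ (1 / 2 : ℝ) ^ (j + 1) * 2 ^ j := by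
                  refine mul_le_mul_of_nonneg_right h3.2 (by positivity)
              _ = 1 / 2 := by rw [pow_succ, mul_right_comm, ← mul_pow]; norm_num
              _ ≤ 1 := by norm_num
          calc _ ≤ 1 * (80 * ηj * Z) := mul_le_mul h4 (hS _) (abs_nonneg _) zero_le_one
            _ = _ := one_mul _
      _ = _ := by
          rw [Finset.sum_const, Finset.card_univ, Fintype.card_fin, nsmul_eq_mul, hηj]; ring
  have hTsum : |∑ j ∈ range J, T j| ≤ 960 * (d + 1) * Z * η₀ := by
    refine (Finset.abs_sum_le_sum_abs _ _).trans ((Finset.sum_le_sum hTbound).trans ?_)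
    rw [← Finset.mul_sum]
    have h1 := sum_range_pow_dist_le (r := 5 / 6) (by norm_num) (by norm_num) K J
    calc _ ≤ 80 * (d + 1) * Z * η₀ * (2 / (1 - 5 / 6)) := by gcongr
      _ = _ := by ring
  have hRsum : |∑ i, (x i - x' i) * u i * R i| ≤ 3 * Z * η₀ := by
    set J' := 3 * κ + κ * d with hJ'
    have hJJ' : J = J' + J' := by rw [hJ, hJ', hK]; ring
    have hη₀' : η₀ = (1 / 2) ^ J * (1 / 2) ^ J' := by
      rw [hη₀, ← pow_add, hJJ', hJ']; congr 1; ring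
    have hc : ∀ i, crossing (w i) (β i) J (cellCorner J (cellIndex J X)) ∈ Set.Icc (0 : ℝ) 1 :=
      fun i => crossing_mem _ _ _ _
    set cr : I → ℝ := fun i => crossing (w i) (β i) J (cellCorner J (cellIndex J X)) with hcr
    have hsum1 : ∑ i, (x i + x' i) ≤ 3 * Z := by
      have h1 := hx'h none
      simp only [h, ρ, Option.elim, mul_one] at h1
      rw [Finset.sum_add_distrib]; linarith
    have hsum2 : ∑ i, (x i + x' i) * (u i ^ 2 * cr i) ≤ 3 * Z * (1 / 2) ^ J := by
      have h1 := hx'h (some ⟨Fin.last J, fun a => ⟨cellIndex J X a, cellIndex_lt J X a⟩⟩)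
      have h2 := hxc J le_rfl (cellIndex J X) (cellIndex_lt J X)
      simp only [h, ρ, Option.elim, Fin.val_last] at h1
      simp_rw [add_mul]
      rw [Finset.sum_add_distrib]
      simp only [hcr]
      linarith
    have hpt : ∀ i, |(x i - x' i) * u i * R i| ≤
        (1 / 2) ^ J * (2 ^ J' / 2 * ((x i + x' i) * (u i ^ 2 * cr i))
          + (1 / 2) ^ J' / 2 * (x i + x' i)) := by
      intro i
      have h1 : |x i - x' i| ≤ x i + x' i := by
        rw [abs_le]; constructor <;> linarith [hx i, hx' i]
      have h2 : |u i| * cr i ≤ 2 ^ J' / 2 * (u i ^ 2 * cr i) + (1 / 2) ^ J' / 2 := by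
        have h3 : (2 : ℝ) ^ J' * (1 / 2) ^ J' = 1 := by rw [← mul_pow]; norm_num
        have h4 : |u i| ≤ 2 ^ J' / 2 * u i ^ 2 + (1 / 2) ^ J' / 2 := by
          have h5 : (0 : ℝ) < (1 / 2) ^ J' := by positivity
          have h6 := mul_nonneg h5.le (sq_nonneg (2 ^ J' * |u i| - 1))
          have h7 : (1 / 2 : ℝ) ^ J' * (2 ^ J' * |u i| - 1) ^ 2
              = (2 ^ J' * (1 / 2) ^ J') * (2 ^ J' * |u i| ^ 2) - 2 * (2 ^ J' * (1 / 2) ^ J') * |u i|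
                + (1 / 2) ^ J' := by ring
          rw [h7, h3, sq_abs] at h6
          linarith
        have h5 := hc i
        have h6 : (0 : ℝ) < (1 / 2) ^ J' := by positivity
        calc |u i| * cr i ≤ (2 ^ J' / 2 * u i ^ 2 + (1 / 2) ^ J' / 2) * cr i :=
              mul_le_mul_of_nonneg_right h4 h5.1
          _ = 2 ^ J' / 2 * (u i ^ 2 * cr i) + (1 / 2) ^ J' / 2 * cr i := by ring
          _ ≤ _ := by
              gcongr
              exact mul_le_of_le_one_right (by positivity) h5.2
      rw [abs_mul, abs_mul]
      have h5 : 0 ≤ x i + x' i := add_nonneg (hx i) (hx' i)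
      calc |x i - x' i| * |u i| * |R i| ≤ (x i + x' i) * |u i| * ((1 / 2) ^ J * cr i) := by
            gcongr; exact hR i
        _ = (1 / 2) ^ J * ((x i + x' i) * (|u i| * cr i)) := by ring
        _ ≤ (1 / 2) ^ J * ((x i + x' i) * (2 ^ J' / 2 * (u i ^ 2 * cr i) + (1 / 2) ^ J' / 2)) := by
            gcongr
        _ = _ := by ring
    refine (Finset.abs_sum_le_sum_abs _ _).trans ((Finset.sum_le_sum fun i _ => hpt i).trans ?_)
    rw [← Finset.mul_sum, Finset.sum_add_distrib, ← Finset.mul_sum, ← Finset.mul_sum, hη₀']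
    have h8 : (2 : ℝ) ^ J' * (1 / 2) ^ J = (1 / 2) ^ J' := by
      rw [hJJ', pow_add (1 / 2 : ℝ) J' J', ← mul_assoc, ← mul_pow]; norm_num
    calc _ ≤ (1 / 2) ^ J * (2 ^ J' / 2 * (3 * Z * (1 / 2) ^ J) + (1 / 2) ^ J' / 2 * (3 * Z)) := by
          gcongr
      _ = (1 / 2) ^ J * (3 * Z / 2 * (2 ^ J' * (1 / 2) ^ J) + (1 / 2) ^ J' / 2 * (3 * Z)) := by ring
      _ = _ := by rw [h8]; ring
  rw [hdecomp]
  calc _ ≤ 3 * Z * η₀ + 960 * (d + 1) * Z * η₀ := (abs_add_le _ _).trans (add_le_add hRsum hTsum)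
    _ = _ := by ring

/-- A minimax reweighting: factors `t ∈ (0,1]` balancing `∑ a / t` against all `∑ a t K_c`. -/
lemma exists_reweight {I C : Type*} [Fintype I] [Fintype C] [Nonempty C]
    {a p b : I → ℝ} {K : C → I → ℝ} {B : ℝ} (ha : ∀ i, 0 ≤ a i) (hp : ∀ i, 0 ≤ p i)
    (hp1 : ∑ i, p i ≤ 1) (hK : ∀ c i, 0 ≤ K c i) (hpK : ∀ c, ∑ i, p i * K c i ≤ 2)
    (hab : ∀ i, a i ^ 2 ≤ p i * b i) (hb : ∀ i, 0 ≤ b i) (hB : ∑ i, b i ≤ B) :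
    ∃ t : I → ℝ, (∀ i, 0 < t i ∧ t i ≤ 1) ∧ ∑ i, a i / t i ≤ √(3 * B) ∧
      ∀ c, ∑ i, a i * t i * K c i ≤ √(3 * B) := by
  classical
  let m : (C → ℝ) → I → ℝ := fun μ i => ∑ c, μ c * K c i
  let Φ : (C → ℝ) → ℝ := fun μ => ∑ i, a i * √(1 + m μ i)
  have hcont : Continuous Φ := by
    simp only [Φ, m]
    fun_prop
  obtain ⟨μ, hμ, hmax⟩ := (isCompact_stdSimplex ℝ C).exists_isMaxOn
    ⟨_, single_mem_stdSimplex ℝ (Classical.arbitrary C)⟩ hcont.continuousOn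
  have hm0 : ∀ i, 0 ≤ m μ i := fun i =>
    Finset.sum_nonneg fun c _ => mul_nonneg (hμ.1 c) (hK c i)
  have hpm : ∑ i, p i * (1 + m μ i) ≤ 3 := by
    have h1 : ∑ i, p i * (1 + m μ i) = ∑ i, p i + ∑ c, μ c * ∑ i, p i * K c i := by
      simp_rw [mul_add, mul_one, Finset.sum_add_distrib, m, Finset.mul_sum]
      rw [Finset.sum_comm]
      congr 1
      exact Finset.sum_congr rfl fun c _ => Finset.sum_congr rfl fun i _ => by ring
    have h2 : ∑ c, μ c * ∑ i, p i * K c i ≤ ∑ c, μ c * 2 :=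
      Finset.sum_le_sum fun c _ => mul_le_mul_of_nonneg_left (hpK c) (hμ.1 c)
    rw [← Finset.sum_mul, hμ.2] at h2
    linarith
  have hΦ : Φ μ ≤ √(3 * B) := by
    have h1 : Φ μ ≤ ∑ i, √(p i * (1 + m μ i)) * √(b i) := by
      refine Finset.sum_le_sum fun i _ => ?_
      rw [← Real.sqrt_mul (mul_nonneg (hp i) (by linarith [hm0 i]))]
      refine Real.le_sqrt_of_sq_le ?_
      rw [mul_pow, Real.sq_sqrt (by linarith [hm0 i])]
      nlinarith [hab i, hm0 i]
    refine h1.trans ?_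
    have h2 := Real.sum_sqrt_mul_sqrt_le (s := (univ : Finset I))
      (fun i => mul_nonneg (hp i) (by linarith [hm0 i] : 0 ≤ 1 + m μ i)) hb
    refine h2.trans ?_
    have h3 : 0 ≤ ∑ i, p i * (1 + m μ i) :=
      Finset.sum_nonneg fun i _ => mul_nonneg (hp i) (by linarith [hm0 i])
    rw [← Real.sqrt_mul h3]
    refine Real.sqrt_le_sqrt ?_
    exact mul_le_mul hpm hB (Finset.sum_nonneg fun i _ => hb i) (by norm_num)
  have hs : ∀ i, 1 ≤ √(1 + m μ i) := fun i => Real.one_le_sqrt.2 (by linarith [hm0 i])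
  refine ⟨fun i => 1 / √(1 + m μ i), fun i => ⟨by have := hs i; positivity, ?_⟩, ?_, fun c => ?_⟩
  · exact div_le_one_of_le₀ (hs i) (by positivity)
  · refine le_trans (le_of_eq ?_) hΦ
    exact Finset.sum_congr rfl fun i _ => by rw [div_div_eq_mul_div, div_one]
  · have hderiv : HasDerivAt (fun u : ℝ => ∑ i, a i * √(1 + (m μ i + u * (K c i - m μ i))))
        (∑ i, a i * ((K c i - m μ i) / (2 * √(1 + m μ i)))) 0 := by
      refine HasDerivAt.fun_sum fun i _ => HasDerivAt.const_mul _ ?_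
      have h1 : HasDerivAt (fun u : ℝ => 1 + (m μ i + u * (K c i - m μ i)))
          (K c i - m μ i) 0 := by
        simpa using (((hasDerivAt_id (0 : ℝ)).mul_const (K c i - m μ i)).const_add
          (m μ i)).const_add 1
      have h2 := h1.sqrt (by simp; linarith [hm0 i])
      simpa using h2
    have hle : ∀ u ∈ Set.Ioc (0 : ℝ) 1,
        ∑ i, a i * √(1 + (m μ i + u * (K c i - m μ i))) ≤ Φ μ := by
      intro u hu
      have hmem : (1 - u) • μ + u • Pi.single c 1 ∈ stdSimplex ℝ C :=
        convex_stdSimplex ℝ C hμ (single_mem_stdSimplex ℝ c) (by linarith [hu.2]) hu.1.le (by ring)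
      have h1 := hmax hmem
      simp only [Set.mem_ofPred_eq] at h1
      refine le_trans (le_of_eq ?_) h1
      simp only [Φ]
      refine Finset.sum_congr rfl fun i _ => ?_
      congr 3
      simp only [m, Pi.add_apply, Pi.smul_apply, smul_eq_mul, add_mul, Finset.sum_add_distrib]
      have h2 : ∑ c', u * (Pi.single c (1 : ℝ) : C → ℝ) c' * K c' i = u * K c i := by
        rw [Finset.sum_eq_single c]
        · simp
        · intro c' _ hc'; simp [hc']
        · simp
      rw [h2]
      have h3 : ∑ c', (1 - u) * μ c' * K c' i = (1 - u) * ∑ c', μ c' * K c' i := by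
        rw [Finset.mul_sum]; exact Finset.sum_congr rfl fun _ _ => by ring
      rw [h3]; ring
    have hD : ∑ i, a i * ((K c i - m μ i) / (2 * √(1 + m μ i))) ≤ 0 := by
      have ht := (hasDerivAt_iff_tendsto_slope_zero.1 hderiv).mono_left
        (nhdsWithin_mono 0 (fun u (hu : u ∈ Set.Ioi (0 : ℝ)) => ne_of_gt hu))
      refine le_of_tendsto ht ?_
      filter_upwards [Ioc_mem_nhdsGT (zero_lt_one' ℝ)] with u hu
      have := hle u hu
      simp only [zero_add, zero_mul, add_zero, smul_eq_mul]
      refine mul_nonpos_of_nonneg_of_nonpos (inv_nonneg.2 hu.1.le) ?_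
      simp only [Φ] at this
      linarith
    have h4 : ∑ i, a i * (1 / √(1 + m μ i)) * K c i
        = 2 * (∑ i, a i * ((K c i - m μ i) / (2 * √(1 + m μ i))))
          + ∑ i, a i * (m μ i / √(1 + m μ i)) := by
      rw [Finset.mul_sum, ← Finset.sum_add_distrib]
      refine Finset.sum_congr rfl fun i _ => ?_
      have : √(1 + m μ i) ≠ 0 := by have := hs i; positivity
      field_simp
      ring
    have h5 : ∑ i, a i * (m μ i / √(1 + m μ i)) ≤ Φ μ := by
      refine Finset.sum_le_sum fun i _ => mul_le_mul_of_nonneg_left ?_ (ha i)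
      rw [div_le_iff₀ (by have := hs i; positivity), Real.mul_self_sqrt (by linarith [hm0 i])]
      linarith
    rw [h4]; linarith

/-- An integral against a probability measure is approximated by finite weighted averages. -/
lemma exists_finite_average {Ω : Type*} [MeasurableSpace Ω] (P : Measure Ω) [IsProbabilityMeasure P]
    {ι : Type*} [Fintype ι] {F : Ω → ι → ℝ} (hF : ∀ i, Integrable (fun ω => F ω i) P) {δ : ℝ}
    (hδ : 0 < δ) : ∃ (I : Type) (_ : Fintype I) (p : I → ℝ) (z : I → Ω), (∀ i, 0 ≤ p i) ∧
      ∑ i, p i = 1 ∧ ∀ a, |∑ i, p i * F (z i) a - ∫ ω, F ω a ∂P| ≤ δ := by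
  have hFint : Integrable F P := Integrable.of_eval hF
  have hmem : ∫ ω, F ω ∂P ∈ closure (convexHull ℝ (Set.range F)) :=
    (convex_convexHull ℝ _).closure.integral_mem isClosed_closure
      (Filter.Eventually.of_forall fun ω => subset_closure (subset_convexHull ℝ _ ⟨ω, rfl⟩)) hFint
  obtain ⟨y, hy, hyd⟩ := Metric.mem_closure_iff.1 hmem δ hδ
  obtain ⟨I, _, p, z, hp, hp1, hz, rfl⟩ := mem_convexHull_iff_exists_fintype.1 hy
  choose ω hω using hz
  refine ⟨I, inferInstance, p, ω, hp, hp1, fun a => ?_⟩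
  have h1 := (dist_pi_le_iff hδ.le).1 hyd.le a
  rw [Real.dist_eq, abs_sub_comm, eval_integral hF, Finset.sum_apply] at h1
  simpa [hω] using h1

lemma relu_sub_le {d : ℕ} {w : Fin d → ℝ} (hw : ∑ a, |w a| ≤ 1) (β : ℝ) {y y' : Fin d → ℝ} {r : ℝ}
    (hy : ∀ a, |y' a - y a| ≤ r) (hr : 0 ≤ r) :
    |max 0 (w ⬝ᵥ y' - β) - max 0 (w ⬝ᵥ y - β)| ≤ r := by
  rw [max_comm 0, max_comm 0]
  refine (abs_max_sub_max_le_abs _ _ _).trans ?_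
  rw [sub_sub_sub_cancel_right]
  exact abs_dotProduct_sub_le hw hy hr

lemma exists_ridge_discretization {Ω : Type*} [MeasurableSpace Ω] (P : Measure Ω)
    [IsProbabilityMeasure P] {d : ℕ} {w : Ω → Fin d → ℝ} {β α : Ω → ℝ} (hwm : Measurable w)
    (hβm : Measurable β) (hαm : Measurable α) (hw : ∀ ω, ∑ a, |w ω a| ≤ 1) (hβ : ∀ ω, |β ω| ≤ 1)
    (hα : Integrable (fun ω => α ω ^ 2) P) {B : ℝ} (hB : ∫ ω, α ω ^ 2 ∂P ≤ B) {J : ℕ}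
    (hcross : ∀ j ≤ J, ∀ q : Fin d → ℕ, (∀ a, q a < 2 ^ j) →
      ∫ ω, crossing (w ω) (β ω) j (cellCorner j q) ∂P ≤ (1 / 2) ^ j) {η : ℝ} (hη : 0 < η) :
    ∃ (I : Type) (_ : Fintype I) (p : I → ℝ) (z : I → Ω), (∀ i, 0 ≤ p i) ∧ ∑ i, p i = 1 ∧
      ∑ i, p i * α (z i) ^ 2 ≤ B + 1 ∧
      (∀ j ≤ J, ∀ q : Fin d → ℕ, (∀ a, q a < 2 ^ j) →
        ∑ i, p i * crossing (w (z i)) (β (z i)) j (cellCorner j q) ≤ 2 * (1 / 2) ^ j) ∧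
      ∀ X ∈ Set.Icc (0 : Fin d → ℝ) 1,
        |∫ ω, α ω * max 0 (w ω ⬝ᵥ X - β ω) ∂P
          - ∑ i, p i * (α (z i) * max 0 (w (z i) ⬝ᵥ X - β (z i)))| ≤ η := by
  classical
  have hB0 : 0 ≤ B := (integral_nonneg fun ω => sq_nonneg _).trans hB
  obtain ⟨J', hJ'⟩ : ∃ J' : ℕ, (2 * B + 3) * (1 / 2 : ℝ) ^ J' ≤ η / 2 := by
    obtain ⟨n, hn⟩ := exists_pow_lt_of_lt_one (by positivity : 0 < η / 2 / (2 * B + 3))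
      (by norm_num : (1 / 2 : ℝ) < 1)
    refine ⟨n, ?_⟩
    rw [lt_div_iff₀ (by positivity)] at hn
    linarith
  have hdotm : ∀ X : Fin d → ℝ, Measurable fun ω => w ω ⬝ᵥ X := fun X => by
    unfold dotProduct; fun_prop
  have habs : ∀ ω, |α ω| ≤ α ω ^ 2 + 1 := fun ω => by
    rcases abs_cases (α ω) with h | h <;> nlinarith [sq_nonneg (α ω - 1), sq_nonneg (α ω + 1)]
  have hαi : Integrable α P := by
    refine (hα.add (integrable_const 1)).mono' hαm.aestronglyMeasurable
      (Filter.Eventually.of_forall fun ω => ?_)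
    simpa using habs ω
  have hrelu : ∀ ω, ∀ X ∈ Set.Icc (0 : Fin d → ℝ) 1, |max 0 (w ω ⬝ᵥ X - β ω)| ≤ 2 := by
    intro ω X hX
    have h1 := abs_dotProduct_sub_le (hw ω) (y := 0) (y' := X) (r := 1)
      (fun a => by
        rw [Pi.zero_apply, sub_zero, abs_of_nonneg (hX.1 a)]; exact hX.2 a) zero_le_one
    rw [dotProduct_zero, sub_zero] at h1
    have h2 := abs_le.1 h1
    have h3 := abs_le.1 (hβ ω)
    rw [abs_of_nonneg (le_max_left _ _)]
    exact max_le (by norm_num) (by linarith)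
  have hTi : ∀ X ∈ Set.Icc (0 : Fin d → ℝ) 1,
      Integrable (fun ω => α ω * max 0 (w ω ⬝ᵥ X - β ω)) P := by
    intro X hX
    refine hαi.mul_bdd (c := 2)
      (measurable_const.max ((hdotm X).sub hβm)).aestronglyMeasurable
      (Filter.Eventually.of_forall fun ω => hrelu ω X hX)
  have hci : ∀ j (y : Fin d → ℝ), Integrable (fun ω => crossing (w ω) (β ω) j y) P := by
    intro j y
    refine Integrable.of_bound (C := 1) ?_ (Filter.Eventually.of_forall fun ω => ?_)
    · unfold crossing
      exact (Measurable.ite (measurableSet_le (((hdotm y).sub hβm).norm) measurable_const)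
        measurable_const measurable_const).aestronglyMeasurable
    · have := crossing_mem (w ω) (β ω) j y
      rw [Real.norm_of_nonneg this.1]; exact this.2
  have hcorner : ∀ j (q : Fin d → ℕ), (∀ a, q a < 2 ^ j) →
      cellCorner j q ∈ Set.Icc (0 : Fin d → ℝ) 1 := by
    intro j q hq
    refine ⟨fun a => by unfold cellCorner; positivity, fun a => ?_⟩
    unfold cellCorner
    have : (q a : ℝ) ≤ 2 ^ j := by exact_mod_cast (hq a).le
    exact div_le_one_of_le₀ this (by positivity)
  let F : Ω → ((Fin d → Fin (2 ^ J')) ⊕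
      (Unit ⊕ ((j : Fin (J + 1)) × (Fin d → Fin (2 ^ (j : ℕ)))))) →
      ℝ := fun ω => Sum.elim
        (fun q => α ω * max 0 (w ω ⬝ᵥ cellCorner J' (fun a => (q a : ℕ)) - β ω))
        (Sum.elim (fun _ => α ω ^ 2)
          fun c => crossing (w ω) (β ω) c.1 (cellCorner c.1 fun a => (c.2 a : ℕ)))
  have hF : ∀ i, Integrable (fun ω => F ω i) P := by
    rintro (q | _ | c)
    · exact hTi _ (hcorner _ _ fun a => (q a).2)
    · exact hα
    · exact hci _ _
  obtain ⟨I, hI, p, z, hp, hp1, hpz⟩ := exists_finite_average P hF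
    (δ := min (min 1 (η / 2)) ((1 / 2) ^ J)) (by positivity)
  refine ⟨I, hI, p, z, hp, hp1, ?_, ?_, ?_⟩
  · have h1 := (hpz (Sum.inr (Sum.inl ()))).trans ((min_le_left _ _).trans (min_le_left _ _))
    have h2 := (abs_le.1 h1).2
    simp only [F, Sum.elim_inr, Sum.elim_inl] at h2
    linarith
  · intro j hj q hq
    have h1 := (hpz (Sum.inr (Sum.inr ⟨⟨j, by omega⟩, fun a => ⟨q a, hq a⟩⟩))).trans
        (min_le_right _ _)
    have h2 := (abs_le.1 h1).2
    simp only [F, Sum.elim_inr] at h2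
    have h3 := hcross j hj q hq
    have h4 : (1 / 2 : ℝ) ^ J ≤ (1 / 2) ^ j :=
      pow_le_pow_of_le_one (by norm_num) (by norm_num) hj
    linarith
  · intro X hX
    set q := cellIndex J' X with hq
    set Y := cellCorner J' q with hY
    have hYm : Y ∈ Set.Icc (0 : Fin d → ℝ) 1 := hcorner _ _ (cellIndex_lt J' X)
    have hr : (0 : ℝ) ≤ (1 / 2) ^ J' := by positivity
    have hlip : ∀ ω, |max 0 (w ω ⬝ᵥ X - β ω) - max 0 (w ω ⬝ᵥ Y - β ω)| ≤ (1 / 2) ^ J' := by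
      intro ω
      refine relu_sub_le (hw ω) _ (fun a => ?_) hr
      have := sub_cellCorner_mem J' hX a
      rw [abs_of_nonneg this.1]; exact this.2
    have h0 := (hpz (Sum.inl fun a => ⟨q a, cellIndex_lt J' X a⟩)).trans
      ((min_le_left _ _).trans (min_le_right _ _))
    simp only [F, Sum.elim_inl] at h0
    rw [← hY] at h0
    have hA : |∫ ω, α ω * max 0 (w ω ⬝ᵥ X - β ω) ∂P - ∫ ω, α ω * max 0 (w ω ⬝ᵥ Y - β ω) ∂P|
        ≤ (B + 1) * (1 / 2) ^ J' := by
      rw [← integral_sub (hTi X hX) (hTi Y hYm)]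
      refine (abs_integral_le_integral_abs).trans ?_
      calc _ ≤ ∫ ω, (α ω ^ 2 + 1) * (1 / 2) ^ J' ∂P := by
            refine integral_mono_of_nonneg (Filter.Eventually.of_forall fun ω => abs_nonneg _)
              ((hα.add (integrable_const 1)).mul_const _) (Filter.Eventually.of_forall fun ω => ?_)
            simp only
            rw [← mul_sub, abs_mul]
            exact mul_le_mul (habs ω) (hlip ω) (abs_nonneg _) (by positivity)
        _ ≤ _ := by
            rw [integral_mul_const, integral_add hα (integrable_const 1)]
            simp only [integral_const, probReal_univ, smul_eq_mul, mul_one]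
            gcongr
    have h5 : ∑ i, p i * α (z i) ^ 2 ≤ B + 1 := by
      have h1 := (hpz (Sum.inr (Sum.inl ()))).trans ((min_le_left _ _).trans (min_le_left _ _))
      have h2 := (abs_le.1 h1).2
      simp only [F, Sum.elim_inr, Sum.elim_inl] at h2
      linarith
    have hS : |∑ i, p i * (α (z i) * max 0 (w (z i) ⬝ᵥ Y - β (z i)))
        - ∑ i, p i * (α (z i) * max 0 (w (z i) ⬝ᵥ X - β (z i)))| ≤ (B + 2) * (1 / 2) ^ J' := by
      rw [← Finset.sum_sub_distrib]
      refine (Finset.abs_sum_le_sum_abs _ _).trans ?_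
      calc _ ≤ ∑ i, (p i * α (z i) ^ 2 + p i) * (1 / 2) ^ J' := by
            refine Finset.sum_le_sum fun i _ => ?_
            rw [← mul_sub, ← mul_sub, abs_mul, abs_mul, abs_of_nonneg (hp i), abs_sub_comm]
            calc _ ≤ p i * ((α (z i) ^ 2 + 1) * (1 / 2) ^ J') := by
                  gcongr
                  · exact hp i
                  · exact habs _
                  · exact hlip _
              _ = _ := by ring
        _ ≤ _ := by
            rw [← Finset.sum_mul, Finset.sum_add_distrib, hp1]
            exact mul_le_mul_of_nonneg_right (by linarith) hr
    rw [abs_le] at *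
    constructor <;> nlinarith [hA.1, hA.2, hS.1, hS.2, h0.1, h0.2]

/-- An integral of ridges whose kinks are spread evenly over the cube is approximated by few
ridges. -/
lemma exists_sparse_integral {d : ℕ} (hd : 2 ≤ d) : ∃ (M : ℕ) (C : ℝ), 0 < C ∧
    ∀ (κ : ℕ) {Ω : Type} [MeasurableSpace Ω] (P : Measure Ω) [IsProbabilityMeasure P]
    {w : Ω → Fin d → ℝ} {β α : Ω → ℝ}, Measurable w → Measurable β → Measurable α →
    (∀ ω, ∑ a, |w ω a| ≤ 1) → (∀ ω, |β ω| ≤ 1) → Integrable (fun ω => α ω ^ 2) P →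
    ∀ {B : ℝ}, ∫ ω, α ω ^ 2 ∂P ≤ B → 0 ≤ B →
    (∀ j ≤ 6 * κ + 2 * κ * d, ∀ q : Fin d → ℕ, (∀ a, q a < 2 ^ j) →
      ∫ ω, crossing (w ω) (β ω) j (cellCorner j q) ∂P ≤ (1 / 2) ^ j) →
    ∃ (I : Type) (_ : Fintype I) (c b : I → ℝ) (u : I → Fin d → ℝ) (v : Fin d → ℝ) (v₀ : ℝ),
      #{i | c i ≠ 0} ≤ M * 2 ^ (6 * κ * d) ∧ ∀ X ∈ Set.Icc (0 : Fin d → ℝ) 1,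
        |∫ ω, α ω * max 0 (w ω ⬝ᵥ X - β ω) ∂P - ∑ i, c i * max 0 (u i ⬝ᵥ X - b i)
          - (v ⬝ᵥ X + v₀)| ≤ C * √(B + 1) * (1 / 2) ^ (9 * κ + 3 * κ * d) := by
  classical
  obtain ⟨M, hM⟩ := exists_sparse_ridge hd
  refine ⟨M, (3 + 960 * (d + 1)) * √3 + 1, by positivity, ?_⟩
  intro κ Ω _ P _ w β α hwm hβm hαm hw hβ hα B hB hB0 hcross
  set η : ℝ := √(B + 1) * (1 / 2) ^ (9 * κ + 3 * κ * d) with hη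
  have hη0 : 0 < η := by positivity
  obtain ⟨I, hI, p, z, hp, hp1, hpα, hpc, hpX⟩ :=
    exists_ridge_discretization P hwm hβm hαm hw hβ hα hB hcross hη0
  set J := 6 * κ + 2 * κ * d with hJ
  let K : ((j : Fin (J + 1)) × (Fin d → Fin (2 ^ (j : ℕ)))) → I → ℝ := fun c i =>
    2 ^ (c.1 : ℕ) * crossing (w (z i)) (β (z i)) c.1 (cellCorner c.1 fun a => (c.2 a : ℕ))
  have : Nonempty ((j : Fin (J + 1)) × (Fin d → Fin (2 ^ (j : ℕ)))) :=
    ⟨⟨0, fun _ => ⟨0, by positivity⟩⟩⟩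
  have h2 : ∀ j : ℕ, (2 : ℝ) ^ j * (1 / 2) ^ j = 1 := fun j => by rw [← mul_pow]; norm_num
  obtain ⟨t, ht, htx, htK⟩ := exists_reweight (a := fun i => p i * |α (z i)|) (p := p)
    (b := fun i => p i * α (z i) ^ 2) (K := K) (B := B + 1)
    (fun i => mul_nonneg (hp i) (abs_nonneg _)) hp hp1.le
    (fun c i => mul_nonneg (by positivity) (crossing_mem _ _ _ _).1)
    (fun c => by
      have h1 := hpc c.1 (by have := c.1.2; omega) (fun a => (c.2 a : ℕ)) fun a => (c.2 a).2
      calc ∑ i, p i * K c i = 2 ^ (c.1 : ℕ) * ∑ i, p i *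
            crossing (w (z i)) (β (z i)) c.1 (cellCorner c.1 fun a => (c.2 a : ℕ)) := by
            rw [Finset.mul_sum]
            exact Finset.sum_congr rfl fun i _ => by simp only [K]; ring
        _ ≤ 2 ^ (c.1 : ℕ) * (2 * (1 / 2) ^ (c.1 : ℕ)) := by gcongr
        _ = 2 := by linear_combination 2 * h2 c.1)
    (fun i => by rw [mul_pow, sq_abs]; exact le_of_eq (by ring))
    (fun i => mul_nonneg (hp i) (sq_nonneg _)) hpα
  set Z := √(3 * (B + 1)) with hZ
  have hZ0 : 0 < Z := by positivity
  have hsign : ∀ r : ℝ, |(SignType.sign r : ℝ)| ≤ 1 := by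
    intro r; rcases lt_trichotomy r 0 with h | h | h <;> simp [h]
  obtain ⟨x', v, v₀, hx'N, hx'⟩ := hM κ I (fun i => w (z i)) (fun i => β (z i))
    (fun i => t i * SignType.sign (α (z i))) (fun i => p i * |α (z i)| / t i) Z hZ0
    (fun i => hw _)
    (fun i => by
      rw [abs_mul, abs_of_pos (ht i).1]
      exact mul_le_one₀ (ht i).2 (abs_nonneg _) (hsign _))
    (fun i => div_nonneg (mul_nonneg (hp i) (abs_nonneg _)) (ht i).1.le) htx
    (fun j hj q hq => by
      have h1 := htK ⟨⟨j, by omega⟩, fun a => ⟨q a, hq a⟩⟩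
      calc _ ≤ ∑ i, (p i * |α (z i)| * t i * K ⟨⟨j, by omega⟩, fun a => ⟨q a, hq a⟩⟩ i)
              * (1 / 2) ^ j := by
            refine Finset.sum_le_sum fun i _ => ?_
            have ht0 := (ht i).1
            have hs := (sq_le_one_iff_abs_le_one _).2 (hsign (α (z i)))
            have hc := (crossing_mem (w (z i)) (β (z i)) j (cellCorner j q)).1
            simp only [K]
            have hp0 := hp i
            have e1 : p i * |α (z i)| / t i * ((t i * SignType.sign (α (z i))) ^ 2 *
              crossing (w (z i)) (β (z i)) j (cellCorner j q)) = p i * |α (z i)| * t i *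
              crossing (w (z i)) (β (z i)) j (cellCorner j q) *
                (SignType.sign (α (z i)) : ℝ) ^ 2 := by
              field_simp
            rw [e1]
            calc _ ≤ p i * |α (z i)| * t i *
                crossing (w (z i)) (β (z i)) j (cellCorner j q) * 1 := by gcongr
              _ = p i * |α (z i)| * t i *
                crossing (w (z i)) (β (z i)) j (cellCorner j q) * (2 ^ j * (1 / 2) ^ j) := by
                  rw [h2]
              _ = _ := by ring
        _ ≤ _ := by rw [← Finset.sum_mul]; gcongr)
  refine ⟨I, hI, fun i => x' i * (t i * SignType.sign (α (z i))), fun i => β (z i),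
    fun i => w (z i), v, v₀, ?_, fun X hX => ?_⟩
  · refine (Finset.card_le_card ?_).trans hx'N
    intro i
    simp only [Finset.mem_filter, Finset.mem_univ, true_and]
    exact left_ne_zero_of_mul
  · have h1 := hx' X hX
    have h3 := hpX X hX
    have h4 : ∑ i, p i * |α (z i)| / t i * (t i * SignType.sign (α (z i))) *
        max 0 (w (z i) ⬝ᵥ X - β (z i)) = ∑ i, p i * (α (z i) * max 0 (w (z i) ⬝ᵥ X - β (z i))) := by
      refine Finset.sum_congr rfl fun i _ => ?_
      have ht0 := (ht i).1.ne'
      have h5 := abs_mul_sign (α (z i))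
      calc _ = p i * (|α (z i)| * SignType.sign (α (z i))) * max 0 (w (z i) ⬝ᵥ X - β (z i)) := by
            field_simp
        _ = _ := by rw [h5]; ring
    rw [h4] at h1
    have h6 : Z = √3 * √(B + 1) := by rw [hZ, Real.sqrt_mul (by norm_num)]
    calc _ = |(∫ ω, α ω * max 0 (w ω ⬝ᵥ X - β ω) ∂P
            - ∑ i, p i * (α (z i) * max 0 (w (z i) ⬝ᵥ X - β (z i)))) +
          (∑ i, p i * (α (z i) * max 0 (w (z i) ⬝ᵥ X - β (z i)))
            - ∑ i, x' i * (t i * SignType.sign (α (z i))) * max 0 (w (z i) ⬝ᵥ X - β (z i))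
            - (v ⬝ᵥ X + v₀))| := by congr 1; ring
      _ ≤ η + (3 + 960 * (d + 1)) * Z * (1 / 2) ^ (9 * κ + 3 * κ * d) :=
          (abs_add_le _ _).trans (add_le_add h3 h1)
      _ = _ := by rw [hη, h6]; ring

/-- The Gaussian `exp (-x²/2)` times the Hermite polynomials, i.e. its derivatives up to sign. -/
noncomputable def gaussDeriv : ℕ → ℝ → ℝ
  | 0, x => Real.exp (-x ^ 2 / 2)
  | 1, x => x * Real.exp (-x ^ 2 / 2)
  | n + 2, x => x * gaussDeriv (n + 1) x - (n + 1) * gaussDeriv n x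

lemma hasDerivAt_gaussDeriv (n : ℕ) (x : ℝ) :
    HasDerivAt (gaussDeriv n) (-gaussDeriv (n + 1) x) x := by
  have h0 : ∀ x, HasDerivAt (gaussDeriv 0) (-gaussDeriv 1 x) x := fun x => by
    have h1 : HasDerivAt (fun x : ℝ => -x ^ 2 / 2) (-x) x := by
      have := ((hasDerivAt_pow 2 x).neg).div_const 2
      refine HasDerivAt.congr_deriv this ?_
      norm_num; ring
    have h2 := h1.exp
    have h3 : gaussDeriv 0 = fun x => Real.exp (-x ^ 2 / 2) := by ext; simp [gaussDeriv]
    rw [h3]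
    refine HasDerivAt.congr_deriv h2 ?_
    simp only [gaussDeriv]; ring
  have key : ∀ n, (∀ x, HasDerivAt (gaussDeriv n) (-gaussDeriv (n + 1) x) x) ∧
      (∀ x, HasDerivAt (gaussDeriv (n + 1)) (-gaussDeriv (n + 2) x) x) := by
    intro n
    induction n with
    | zero =>
      refine ⟨h0, fun x => ?_⟩
      have h3 : gaussDeriv 1 = fun x => x * gaussDeriv 0 x := by ext; simp [gaussDeriv]
      have h2 := (hasDerivAt_id x).mul (h0 x)
      rw [zero_add, h3]
      refine HasDerivAt.congr_deriv h2 ?_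
      simp only [gaussDeriv, id]; push_cast; ring
    | succ n ih =>
      refine ⟨ih.2, fun x => ?_⟩
      have h3 : gaussDeriv (n + 2) =
          fun x => x * gaussDeriv (n + 1) x - (n + 1) * gaussDeriv n x := by
        ext; simp [gaussDeriv]
      have h2 := ((hasDerivAt_id x).mul (ih.2 x)).sub ((ih.1 x).const_mul ((n : ℝ) + 1))
      rw [show n + 1 + 1 = n + 2 by ring, h3]
      refine HasDerivAt.congr_deriv h2 ?_
      simp only [gaussDeriv, id]; push_cast; ring
  exact (key n).1 x

lemma continuous_gaussDeriv (n : ℕ) : Continuous (gaussDeriv n) :=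
  continuous_iff_continuousAt.2 fun x => (hasDerivAt_gaussDeriv n x).continuousAt

lemma exists_gaussDeriv_le (n m : ℕ) : ∃ C, 0 < C ∧ ∀ x,
    |gaussDeriv n x| ≤ C * ((1 + |x|) ^ m)⁻¹ := by
  suffices h : ∀ n m : ℕ, ∃ C, 0 < C ∧ ∀ x, (1 + |x|) ^ m * |gaussDeriv n x| ≤ C by
    obtain ⟨C, hC, h⟩ := h n m
    refine ⟨C, hC, fun x => ?_⟩
    rw [← div_eq_mul_inv, le_div_iff₀ (by positivity), mul_comm]
    exact h x
  have h0 : ∀ m : ℕ, ∃ C, 0 < C ∧ ∀ x, (1 + |x|) ^ m * |gaussDeriv 0 x| ≤ C := by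
    intro m
    refine ⟨Real.exp (m ^ 2 / 2), Real.exp_pos _, fun x => ?_⟩
    have h1 : 1 + |x| ≤ Real.exp |x| := by linarith [Real.add_one_le_exp |x|]
    simp only [gaussDeriv]
    rw [abs_of_pos (Real.exp_pos _)]
    calc _ ≤ Real.exp |x| ^ m * Real.exp (-x ^ 2 / 2) := by gcongr
      _ = Real.exp (m * |x| + -x ^ 2 / 2) := by rw [← Real.exp_nat_mul, ← Real.exp_add]
      _ ≤ _ := by
        rw [Real.exp_le_exp, ← sq_abs x]
        nlinarith [sq_nonneg (m - |x|)]
  have h1 : ∀ n, (∀ m : ℕ, ∃ C, 0 < C ∧ ∀ x, (1 + |x|) ^ m * |gaussDeriv n x| ≤ C) →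
      ∀ m : ℕ, ∃ C, 0 < C ∧ ∀ x, (1 + |x|) ^ m * |x * gaussDeriv n x| ≤ C := by
    intro n h m
    obtain ⟨C, hC, h⟩ := h (m + 1)
    refine ⟨C, hC, fun x => le_trans ?_ (h x)⟩
    rw [abs_mul, pow_succ, mul_assoc]
    gcongr
    linarith
  have key : ∀ n, (∀ m : ℕ, ∃ C, 0 < C ∧ ∀ x, (1 + |x|) ^ m * |gaussDeriv n x| ≤ C) ∧
      (∀ m : ℕ, ∃ C, 0 < C ∧ ∀ x, (1 + |x|) ^ m * |gaussDeriv (n + 1) x| ≤ C) := by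
    intro n
    induction n with
    | zero =>
      refine ⟨h0, fun m => ?_⟩
      obtain ⟨C, hC, h⟩ := h1 0 h0 m
      exact ⟨C, hC, fun x => by simpa [gaussDeriv] using h x⟩
    | succ n ih =>
      refine ⟨ih.2, fun m => ?_⟩
      obtain ⟨C, hC, h⟩ := h1 _ ih.2 m
      obtain ⟨C', hC', h'⟩ := ih.1 m
      refine ⟨C + (n + 1) * C', by positivity, fun x => ?_⟩
      simp only [gaussDeriv]
      have h2 : |x * gaussDeriv (n + 1) x - (n + 1) * gaussDeriv n x| ≤
          |x * gaussDeriv (n + 1) x| + (n + 1) * |gaussDeriv n x| := by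
        refine (abs_sub _ _).trans ?_
        rw [abs_mul ((n : ℝ) + 1), abs_of_pos (by positivity : (0 : ℝ) < n + 1)]
      calc _ ≤ (1 + |x|) ^ m * (|x * gaussDeriv (n + 1) x| + (n + 1) * |gaussDeriv n x|) := by
            gcongr
        _ = (1 + |x|) ^ m * |x * gaussDeriv (n + 1) x|
            + (n + 1) * ((1 + |x|) ^ m * |gaussDeriv n x|) := by ring
        _ ≤ _ := add_le_add (h x) (mul_le_mul_of_nonneg_left (h' x) (by positivity))
  exact fun n => (key n).1

lemma gaussDeriv_bdd (n : ℕ) : ∃ C, 0 < C ∧ ∀ x, |gaussDeriv n x| ≤ C := by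
  obtain ⟨C, hC, h⟩ := exists_gaussDeriv_le n 0
  exact ⟨C, hC, fun x => by simpa using h x⟩

lemma integrable_inv_one_add_abs_pow {m : ℕ} (hm : 2 ≤ m) :
    Integrable fun x : ℝ => ((1 + |x|) ^ m)⁻¹ := by
  have h := integrable_one_add_norm (E := ℝ) (μ := volume) (r := m)
    (by simp only [Module.finrank_self]; exact_mod_cast hm)
  refine h.congr (Filter.Eventually.of_forall fun x => ?_)
  simp only [Real.norm_eq_abs]
  rw [Real.rpow_neg (by positivity), Real.rpow_natCast]

lemma integrable_mul_gaussDeriv (n m : ℕ) {f : ℝ → ℝ} (hf : Continuous f) {C : ℝ}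
    (h : ∀ x, |f x| ≤ C * (1 + |x|) ^ m) : Integrable fun x => f x * gaussDeriv n x := by
  obtain ⟨C', hC', h'⟩ := exists_gaussDeriv_le n (m + 2)
  have hC : 0 ≤ C := by
    have := (abs_nonneg _).trans (h 0); simpa using this
  refine ((integrable_inv_one_add_abs_pow le_rfl).const_mul (C * C')).mono'
    (hf.mul (continuous_gaussDeriv n)).aestronglyMeasurable
      (Filter.Eventually.of_forall fun x => ?_)
  have h1 : 0 < 1 + |x| := by positivity
  rw [Real.norm_eq_abs, abs_mul]
  calc _ ≤ C * (1 + |x|) ^ m * (C' * ((1 + |x|) ^ (m + 2))⁻¹) := by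
        gcongr
        · exact h x
        · exact h' x
    _ = _ := by rw [pow_add]; field_simp

lemma integrable_gaussDeriv (n : ℕ) : Integrable (gaussDeriv n) := by
  simpa using integrable_mul_gaussDeriv n 0 (f := fun _ => 1) continuous_const (C := 1) (by simp)

lemma integrable_gaussDeriv_measure (n : ℕ) (μ : Measure ℝ) [IsFiniteMeasure μ] :
    Integrable (gaussDeriv n) μ := by
  obtain ⟨C, _, h⟩ := gaussDeriv_bdd n
  exact Integrable.of_bound (continuous_gaussDeriv n).aestronglyMeasurable C
    (Filter.Eventually.of_forall h)

open ProbabilityTheory in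
/-- Gaussian integration by parts. -/
lemma integral_mul_gaussDeriv_gaussianReal (n : ℕ) (v : NNReal) :
    ∫ x, x * gaussDeriv n x ∂gaussianReal 0 v =
      -v * ∫ x, gaussDeriv (n + 1) x ∂gaussianReal 0 v := by
  by_cases hv : v = 0
  · subst hv; simp
  have hv' : (0 : ℝ) < v := by positivity
  rw [integral_gaussianReal_eq_integral_smul hv, integral_gaussianReal_eq_integral_smul hv]
  have hpdf : ∀ x, HasDerivAt (gaussianPDFReal 0 v) (-(x / v) * gaussianPDFReal 0 v x) x := by
    intro x
    have h1 : HasDerivAt (fun x : ℝ => -(x - 0) ^ 2 / (2 * v)) (-(x / v)) x := by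
      have := ((((hasDerivAt_id x).sub_const 0).pow 2).neg).div_const (2 * (v : ℝ))
      refine HasDerivAt.congr_deriv this ?_
      simp; field_simp
    have := h1.exp.const_mul (√(2 * Real.pi * v))⁻¹
    rw [gaussianPDFReal_def]
    refine HasDerivAt.congr_deriv this ?_
    ring
  have hpdfb : ∀ x, |gaussianPDFReal 0 v x| ≤ (√(2 * Real.pi * v))⁻¹ := by
    intro x
    rw [abs_of_nonneg (gaussianPDFReal_nonneg _ _ _)]
    simp only [gaussianPDFReal]
    refine mul_le_of_le_one_right (by positivity) (Real.exp_le_one_iff.2 ?_)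
    exact div_nonpos_of_nonpos_of_nonneg (by nlinarith [sq_nonneg (x - 0)]) (by positivity)
  have hpdfc : Continuous (gaussianPDFReal 0 v) :=
    continuous_iff_continuousAt.2 fun x => (hpdf x).continuousAt
  have hI : ∀ k, Integrable fun x => gaussianPDFReal 0 v x * gaussDeriv k x := fun k =>
    integrable_mul_gaussDeriv k 0 hpdfc (by simpa using hpdfb)
  have hIx : Integrable fun x => x * gaussianPDFReal 0 v x * gaussDeriv n x :=
    integrable_mul_gaussDeriv n 1 (continuous_id.mul hpdfc) (C := (√(2 * Real.pi * v))⁻¹) (by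
      intro x
      rw [abs_mul, pow_one, mul_comm]
      have := hpdfb x
      have h2 : |x| ≤ 1 + |x| := by linarith
      gcongr)
  have := integral_mul_deriv_eq_deriv_mul_of_integrable (u := gaussDeriv n)
    (v := gaussianPDFReal 0 v) (u' := fun x => -gaussDeriv (n + 1) x)
    (v' := fun x => -(x / v) * gaussianPDFReal 0 v x)
    (fun x _ => hasDerivAt_gaussDeriv n x) (fun x _ => hpdf x)
    ((hIx.const_mul (-1 / (v : ℝ))).congr (Filter.Eventually.of_forall fun x => by
      simp only [Pi.mul_apply]; ring))
    ((hI (n + 1)).neg.congr (Filter.Eventually.of_forall fun x => by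
      simp only [Pi.mul_apply, Pi.neg_apply]; ring))
    ((hI n).congr (Filter.Eventually.of_forall fun x => by
      simp only [Pi.mul_apply]; ring))
  have e1 : ∫ x, gaussDeriv n x * (-(x / v) * gaussianPDFReal 0 v x) =
      -(1 / v) * ∫ x, gaussianPDFReal 0 v x • (x * gaussDeriv n x) := by
    rw [← integral_const_mul]
    congr 1; ext x; simp only [smul_eq_mul]; ring
  have e2 : ∫ x, -gaussDeriv (n + 1) x * gaussianPDFReal 0 v x =
      - ∫ x, gaussianPDFReal 0 v x • gaussDeriv (n + 1) x := by
    rw [← integral_neg]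
    congr 1; ext x; simp only [smul_eq_mul]; ring
  rw [e1, e2] at this
  field_simp at this
  linarith

open ProbabilityTheory in
lemma integral_gaussDeriv_add_two (n : ℕ) (v : NNReal) :
    (1 + v) * ∫ x, gaussDeriv (n + 2) x ∂gaussianReal 0 v
      = -(n + 1) * ∫ x, gaussDeriv n x ∂gaussianReal 0 v := by
  have h1 := integral_mul_gaussDeriv_gaussianReal (n + 1) v
  have h2 := integrable_gaussDeriv_measure n (gaussianReal 0 v)
  have h3 := integrable_gaussDeriv_measure (n + 2) (gaussianReal 0 v)
  have h4 : Integrable (fun x => x * gaussDeriv (n + 1) x) (gaussianReal 0 v) := by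
    refine (h3.add (h2.const_mul (n + 1))).congr (Filter.Eventually.of_forall fun x => ?_)
    simp only [Pi.add_apply, gaussDeriv]; ring
  have h5 : ∫ x, gaussDeriv (n + 2) x ∂gaussianReal 0 v =
      ∫ x, x * gaussDeriv (n + 1) x ∂gaussianReal 0 v
        - (n + 1) * ∫ x, gaussDeriv n x ∂gaussianReal 0 v := by
    rw [← integral_const_mul, ← integral_sub h4 (h2.const_mul _)]
    rfl
  linarith

open ProbabilityTheory in
/-- The Gaussian averages of the even `gaussDeriv` alternate in sign and decay in the variance. -/
lemma integral_gaussDeriv_even (L : ℕ) : ∃ C, 0 < C ∧ ∀ v : NNReal,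
    (-1) ^ L * ∫ x, gaussDeriv (2 * L) x ∂gaussianReal 0 v ∈
      Set.Ioc 0 (C * ((1 + (v : ℝ)) ^ L)⁻¹) := by
  induction L with
  | zero =>
    refine ⟨1, one_pos, fun v => ?_⟩
    have h0 := integrable_gaussDeriv_measure 0 (gaussianReal 0 v)
    have h1 : ∀ x, gaussDeriv 0 x ≤ 1 := fun x => by
      simp only [gaussDeriv]
      exact Real.exp_le_one_iff.2 (by nlinarith [sq_nonneg x])
    have h2 : ∀ x, 0 < gaussDeriv 0 x := fun x => Real.exp_pos _
    simp only [pow_zero, one_mul, mul_zero, inv_one, mul_one]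
    constructor
    · rw [integral_pos_iff_support_of_nonneg (fun x => (h2 x).le) h0]
      have : Function.support (gaussDeriv 0) = Set.univ := by
        ext x; simp [(h2 x).ne']
      rw [this]; simp
    · calc _ ≤ ∫ x, (1 : ℝ) ∂gaussianReal 0 v := integral_mono h0 (integrable_const _) h1
        _ = 1 := by simp
  | succ L ih =>
    obtain ⟨C, hC, h⟩ := ih
    refine ⟨(2 * L + 1) * C, by positivity, fun v => ?_⟩
    have h1 := integral_gaussDeriv_add_two (2 * L) v
    have h2 := h v
    have hv : (0 : ℝ) < 1 + v := by positivity
    have h3 : (-1) ^ (L + 1) * ∫ x, gaussDeriv (2 * (L + 1)) x ∂gaussianReal 0 v =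
        (2 * L + 1) / (1 + v) * ((-1) ^ L * ∫ x, gaussDeriv (2 * L) x ∂gaussianReal 0 v) := by
      rw [show 2 * (L + 1) = 2 * L + 2 by ring, pow_succ]
      push_cast at h1
      rw [div_mul_eq_mul_div, eq_div_iff hv.ne']
      linear_combination (-(-1) ^ L) * h1
    rw [h3]
    refine ⟨mul_pos (by positivity) h2.1, ?_⟩
    calc _ ≤ (2 * L + 1) / (1 + (v : ℝ)) * (C * ((1 + (v : ℝ)) ^ L)⁻¹) :=
          mul_le_mul_of_nonneg_left h2.2 (by positivity)
      _ = _ := by rw [pow_succ]; field_simp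

open ProbabilityTheory in
lemma map_dotProduct_pi_gaussianReal {d : ℕ} (z : Fin d → ℝ) :
    (Measure.pi fun _ : Fin d => gaussianReal 0 1).map (fun w => w ⬝ᵥ z)
      = gaussianReal 0 (∑ a, z a ^ 2).toNNReal := by
  have hm : Measurable fun w : Fin d → ℝ => w ⬝ᵥ z := by unfold dotProduct; fun_prop
  have : IsProbabilityMeasure ((Measure.pi fun _ : Fin d => gaussianReal 0 1).map
      (fun w => w ⬝ᵥ z)) := Measure.isProbabilityMeasure_map hm.aemeasurable
  refine Measure.ext_of_charFun ?_
  ext t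
  rw [charFun_gaussianReal, charFun_apply_real, integral_map hm.aemeasurable (by fun_prop)]
  have h1 : ∀ w : Fin d → ℝ, Complex.exp (t * (w ⬝ᵥ z : ℝ) * Complex.I)
      = ∏ a, Complex.exp ((t * z a : ℝ) * w a * Complex.I) := by
    intro w
    rw [← Complex.exp_sum]
    congr 1
    unfold dotProduct
    push_cast
    rw [Finset.mul_sum, Finset.sum_mul]
    exact Finset.sum_congr rfl fun a _ => by ring
  simp_rw [h1]
  rw [integral_fintype_prod_eq_prod (fun a (x : ℝ) => Complex.exp ((t * z a : ℝ) * x * Complex.I))]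
  simp_rw [← charFun_apply_real, charFun_gaussianReal]
  rw [← Complex.exp_sum]
  congr 1
  rw [Real.coe_toNNReal _ (by positivity)]
  push_cast
  rw [Finset.sum_mul, Finset.sum_div]
  simp only [mul_zero, zero_mul, zero_sub]
  rw [Finset.sum_neg_distrib]
  congr 1
  exact Finset.sum_congr rfl fun a _ => by ring

open ProbabilityTheory in
lemma integral_gaussDeriv_dotProduct {d : ℕ} (n : ℕ) (z : Fin d → ℝ) :
    ∫ w, gaussDeriv n (w ⬝ᵥ z) ∂(Measure.pi fun _ : Fin d => gaussianReal 0 1)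
      = ∫ x, gaussDeriv n x ∂gaussianReal 0 (∑ a, z a ^ 2).toNNReal := by
  have hm : Measurable fun w : Fin d → ℝ => w ⬝ᵥ z := by unfold dotProduct; fun_prop
  rw [← map_dotProduct_pi_gaussianReal, integral_map hm.aemeasurable
    (continuous_gaussDeriv n).aestronglyMeasurable]

lemma hasDerivAt_gaussDeriv_sub (n : ℕ) (u b : ℝ) :
    HasDerivAt (fun b => gaussDeriv n (u - b)) (gaussDeriv (n + 1) (u - b)) b := by
  have h := (hasDerivAt_gaussDeriv n (u - b)).comp b ((hasDerivAt_id b).const_sub u)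
  exact HasDerivAt.congr_deriv h (by ring)

lemma integrable_gaussDeriv_sub (n : ℕ) (u : ℝ) : Integrable fun b => gaussDeriv n (u - b) :=
  (integrable_gaussDeriv n).comp_sub_left u

lemma integrable_gaussDeriv_mul (n m : ℕ) (u u' : ℝ) :
    Integrable fun b => gaussDeriv n (u - b) * gaussDeriv m (u' - b) := by
  obtain ⟨C, hC, h⟩ := gaussDeriv_bdd m
  exact (integrable_gaussDeriv_sub n u).mul_bdd (c := C)
    ((continuous_gaussDeriv m).comp (continuous_const.sub continuous_id)).aestronglyMeasurable
    (Filter.Eventually.of_forall fun b => h _)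

open ProbabilityTheory in
lemma integral_gaussDeriv_mul_gaussDeriv (n : ℕ) (u u' : ℝ) :
    ∫ b, gaussDeriv n (u - b) * gaussDeriv n (u' - b) =
      (-1) ^ n * √(2 * Real.pi) * ∫ y, gaussDeriv (2 * n) (u - u' + y) ∂gaussianReal 0 1 := by
  have step : ∀ n m, ∫ b, gaussDeriv n (u - b) * gaussDeriv (m + 1) (u' - b) =
      -∫ b, gaussDeriv (n + 1) (u - b) * gaussDeriv m (u' - b) := fun n m =>
    integral_mul_deriv_eq_deriv_mul_of_integrable
      (fun b _ => hasDerivAt_gaussDeriv_sub n u b) (fun b _ => hasDerivAt_gaussDeriv_sub m u' b)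
      (integrable_gaussDeriv_mul n (m + 1) u u') (integrable_gaussDeriv_mul (n + 1) m u u')
      (integrable_gaussDeriv_mul n m u u')
  have iter : ∀ m n, ∫ b, gaussDeriv n (u - b) * gaussDeriv m (u' - b) =
      (-1) ^ m * ∫ b, gaussDeriv (n + m) (u - b) * gaussDeriv 0 (u' - b) := by
    intro m
    induction m with
    | zero => intro n; simp
    | succ m ih =>
      intro n
      rw [step, ih, show n + 1 + m = n + (m + 1) by ring, pow_succ]; ring
  rw [iter, ← two_mul, integral_gaussianReal_eq_integral_smul one_ne_zero, mul_assoc]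
  congr 1
  rw [← integral_sub_left_eq_self
      (fun b => gaussDeriv (2 * n) (u - b) * gaussDeriv 0 (u' - b)) _ u',
    ← integral_const_mul]
  congr 1
  ext y
  have h1 : √(2 * Real.pi) * gaussianPDFReal 0 1 y = gaussDeriv 0 y := by
    simp only [gaussianPDFReal, gaussDeriv, NNReal.coe_one, mul_one, sub_zero]
    rw [← mul_assoc, mul_inv_cancel₀ (by positivity), one_mul]
  rw [smul_eq_mul, ← mul_assoc, h1, show u - (u' - y) = u - u' + y by ring,
    show u' - (u' - y) = y by ring]
  ring

open ProbabilityTheory in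
lemma integral_integral_gaussDeriv_mul {d : ℕ} (n : ℕ) (z z' : Fin d → ℝ) :
    ∫ w, (∫ b, gaussDeriv n (w ⬝ᵥ z - b) * gaussDeriv n (w ⬝ᵥ z' - b))
        ∂(Measure.pi fun _ : Fin d => gaussianReal 0 1) =
      √(2 * Real.pi) * ((-1) ^ n *
        ∫ x, gaussDeriv (2 * n) x ∂gaussianReal 0 ((∑ a, (z a - z' a) ^ 2).toNNReal + 1)) := by
  simp_rw [integral_gaussDeriv_mul_gaussDeriv]
  rw [integral_const_mul, mul_comm ((-1 : ℝ) ^ n), mul_assoc]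
  congr 2
  have hm : Measurable fun w : Fin d → ℝ => w ⬝ᵥ (z - z') := by unfold dotProduct; fun_prop
  have h1 := gaussianReal_conv_gaussianReal (m₁ := 0) (m₂ := 0)
    (v₁ := (∑ a, (z a - z' a) ^ 2).toNNReal) (v₂ := 1)
  rw [add_zero] at h1
  obtain ⟨C, _, hC⟩ := gaussDeriv_bdd (2 * n)
  rw [← h1, integral_conv (integrable_gaussDeriv_measure _ _)]
  have h2 := map_dotProduct_pi_gaussianReal (z - z')
  simp only [Pi.sub_apply] at h2
  rw [← h2, integral_map hm.aemeasurable]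
  · simp_rw [dotProduct_sub]
  · refine StronglyMeasurable.aestronglyMeasurable ?_
    refine StronglyMeasurable.integral_prod_right'
      (f := fun x : ℝ × ℝ => gaussDeriv (2 * n) (x.1 + x.2)) ?_
    exact ((continuous_gaussDeriv _).comp (continuous_fst.add continuous_snd)).stronglyMeasurable

lemma abs_sub_le_one_add_mul (u v b : ℝ) : |v - b| ≤ (1 + |u - v|) * (1 + |u - b|) := by
  have h : |v - b| ≤ |u - v| + |u - b| := by
    rw [show v - b = (u - b) - (u - v) by ring]
    exact (abs_sub _ _).trans (by linarith)
  nlinarith [abs_nonneg (u - v), abs_nonneg (u - b)]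

lemma integrable_gaussDeriv_sub_mul (n : ℕ) (u v : ℝ) {f : ℝ → ℝ} (hf : Continuous f)
    (h : ∀ x, |f x| ≤ |x|) : Integrable fun b => gaussDeriv n (u - b) * f (v - b) := by
  have h1 := (integrable_mul_gaussDeriv n 1 (f := fun y => f (v - u + y))
    (hf.comp (continuous_const.add continuous_id)) (C := 1 + |u - v|) (fun y => by
      rw [pow_one]
      refine (h _).trans ?_
      have := abs_sub_le_one_add_mul u v (u - y)
      rwa [show v - (u - y) = v - u + y by ring,
          show u - (u - y) = y by ring] at this)).comp_sub_left u
  refine h1.congr (Filter.Eventually.of_forall fun b => ?_)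
  simp only
  rw [show v - u + (u - b) = v - b by ring, mul_comm]

/-- Convolving `gaussDeriv (n + 2)` with the ReLU gives `gaussDeriv n`. -/
lemma integral_gaussDeriv_mul_relu (n : ℕ) (u v : ℝ) :
    ∫ b, gaussDeriv (n + 2) (u - b) * max 0 (v - b) = gaussDeriv n (u - v) := by
  have hF : ∀ b, HasDerivAt (fun b => gaussDeriv (n + 1) (u - b) * (v - b) + gaussDeriv n (u - b))
      (gaussDeriv (n + 2) (u - b) * (v - b)) b := fun b => by
    have h1 := ((hasDerivAt_gaussDeriv_sub (n + 1) u b).mul ((hasDerivAt_id b).const_sub v)).add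
      (hasDerivAt_gaussDeriv_sub n u b)
    exact HasDerivAt.congr_deriv h1 (by simp)
  have hi : ∀ n, Integrable fun b => gaussDeriv n (u - b) * (v - b) := fun n =>
    integrable_gaussDeriv_sub_mul n u v (f := fun x => x) continuous_id fun x => le_rfl
  have h0 : ∀ b ∉ Set.Iic v, gaussDeriv (n + 2) (u - b) * max 0 (v - b) = 0 := fun b hb => by
    have : v < b := lt_of_not_ge hb
    rw [max_eq_left (by linarith), mul_zero]
  rw [← setIntegral_eq_integral_of_forall_compl_eq_zero h0]
  rw [setIntegral_congr_fun (g := fun b => gaussDeriv (n + 2) (u - b) * (v - b)) measurableSet_Iic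
    (fun b hb => by
      have : b ≤ v := hb
      simp only; rw [max_eq_right (by linarith)])]
  rw [integral_Iic_of_hasDerivAt_of_tendsto' (fun b _ => hF b) (hi _).integrableOn
    (tendsto_zero_of_hasDerivAt_of_integrableOn_Iic (a := v) (fun b _ => hF b) (hi _).integrableOn
      ((hi _).add (integrable_gaussDeriv_sub n u)).integrableOn)]
  simp

lemma exists_integral_gaussDeriv_mul_relu_le (n : ℕ) : ∃ C, 0 < C ∧ ∀ u v : ℝ,
    ∫ b, |gaussDeriv n (u - b) * max 0 (v - b)| ≤ C * (1 + |u - v|) := by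
  have h1 : Integrable fun y => |(1 + |y|) * gaussDeriv n y| :=
    (integrable_mul_gaussDeriv n 1 (f := fun y => 1 + |y|) (by fun_prop) (C := 1) (fun y => by
      rw [pow_one, one_mul, abs_of_nonneg (by positivity)])).abs
  have h2 : 0 ≤ ∫ y, |(1 + |y|) * gaussDeriv n y| := integral_nonneg fun y => abs_nonneg _
  refine ⟨(∫ y, |(1 + |y|) * gaussDeriv n y|) + 1, by linarith, fun u v => ?_⟩
  calc ∫ b, |gaussDeriv n (u - b) * max 0 (v - b)|
      ≤ ∫ b, (1 + |u - v|) * |(1 + |u - b|) * gaussDeriv n (u - b)| := by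
        refine integral_mono_of_nonneg (Filter.Eventually.of_forall fun b => abs_nonneg _)
          ((h1.comp_sub_left u).const_mul _) (Filter.Eventually.of_forall fun b => ?_)
        have h3 : |max 0 (v - b)| ≤ |v - b| := by
          rw [abs_of_nonneg (le_max_left _ _)]
          exact max_le (abs_nonneg _) (le_abs_self _)
        simp only
        rw [abs_mul, abs_mul, abs_of_nonneg (by positivity : 0 ≤ 1 + |u - b|), ← mul_assoc,
            mul_comm]
        exact mul_le_mul_of_nonneg_right (h3.trans (abs_sub_le_one_add_mul u v b)) (abs_nonneg _)
    _ = (1 + |u - v|) * ∫ y, |(1 + |y|) * gaussDeriv n y| := by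
        rw [integral_const_mul, integral_sub_left_eq_self (fun y => |(1 + |y|) * gaussDeriv n y|)]
    _ ≤ _ := by nlinarith [abs_nonneg (u - v)]

lemma abs_clamp_sub_le {k : ℝ} (s t : ℝ) :
    |min k (max 0 s) - min k (max 0 t)| ≤ |s - t| := by
  refine (abs_min_sub_min_le_max _ _ _ _).trans ?_
  rw [sub_self, abs_zero]
  refine max_le (abs_nonneg _) ((abs_max_sub_max_le_max _ _ _ _).trans ?_)
  rw [sub_self, abs_zero]
  exact max_le (abs_nonneg _) le_rfl

lemma abs_sub_clamp_sub_le {k : ℝ} (s t : ℝ) :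
    |(s - min k (max 0 s)) - (t - min k (max 0 t))| ≤ |s - t| := by
  have mono : Monotone fun s : ℝ => min k (max 0 s) := fun a b hab => by dsimp only; gcongr
  wlog hst : s ≤ t generalizing s t
  · rw [abs_sub_comm, abs_sub_comm s]; exact this t s (le_of_not_ge hst)
  have h1 := mono hst
  have h2 := abs_clamp_sub_le (k := k) s t
  dsimp only at h1
  rw [abs_le]
  rw [abs_of_nonpos (sub_nonpos.2 hst)] at h2 ⊢
  rw [abs_of_nonpos (sub_nonpos.2 h1)] at h2
  constructor <;> linarith

/-- A `1`-Lipschitz function on the unit cube, dilated by `k`, extends to a compactly supported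
Lipschitz function. -/
lemma exists_lipschitz_extension {d : ℕ} {h : (Fin d → ℝ) → ℝ}
    (hmem : ∀ x ∈ Set.Icc (0 : Fin d → ℝ) 1, h x ∈ Set.Icc (0 : ℝ) 1)
    (hlip : ∀ x ∈ Set.Icc (0 : Fin d → ℝ) 1, ∀ y ∈ Set.Icc (0 : Fin d → ℝ) 1,
      |h x - h y| ≤ ‖x - y‖) {k : ℝ} (hk : 0 < k) :
    ∃ H : (Fin d → ℝ) → ℝ, LipschitzWith 2 H ∧
      (∀ y ∉ Set.Icc (fun _ => -k : Fin d → ℝ) (fun _ => 2 * k), H y = 0) ∧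
      ∀ x ∈ Set.Icc (0 : Fin d → ℝ) 1, H (k • x) = k * h x := by
  set c : (Fin d → ℝ) → Fin d → ℝ := fun y a => min k (max 0 (y a)) with hc
  have hcI : ∀ y, k⁻¹ • c y ∈ Set.Icc (0 : Fin d → ℝ) 1 := fun y => by
    refine ⟨fun a => ?_, fun a => ?_⟩
    · simp only [hc, Pi.smul_apply, smul_eq_mul, Pi.zero_apply]; positivity
    · simp only [hc, Pi.smul_apply, smul_eq_mul, Pi.one_apply]
      rw [inv_mul_le_iff₀ hk, mul_one]; exact min_le_left _ _
  have hcL : ∀ y y', ‖c y - c y'‖ ≤ ‖y - y'‖ := fun y y' =>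
    (pi_norm_le_iff_of_nonneg (norm_nonneg _)).2 fun a =>
      (abs_clamp_sub_le _ _).trans (norm_le_pi_norm (y - y') a)
  have hcL' : ∀ y y', ‖(y - c y) - (y' - c y')‖ ≤ ‖y - y'‖ := fun y y' =>
    (pi_norm_le_iff_of_nonneg (norm_nonneg _)).2 fun a =>
      (abs_sub_clamp_sub_le _ _).trans (norm_le_pi_norm (y - y') a)
  refine ⟨fun y => max 0 (k * h (k⁻¹ • c y) - ‖y - c y‖), ?_, ?_, ?_⟩
  · refine LipschitzWith.of_dist_le_mul fun y y' => ?_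
    rw [Real.dist_eq, dist_eq_norm, NNReal.coe_ofNat]
    refine (abs_max_sub_max_le_max _ _ _ _).trans ?_
    rw [sub_self, abs_zero]
    refine max_le (by positivity) ?_
    have h1 : |k * h (k⁻¹ • c y) - k * h (k⁻¹ • c y')| ≤ ‖y - y'‖ := by
      rw [← mul_sub, abs_mul, abs_of_pos hk]
      refine (mul_le_mul_of_nonneg_left (hlip _ (hcI y) _ (hcI y')) hk.le).trans ?_
      rw [← smul_sub, norm_smul, Real.norm_of_nonneg (by positivity), ← mul_assoc,
        mul_inv_cancel₀ hk.ne', one_mul]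
      exact hcL _ _
    have h2 : |‖y - c y‖ - ‖y' - c y'‖| ≤ ‖y - y'‖ := (abs_norm_sub_norm_le _ _).trans (hcL' _ _)
    rw [abs_le] at *
    constructor <;> linarith [h1.1, h1.2, h2.1, h2.2]
  · intro y hy
    refine max_eq_left ?_
    have h1 : k * h (k⁻¹ • c y) ≤ k := mul_le_of_le_one_right hk.le (hmem _ (hcI y)).2
    suffices h : k ≤ ‖y - c y‖ by linarith
    rw [Set.mem_Icc, not_and_or] at hy
    simp only [Pi.le_def, not_forall, not_le] at hy
    rcases hy with ⟨a, ha⟩ | ⟨a, ha⟩ <;> refine le_trans ?_ (norm_le_pi_norm (y - c y) a)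
    · simp only [hc, Pi.sub_apply, Real.norm_eq_abs]
      rw [max_eq_left (by linarith), min_eq_right hk.le, abs_of_nonpos (by linarith)]; linarith
    · simp only [hc, Pi.sub_apply, Real.norm_eq_abs]
      rw [max_eq_right (by linarith), min_eq_left (by linarith), abs_of_nonneg (by linarith)]
      linarith
  · intro x hx
    have h1 : c (k • x) = k • x := by
      ext a
      have := hx.1 a; have := hx.2 a
      simp only [Pi.zero_apply, Pi.one_apply] at *
      simp only [hc, Pi.smul_apply, smul_eq_mul]
      rw [max_eq_right (by positivity), min_eq_right (by nlinarith)]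
    dsimp only
    rw [h1, smul_smul, inv_mul_cancel₀ hk.ne', one_smul, sub_self, norm_zero, sub_zero]
    exact max_eq_right (mul_nonneg hk.le (hmem x hx).1)

/-- The standard Gaussian measure on `Fin d → ℝ`. -/
noncomputable abbrev gaussPi (d : ℕ) : Measure (Fin d → ℝ) :=
  Measure.pi fun _ : Fin d => ProbabilityTheory.gaussianReal 0 1

/-- The Gaussian average of `gaussDeriv n (w ⬝ᵥ z)` over the directions `w`. -/
noncomputable def ridgeKernel {d : ℕ} (n : ℕ) (z : Fin d → ℝ) : ℝ :=
  ∫ w, gaussDeriv n (w ⬝ᵥ z) ∂gaussPi d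

lemma measurable_ridgeKernel {d : ℕ} (n : ℕ) : Measurable (ridgeKernel (d := d) n) := by
  refine StronglyMeasurable.measurable ?_
  refine StronglyMeasurable.integral_prod_right'
    (f := fun p : (Fin d → ℝ) × (Fin d → ℝ) => gaussDeriv n (p.2 ⬝ᵥ p.1)) ?_
  refine ((continuous_gaussDeriv n).comp ?_).stronglyMeasurable
  unfold dotProduct; fun_prop

lemma norm_sq_le_sum_sq {d : ℕ} (z : Fin d → ℝ) : ‖z‖ ^ 2 ≤ ∑ a, z a ^ 2 := by
  have h : ‖z‖ ≤ √(∑ a, z a ^ 2) :=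
    (pi_norm_le_iff_of_nonneg (Real.sqrt_nonneg _)).2 fun a => by
      rw [Real.norm_eq_abs]
      exact Real.abs_le_sqrt (Finset.single_le_sum (f := fun a => z a ^ 2)
        (fun i _ => sq_nonneg _) (mem_univ a))
  have := pow_le_pow_left₀ (norm_nonneg _) h 2
  rwa [Real.sq_sqrt (Finset.sum_nonneg fun i _ => sq_nonneg _)] at this

lemma inv_one_add_pow_le {s t : ℝ} (hs : 0 ≤ s) (hst : s ^ 2 ≤ t) (L : ℕ) :
    ((1 + t) ^ L)⁻¹ ≤ 2 ^ L * ((1 + s) ^ (2 * L))⁻¹ := by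
  have h0 : 0 ≤ t := (sq_nonneg s).trans hst
  rw [← div_eq_mul_inv, le_div_iff₀ (by positivity), inv_mul_le_iff₀ (by positivity), pow_mul,
    ← mul_pow]
  exact pow_le_pow_left₀ (by positivity) (by nlinarith [sq_nonneg (s - 1)]) L

lemma exists_ridgeKernel_le {d : ℕ} (L : ℕ) : ∃ C, 0 < C ∧ ∀ z : Fin d → ℝ,
    (-1) ^ L * ridgeKernel (2 * L) z ∈ Set.Ioc 0 (C * ((1 + ‖z‖) ^ (2 * L))⁻¹) := by
  obtain ⟨C, hC, h⟩ := integral_gaussDeriv_even L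
  refine ⟨C * 2 ^ L, by positivity, fun z => ?_⟩
  have h1 := h (∑ a, z a ^ 2).toNNReal
  rw [← integral_gaussDeriv_dotProduct] at h1
  refine ⟨h1.1, h1.2.trans ?_⟩
  rw [Real.coe_toNNReal _ (Finset.sum_nonneg fun i _ => sq_nonneg _), mul_assoc]
  exact mul_le_mul_of_nonneg_left
    (inv_one_add_pow_le (norm_nonneg z) (norm_sq_le_sum_sq z) L) hC.le

lemma integrable_inv_one_add_norm_pow {d m : ℕ} (h : d < m) :
    Integrable fun z : Fin d → ℝ => ((1 + ‖z‖) ^ m)⁻¹ := by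
  have h := integrable_one_add_norm (E := Fin d → ℝ) (μ := volume) (r := m)
    (by rw [Module.finrank_fin_fun]; exact_mod_cast h)
  refine h.congr (Filter.Eventually.of_forall fun x => ?_)
  dsimp only
  rw [Real.rpow_neg (by positivity), Real.rpow_natCast]

lemma integrable_ridgeKernel {d L : ℕ} (h : d + 1 < 2 * L) :
    Integrable fun z : Fin d → ℝ => (1 + ‖z‖) * ridgeKernel (2 * L) z := by
  obtain ⟨C, hC, hK⟩ := exists_ridgeKernel_le (d := d) L
  obtain ⟨m, hm⟩ : ∃ m, 2 * L = m + 1 := ⟨2 * L - 1, by omega⟩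
  refine ((integrable_inv_one_add_norm_pow (m := m) (by omega)).const_mul C).mono'
    ((by fun_prop : Measurable fun z : Fin d → ℝ => (1 + ‖z‖)).mul
      (measurable_ridgeKernel _)).aestronglyMeasurable (Filter.Eventually.of_forall fun z => ?_)
  have h1 := hK z
  have h2 : |ridgeKernel (2 * L) z| = (-1) ^ L * ridgeKernel (2 * L) z := by
    rw [← abs_of_pos h1.1, abs_mul, abs_pow]; simp
  rw [Real.norm_eq_abs, abs_mul, h2, abs_of_nonneg (by positivity)]
  refine (mul_le_mul_of_nonneg_left h1.2 (by positivity)).trans (le_of_eq ?_)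
  rw [hm, pow_succ]
  have : (1 + ‖z‖) ≠ 0 := by positivity
  field_simp

lemma integrable_of_one_add_norm_mul {d : ℕ} {K : (Fin d → ℝ) → ℝ} (hm : Measurable K)
    (hi : Integrable fun z => (1 + ‖z‖) * K z) : Integrable K := by
  refine hi.mono hm.aestronglyMeasurable (Filter.Eventually.of_forall fun z => ?_)
  rw [norm_mul, Real.norm_of_nonneg (by positivity : 0 ≤ 1 + ‖z‖)]
  nlinarith [norm_nonneg z, norm_nonneg (K z)]

lemma abs_integral_mul_kernel_sub_le {d : ℕ} {K : (Fin d → ℝ) → ℝ} (hm : Measurable K)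
    (hi : Integrable fun z => (1 + ‖z‖) * K z) {H : (Fin d → ℝ) → ℝ} (hH : LipschitzWith 2 H)
    (X : Fin d → ℝ) : |(∫ Y, H Y * K (Y - X)) - H X * ∫ z, K z| ≤ 2 * ∫ z, |(1 + ‖z‖) * K z| := by
  have h1 : ∀ z, |(H (z + X) - H X) * K z| ≤ 2 * |(1 + ‖z‖) * K z| := fun z => by
    have h2 := hH.dist_le_mul (z + X) X
    rw [Real.dist_eq, dist_eq_norm, add_sub_cancel_right, NNReal.coe_ofNat] at h2
    rw [abs_mul, abs_mul, abs_of_nonneg (by positivity : 0 ≤ 1 + ‖z‖), ← mul_assoc]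
    exact mul_le_mul_of_nonneg_right (by linarith) (abs_nonneg _)
  have h3 : Integrable fun z => (H (z + X) - H X) * K z := by
    refine (hi.abs.const_mul 2).mono' ?_ (Filter.Eventually.of_forall h1)
    exact (((hH.continuous.comp (continuous_id.add continuous_const)).sub
      continuous_const).measurable.mul hm).aestronglyMeasurable
  have h4 : ∫ Y, H Y * K (Y - X) = (∫ z, (H (z + X) - H X) * K z) + H X * ∫ z, K z := by
    rw [← integral_add_right_eq_self _ X, ← integral_const_mul, ← integral_add h3
      ((integrable_of_one_add_norm_mul hm hi).const_mul _)]
    congr 1; ext z; rw [add_sub_cancel_right]; ring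
  rw [h4, add_sub_cancel_right, ← integral_const_mul]
  exact abs_integral_le_integral_abs.trans
    (integral_mono h3.abs (hi.abs.const_mul 2) h1)

lemma integral_ridgeKernel_ne_zero {d L : ℕ} (h : d + 1 < 2 * L) :
    ∫ z : Fin d → ℝ, ridgeKernel (2 * L) z ≠ 0 := by
  obtain ⟨C, hC, hK⟩ := exists_ridgeKernel_le (d := d) L
  have hi := (integrable_of_one_add_norm_mul (measurable_ridgeKernel _)
    (integrable_ridgeKernel h)).const_mul ((-1) ^ L)
  have h1 : 0 < ∫ z : Fin d → ℝ, (-1) ^ L * ridgeKernel (2 * L) z := by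
    rw [integral_pos_iff_support_of_nonneg (fun z => (hK z).1.le) hi]
    rw [Function.support_eq_univ fun z => (hK z).1.ne']
    exact Measure.measure_univ_pos.2 (NeZero.ne _)
  rw [integral_const_mul] at h1
  exact right_ne_zero_of_mul (ne_of_gt h1)

/-- Ridge transform of `H` with profile `gaussDeriv n`, at direction `p.1` and offset `p.2`. -/
noncomputable def ridgeTransform {d : ℕ} (n : ℕ) (H : (Fin d → ℝ) → ℝ) (p : (Fin d → ℝ) × ℝ) : ℝ :=
  ∫ y, H y * gaussDeriv n (p.1 ⬝ᵥ y - p.2)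

lemma abs_dotProduct_le_sum_mul_norm {d : ℕ} (w z : Fin d → ℝ) :
    |w ⬝ᵥ z| ≤ (∑ a, |w a|) * ‖z‖ := by
  unfold dotProduct
  rw [Finset.sum_mul]
  refine (Finset.abs_sum_le_sum_abs _ _).trans (Finset.sum_le_sum fun a _ => ?_)
  rw [abs_mul]
  exact mul_le_mul_of_nonneg_left (norm_le_pi_norm z a) (abs_nonneg _)

lemma integrable_abs_eval_gaussPi {d : ℕ} (a : Fin d) :
    Integrable (fun w : Fin d → ℝ => |w a|) (gaussPi d) := by
  have h : Integrable (fun x : ℝ => |x|) (ProbabilityTheory.gaussianReal 0 1) :=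
    ((ProbabilityTheory.memLp_id_gaussianReal (μ := 0) (v := 1) 1).integrable le_rfl).abs
  exact integrable_comp_eval (μ := fun _ : Fin d => ProbabilityTheory.gaussianReal 0 1) (i := a) h

lemma integrable_sum_abs_gaussPi (d : ℕ) :
    Integrable (fun w : Fin d → ℝ => ∑ a, |w a|) (gaussPi d) :=
  integrable_finsetSum _ fun a _ => integrable_abs_eval_gaussPi a

lemma integrable_dotProduct_gaussPi {d : ℕ} (z : Fin d → ℝ) :
    Integrable (fun w : Fin d → ℝ => w ⬝ᵥ z) (gaussPi d) := by
  refine ((integrable_sum_abs_gaussPi d).mul_const ‖z‖).mono' ?_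
    (Filter.Eventually.of_forall fun w => abs_dotProduct_le_sum_mul_norm w z)
  unfold dotProduct
  exact (by fun_prop : Continuous fun w : Fin d → ℝ => ∑ a, w a * z a).aestronglyMeasurable

lemma continuous_gaussDeriv_ridge {d : ℕ} (n : ℕ) :
    Continuous fun q : ((Fin d → ℝ) × ℝ) × (Fin d → ℝ) => gaussDeriv n (q.1.1 ⬝ᵥ q.2 - q.1.2) := by
  refine (continuous_gaussDeriv n).comp ?_
  unfold dotProduct
  fun_prop

lemma continuous_relu_ridge {d : ℕ} (X : Fin d → ℝ) :
    Continuous fun p : (Fin d → ℝ) × ℝ => max 0 (p.1 ⬝ᵥ X - p.2) := by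
  unfold dotProduct
  fun_prop

lemma measurable_ridgeTransform {d : ℕ} (n : ℕ) {H : (Fin d → ℝ) → ℝ} (hH : Measurable H) :
    Measurable (ridgeTransform n H) := by
  refine StronglyMeasurable.measurable ?_
  exact StronglyMeasurable.integral_prod_right'
    (f := fun q : ((Fin d → ℝ) × ℝ) × (Fin d → ℝ) => H q.2 * gaussDeriv n (q.1.1 ⬝ᵥ q.2 - q.1.2))
    ((hH.comp measurable_snd).mul (continuous_gaussDeriv_ridge n).measurable).stronglyMeasurable

lemma integrable_gaussDeriv_mul_relu {d : ℕ} (n : ℕ) (X Y : Fin d → ℝ) :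
    Integrable (fun p : (Fin d → ℝ) × ℝ => gaussDeriv n (p.1 ⬝ᵥ Y - p.2) * max 0 (p.1 ⬝ᵥ X - p.2))
      ((gaussPi d).prod volume) := by
  obtain ⟨C, hC, h⟩ := exists_integral_gaussDeriv_mul_relu_le n
  have hm : AEStronglyMeasurable (fun p : (Fin d → ℝ) × ℝ =>
      gaussDeriv n (p.1 ⬝ᵥ Y - p.2) * max 0 (p.1 ⬝ᵥ X - p.2)) ((gaussPi d).prod volume) :=
    (((continuous_gaussDeriv_ridge n).comp (by fun_prop :
      Continuous fun p : (Fin d → ℝ) × ℝ => (p, Y))).mul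
      (continuous_relu_ridge X)).aestronglyMeasurable
  refine (integrable_prod_iff hm).2 ⟨Filter.Eventually.of_forall fun w => ?_, ?_⟩
  · refine integrable_gaussDeriv_sub_mul n (w ⬝ᵥ Y) (w ⬝ᵥ X) (f := fun x => max 0 x)
      (by fun_prop) fun x => ?_
    rw [abs_of_nonneg (le_max_left _ _)]
    exact max_le (abs_nonneg _) (le_abs_self _)
  · refine (((integrable_const 1).add
        (integrable_dotProduct_gaussPi (Y - X)).abs).const_mul C).mono'
      hm.norm.integral_prod_right' (Filter.Eventually.of_forall fun w => ?_)
    rw [Real.norm_of_nonneg (integral_nonneg fun b => norm_nonneg _)]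
    simp only [Pi.add_apply, dotProduct_sub]
    exact h _ _

lemma exists_integral_abs_gaussDeriv_mul_relu_le {d : ℕ} (n : ℕ) (X : Fin d → ℝ) :
    ∃ C, ∀ Y : Fin d → ℝ,
    ∫ p : (Fin d → ℝ) × ℝ, |gaussDeriv n (p.1 ⬝ᵥ Y - p.2) * max 0 (p.1 ⬝ᵥ X - p.2)|
      ∂((gaussPi d).prod volume) ≤ C * (1 + ‖Y‖) := by
  obtain ⟨C, hC, h⟩ := exists_integral_gaussDeriv_mul_relu_le n
  have hm0 : 0 ≤ ∫ w, ∑ a, |w a| ∂gaussPi d := integral_nonneg fun w => by positivity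
  refine ⟨C * (1 + (∫ w, ∑ a, |w a| ∂gaussPi d) * (1 + ‖X‖)), fun Y => ?_⟩
  have hi := integrable_gaussDeriv_mul_relu n X Y
  rw [integral_prod _ hi.abs]
  calc _ ≤ ∫ w, C * (1 + (∑ a, |w a|) * ‖Y - X‖) ∂gaussPi d := by
        refine integral_mono hi.abs.integral_prod_left ?_ fun w => ?_
        · exact ((integrable_const 1).add
            ((integrable_sum_abs_gaussPi d).mul_const _)).const_mul C
        · refine (h (w ⬝ᵥ Y) (w ⬝ᵥ X)).trans (mul_le_mul_of_nonneg_left ?_ hC.le)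
          rw [← dotProduct_sub]
          linarith [abs_dotProduct_le_sum_mul_norm w (Y - X)]
    _ = C * (1 + (∫ w, ∑ a, |w a| ∂gaussPi d) * ‖Y - X‖) := by
        rw [integral_const_mul, integral_add (integrable_const 1)
          ((integrable_sum_abs_gaussPi d).mul_const _), integral_mul_const]
        simp
    _ ≤ _ := by
        rw [mul_assoc]
        refine mul_le_mul_of_nonneg_left ?_ hC.le
        have h1 : ‖Y - X‖ ≤ (1 + ‖X‖) * (1 + ‖Y‖) := by
          nlinarith [norm_sub_le Y X, norm_nonneg X, norm_nonneg Y]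
        nlinarith [mul_le_mul_of_nonneg_left h1 hm0, norm_nonneg Y]

lemma integrable_ridge_prod {d : ℕ} (n : ℕ) {H : (Fin d → ℝ) → ℝ} (hH : Measurable H)
    (hi : Integrable fun y => (1 + ‖y‖) * H y) (X : Fin d → ℝ) :
    Integrable (fun q : ((Fin d → ℝ) × ℝ) × (Fin d → ℝ) =>
      H q.2 * (gaussDeriv n (q.1.1 ⬝ᵥ q.2 - q.1.2) * max 0 (q.1.1 ⬝ᵥ X - q.1.2)))
      (((gaussPi d).prod volume).prod volume) := by
  obtain ⟨C, h⟩ := exists_integral_abs_gaussDeriv_mul_relu_le n X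
  have hm : AEStronglyMeasurable (fun q : ((Fin d → ℝ) × ℝ) × (Fin d → ℝ) =>
      H q.2 * (gaussDeriv n (q.1.1 ⬝ᵥ q.2 - q.1.2) * max 0 (q.1.1 ⬝ᵥ X - q.1.2)))
      (((gaussPi d).prod volume).prod volume) :=
    ((hH.comp measurable_snd).mul ((continuous_gaussDeriv_ridge n).mul
      ((continuous_relu_ridge X).comp continuous_fst)).measurable).aestronglyMeasurable
  refine (integrable_prod_iff' hm).2 ⟨Filter.Eventually.of_forall fun Y =>
    (integrable_gaussDeriv_mul_relu n X Y).const_mul (H Y), ?_⟩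
  refine (hi.abs.const_mul C).mono' hm.norm.prod_swap.integral_prod_right'
    (Filter.Eventually.of_forall fun Y => ?_)
  rw [Real.norm_of_nonneg (integral_nonneg fun b => norm_nonneg _)]
  simp only [norm_mul (H Y), integral_const_mul]
  simp only [Real.norm_eq_abs]
  refine (mul_le_mul_of_nonneg_left (h Y) (abs_nonneg _)).trans (le_of_eq ?_)
  rw [abs_mul, abs_of_nonneg (by positivity : 0 ≤ 1 + ‖Y‖)]; ring

/-- The ridge transform represents a smoothing of `H` as a continuous ReLU network. -/
lemma integral_ridgeTransform_mul_relu {d : ℕ} (n : ℕ) {H : (Fin d → ℝ) → ℝ} (hH : Measurable H)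
    (hi : Integrable fun y => (1 + ‖y‖) * H y) (X : Fin d → ℝ) :
    Integrable (fun p => ridgeTransform (n + 2) H p * max 0 (p.1 ⬝ᵥ X - p.2))
      ((gaussPi d).prod volume) ∧
    ∫ p, ridgeTransform (n + 2) H p * max 0 (p.1 ⬝ᵥ X - p.2) ∂((gaussPi d).prod volume)
      = ∫ Y, H Y * ridgeKernel n (Y - X) := by
  have h := integrable_ridge_prod (n + 2) hH hi X
  have h1 : ∀ p : (Fin d → ℝ) × ℝ, ridgeTransform (n + 2) H p * max 0 (p.1 ⬝ᵥ X - p.2) =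
      ∫ y, H y * (gaussDeriv (n + 2) (p.1 ⬝ᵥ y - p.2) * max 0 (p.1 ⬝ᵥ X - p.2)) := fun p => by
    unfold ridgeTransform
    rw [← integral_mul_const]
    simp_rw [mul_assoc]
  simp_rw [h1]
  refine ⟨h.integral_prod_left, ?_⟩
  rw [integral_integral_swap h]
  congr 1; ext Y
  rw [integral_const_mul, integral_prod _ (integrable_gaussDeriv_mul_relu _ X Y)]
  simp only [integral_gaussDeriv_mul_relu, ridgeKernel, dotProduct_sub]

lemma exists_integrable_gaussDeriv_mul_prod {d : ℕ} (n : ℕ) : ∃ B, ∀ y y' : Fin d → ℝ,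
    Integrable (fun p : (Fin d → ℝ) × ℝ => gaussDeriv n (p.1 ⬝ᵥ y - p.2) *
      gaussDeriv n (p.1 ⬝ᵥ y' - p.2))
      ((gaussPi d).prod volume) ∧
    ∫ p : (Fin d → ℝ) × ℝ, |gaussDeriv n (p.1 ⬝ᵥ y - p.2) * gaussDeriv n (p.1 ⬝ᵥ y' - p.2)|
      ∂((gaussPi d).prod volume) ≤ B := by
  obtain ⟨C, hC, hb⟩ := gaussDeriv_bdd n
  have h0 : ∀ u u', ∫ b, |gaussDeriv n (u - b) * gaussDeriv n (u' - b)| ≤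
      C * ∫ b, |gaussDeriv n b| := fun u u' => by
    rw [← integral_sub_left_eq_self (fun b => |gaussDeriv n b|) _ u', ← integral_const_mul]
    refine integral_mono (integrable_gaussDeriv_mul n n u u').abs
      ((integrable_gaussDeriv_sub n u').abs.const_mul C) fun b => ?_
    dsimp only
    rw [abs_mul]
    exact mul_le_mul_of_nonneg_right (hb _) (abs_nonneg _)
  have key : ∀ y y' : Fin d → ℝ, Integrable (fun p : (Fin d → ℝ) × ℝ =>
      gaussDeriv n (p.1 ⬝ᵥ y - p.2) * gaussDeriv n (p.1 ⬝ᵥ y' - p.2))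
        ((gaussPi d).prod volume) := by
    intro y y'
    have hc : ∀ y : Fin d → ℝ,
        Continuous fun p : (Fin d → ℝ) × ℝ => gaussDeriv n (p.1 ⬝ᵥ y - p.2) :=
      fun y => (continuous_gaussDeriv_ridge n).comp
        (by fun_prop : Continuous fun p : (Fin d → ℝ) × ℝ => (p, y))
    have hm := ((hc y).mul (hc y')).aestronglyMeasurable (μ := (gaussPi d).prod volume)
    refine (integrable_prod_iff hm).2 ⟨Filter.Eventually.of_forall fun w =>
      integrable_gaussDeriv_mul n n (w ⬝ᵥ y) (w ⬝ᵥ y'), ?_⟩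
    refine (integrable_const (C * ∫ b, |gaussDeriv n b|)).mono' hm.norm.integral_prod_right'
      (Filter.Eventually.of_forall fun w => ?_)
    rw [Real.norm_of_nonneg (integral_nonneg fun b => norm_nonneg _)]
    exact h0 (w ⬝ᵥ y) (w ⬝ᵥ y')
  refine ⟨C * ∫ b, |gaussDeriv n b|, fun y y' => ⟨key y y', ?_⟩⟩
  rw [integral_prod _ (key y y').abs]
  refine (integral_mono (key y y').abs.integral_prod_left (integrable_const _)
    fun w => h0 (w ⬝ᵥ y) (w ⬝ᵥ y')).trans ?_
  simp

lemma exists_abs_integral_gaussDeriv_mul_prod_le {d : ℕ} (n : ℕ) : ∃ C, 0 < C ∧ ∀ y y' : Fin d → ℝ,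
    |∫ p : (Fin d → ℝ) × ℝ, gaussDeriv n (p.1 ⬝ᵥ y - p.2) * gaussDeriv n (p.1 ⬝ᵥ y' - p.2)
      ∂((gaussPi d).prod volume)| ≤ C * ((1 + ‖y - y'‖) ^ (2 * n))⁻¹ := by
  obtain ⟨C, hC, h⟩ := integral_gaussDeriv_even n
  obtain ⟨B, hB⟩ := exists_integrable_gaussDeriv_mul_prod (d := d) n
  refine ⟨√(2 * Real.pi) * (C * 2 ^ n), by positivity, fun y y' => ?_⟩
  rw [integral_prod _ (hB y y').1, integral_integral_gaussDeriv_mul, abs_mul,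
    abs_of_nonneg (Real.sqrt_nonneg _), mul_assoc]
  refine mul_le_mul_of_nonneg_left ?_ (Real.sqrt_nonneg _)
  have h1 := h ((∑ a, (y a - y' a) ^ 2).toNNReal + 1)
  rw [abs_of_pos h1.1]
  refine h1.2.trans ?_
  rw [mul_assoc]
  refine mul_le_mul_of_nonneg_left ?_ hC.le
  refine inv_one_add_pow_le (norm_nonneg _) ?_ n
  rw [NNReal.coe_add, Real.coe_toNNReal _ (Finset.sum_nonneg fun i _ => sq_nonneg _)]
  have := norm_sq_le_sum_sq (y - y')
  simp only [Pi.sub_apply] at this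
  rw [NNReal.coe_one]; linarith

/-- An `L²` bound for ridge transforms of bounded integrable functions. -/
lemma exists_integral_ridgeTransform_sq_le {d n : ℕ} (hn : d < 2 * n) : ∃ C, 0 < C ∧
    ∀ {D : (Fin d → ℝ) → ℝ} {A : ℝ}, Measurable D → Integrable D → (∀ y, |D y| ≤ A) →
      Integrable (fun p => ridgeTransform n D p ^ 2) ((gaussPi d).prod volume) ∧
      ∫ p, ridgeTransform n D p ^ 2 ∂((gaussPi d).prod volume) ≤ C * A * ∫ y, |D y| := by
  obtain ⟨C, hC, hK⟩ := exists_abs_integral_gaussDeriv_mul_prod_le (d := d) n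
  obtain ⟨B, hB⟩ := exists_integrable_gaussDeriv_mul_prod (d := d) n
  have hI := integrable_inv_one_add_norm_pow hn
  have hI0 : 0 ≤ ∫ z : Fin d → ℝ, ((1 + ‖z‖) ^ (2 * n))⁻¹ := integral_nonneg fun z => by positivity
  refine ⟨C * ((∫ z : Fin d → ℝ, ((1 + ‖z‖) ^ (2 * n))⁻¹) + 1), by positivity, ?_⟩
  intro D A hD hi hA
  have hA0 : 0 ≤ A := (abs_nonneg _).trans (hA 0)
  let Φ : ((Fin d → ℝ) × ℝ) × ((Fin d → ℝ) × (Fin d → ℝ)) → ℝ := fun q =>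
    (D q.2.1 * D q.2.2) * (gaussDeriv n (q.1.1 ⬝ᵥ q.2.1 - q.1.2) *
      gaussDeriv n (q.1.1 ⬝ᵥ q.2.2 - q.1.2))
  have hm : AEStronglyMeasurable Φ (((gaussPi d).prod volume).prod (volume.prod volume)) := by
    refine Measurable.aestronglyMeasurable (Measurable.mul ?_ (Continuous.measurable ?_))
    · exact (hD.comp (measurable_fst.comp measurable_snd)).mul
        (hD.comp (measurable_snd.comp measurable_snd))
    · exact ((continuous_gaussDeriv_ridge n).comp (by fun_prop : Continuous fun
        q : ((Fin d → ℝ) × ℝ) × ((Fin d → ℝ) × (Fin d → ℝ)) => (q.1, q.2.1))).mul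
        ((continuous_gaussDeriv_ridge n).comp (by fun_prop : Continuous fun
        q : ((Fin d → ℝ) × ℝ) × ((Fin d → ℝ) × (Fin d → ℝ)) => (q.1, q.2.2)))
  have hDD : Integrable (fun y : (Fin d → ℝ) × (Fin d → ℝ) => D y.1 * D y.2)
    (volume.prod volume) := hi.mul_prod hi
  have hΦ : Integrable Φ (((gaussPi d).prod volume).prod (volume.prod volume)) := by
    refine (integrable_prod_iff' hm).2 ⟨Filter.Eventually.of_forall fun y =>
      (hB y.1 y.2).1.const_mul (D y.1 * D y.2), ?_⟩
    refine (hDD.abs.mul_const B).mono' hm.norm.prod_swap.integral_prod_right'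
      (Filter.Eventually.of_forall fun y => ?_)
    rw [Real.norm_of_nonneg (integral_nonneg fun b => norm_nonneg _)]
    simp only [Φ, norm_mul (D y.1 * D y.2), integral_const_mul]
    exact mul_le_mul_of_nonneg_left (hB y.1 y.2).2 (abs_nonneg _)
  have hsq : ∀ p, ridgeTransform n D p ^ 2 = ∫ y, Φ (p, y) ∂(volume.prod volume) := fun p => by
    unfold ridgeTransform
    rw [sq, ← integral_prod_mul]
    congr 1; ext y; simp only [Φ]; ring
  simp_rw [hsq]
  refine ⟨hΦ.integral_prod_left, ?_⟩
  rw [integral_integral_swap (f := fun p y => Φ (p, y)) hΦ]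
  have hmaj : Integrable (fun y : (Fin d → ℝ) × (Fin d → ℝ) =>
      |D y.1| * (A * (C * ((1 + ‖y.1 - y.2‖) ^ (2 * n))⁻¹))) (volume.prod volume) := by
    have hm' : AEStronglyMeasurable (fun y : (Fin d → ℝ) × (Fin d → ℝ) =>
        |D y.1| * (A * (C * ((1 + ‖y.1 - y.2‖) ^ (2 * n))⁻¹))) (volume.prod volume) := by
      refine Measurable.aestronglyMeasurable (Measurable.mul ?_ (by fun_prop))
      exact (hD.comp measurable_fst).norm
    refine (integrable_prod_iff hm').2 ⟨Filter.Eventually.of_forall fun y => ?_, ?_⟩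
    · exact ((((hI.comp_sub_left y).const_mul C).const_mul A).const_mul |D y|)
    · refine (hi.abs.mul_const (A * (C * ∫ z : Fin d → ℝ, ((1 + ‖z‖) ^ (2 * n))⁻¹))).congr
        (Filter.Eventually.of_forall fun y => ?_)
      have h1 : ∀ z : Fin d → ℝ, ‖|D y| * (A * (C * ((1 + ‖y - z‖) ^ (2 * n))⁻¹))‖ =
          |D y| * (A * (C * ((1 + ‖y - z‖) ^ (2 * n))⁻¹)) := fun z =>
        Real.norm_of_nonneg (by positivity)
      simp only [h1]
      rw [integral_const_mul, integral_const_mul, integral_const_mul,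
        integral_sub_left_eq_self (fun z : Fin d → ℝ => ((1 + ‖z‖) ^ (2 * n))⁻¹)]
  calc _ ≤ ∫ y : (Fin d → ℝ) × (Fin d → ℝ),
        |D y.1| * (A * (C * ((1 + ‖y.1 - y.2‖) ^ (2 * n))⁻¹)) ∂(volume.prod volume) := by
        refine integral_mono hΦ.integral_prod_right hmaj fun y => ?_
        dsimp only [Φ]
        rw [integral_const_mul]
        refine (le_abs_self _).trans ?_
        rw [abs_mul, abs_mul, mul_assoc]
        refine mul_le_mul_of_nonneg_left ?_ (abs_nonneg _)
        exact mul_le_mul (hA _) (hK _ _) (abs_nonneg _) hA0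
    _ = ∫ y, |D y| * (A * (C * ∫ z : Fin d → ℝ, ((1 + ‖z‖) ^ (2 * n))⁻¹)) := by
        rw [integral_prod _ hmaj]
        congr 1; ext y
        dsimp only
        rw [integral_const_mul, integral_const_mul, integral_const_mul,
          integral_sub_left_eq_self (fun z : Fin d → ℝ => ((1 + ‖z‖) ^ (2 * n))⁻¹)]
    _ ≤ _ := by
        rw [integral_mul_const]
        have : 0 ≤ ∫ y, |D y| := integral_nonneg fun y => abs_nonneg _
        have h2 : 0 ≤ (∫ y, |D y|) * A * C := by positivity
        nlinarith

lemma lineDeriv_gaussDeriv_ridge {d : ℕ} (n : ℕ) (w : Fin d → ℝ) (b : ℝ) (y : Fin d → ℝ)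
    (a : Fin d) :
    lineDeriv ℝ (fun y => gaussDeriv n (w ⬝ᵥ y - b)) y (Pi.single a 1) =
      -gaussDeriv (n + 1) (w ⬝ᵥ y - b) * w a := by
  have h1 : HasDerivAt (fun t : ℝ => w ⬝ᵥ (y + t • Pi.single a 1) - b) (w a) 0 := by
    simp only [dotProduct_add, dotProduct_smul, dotProduct_single, mul_one, smul_eq_mul]
    exact HasDerivAt.congr_deriv ((((hasDerivAt_id (0 : ℝ)).mul_const (w a)).const_add
      (w ⬝ᵥ y)).sub_const b) (by simp)
  have h2 := HasDerivAt.comp (0 : ℝ)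
      (hasDerivAt_gaussDeriv n (w ⬝ᵥ (y + (0 : ℝ) • Pi.single a 1) - b)) h1
  rw [zero_smul, add_zero] at h2
  exact h2.deriv

lemma exists_lipschitzWith_gaussDeriv_ridge {d : ℕ} (n : ℕ) (w : Fin d → ℝ) (b : ℝ) :
    ∃ C, LipschitzWith C fun y : Fin d → ℝ => gaussDeriv n (w ⬝ᵥ y - b) := by
  obtain ⟨C, hC, h⟩ := gaussDeriv_bdd (n + 1)
  have h1 : LipschitzWith C.toNNReal (gaussDeriv n) := by
    refine lipschitzWith_of_nnnorm_deriv_le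
      (fun x => (hasDerivAt_gaussDeriv n x).differentiableAt) fun x => ?_
    rw [(hasDerivAt_gaussDeriv n x).deriv, ← NNReal.coe_le_coe, coe_nnnorm, norm_neg,
      Real.coe_toNNReal _ hC.le]
    exact h x
  have h2 : LipschitzWith (∑ a, |w a|).toNNReal fun y : Fin d → ℝ => w ⬝ᵥ y - b := by
    refine LipschitzWith.of_dist_le_mul fun y y' => ?_
    rw [Real.dist_eq, dist_eq_norm, Real.coe_toNNReal _ (Finset.sum_nonneg fun a _ => abs_nonneg _),
      sub_sub_sub_cancel_right, ← dotProduct_sub]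
    exact abs_dotProduct_le_sum_mul_norm _ _
  exact ⟨_, h1.comp h2⟩

/-- Integration by parts: multiplying a ridge transform by a coordinate of the direction amounts to
differentiating `H`. -/
lemma apply_mul_ridgeTransform {d : ℕ} (n : ℕ) {H : (Fin d → ℝ) → ℝ} {C : NNReal}
    (hH : LipschitzWith C H) (hc : HasCompactSupport H) (a : Fin d) (p : (Fin d → ℝ) × ℝ) :
    p.1 a * ridgeTransform (n + 1) H p =
      ridgeTransform n (fun y => lineDeriv ℝ H y (Pi.single a 1)) p := by
  obtain ⟨C', h⟩ := exists_lipschitzWith_gaussDeriv_ridge n p.1 p.2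
  have h1 := LipschitzWith.integral_lineDeriv_mul_eq (μ := volume) h hH hc (Pi.single a 1)
  simp only [lineDeriv_gaussDeriv_ridge, lineDeriv_neg, neg_mul, integral_neg, neg_inj] at h1
  unfold ridgeTransform
  rw [← h1, ← integral_const_mul]
  congr 1; ext y; ring

lemma lineDeriv_bound {d : ℕ} {H : (Fin d → ℝ) → ℝ} (hH : LipschitzWith 2 H) {s : Set (Fin d → ℝ)}
    (hs : IsClosed s) (h0 : ∀ y ∉ s, H y = 0) (a : Fin d) (y : Fin d → ℝ) :
    |lineDeriv ℝ H y (Pi.single a 1)| ≤ s.indicator (fun _ => 2) y := by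
  have h1 : ‖(Pi.single a 1 : Fin d → ℝ)‖ ≤ 1 :=
    (pi_norm_le_iff_of_nonneg zero_le_one).2 fun i => by
      rcases eq_or_ne i a with rfl | hi
      · simp
      · simp [hi]
  by_cases hy : y ∈ s
  · rw [Set.indicator_of_mem hy]
    have h2 := norm_lineDeriv_le_of_lipschitz ℝ (v := Pi.single a (1 : ℝ)) (x₀ := y) hH
    rw [NNReal.coe_ofNat] at h2
    exact h2.trans (by linarith)
  · rw [Set.indicator_of_notMem hy]
    have h2 := norm_lineDeriv_le_of_lip' ℝ (f := H) (x₀ := y) (v := Pi.single a (1 : ℝ)) le_rfl (by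
      filter_upwards [hs.isOpen_compl.mem_nhds hy] with x hx
      rw [h0 x hx, h0 y hy]; simp)
    rwa [zero_mul] at h2

/-- A `1`-Lipschitz function on the cube is approximated by a continuous superposition of ReLU
ridge functions whose density is controlled in `L²`. -/
lemma exists_relu_representation {d : ℕ} (hd : 2 ≤ d) : ∃ C : ℝ, 0 < C ∧
    ∀ {h : (Fin d → ℝ) → ℝ}, (∀ x ∈ Set.Icc (0 : Fin d → ℝ) 1, h x ∈ Set.Icc (0 : ℝ) 1) →
      (∀ x ∈ Set.Icc (0 : Fin d → ℝ) 1, ∀ y ∈ Set.Icc (0 : Fin d → ℝ) 1,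
        |h x - h y| ≤ ‖x - y‖) → ∀ {k : ℝ}, 0 < k →
      ∃ α : (Fin d → ℝ) × ℝ → ℝ, Measurable α ∧
        (∀ X, Integrable (fun p => α p * max 0 (p.1 ⬝ᵥ X - p.2)) ((gaussPi d).prod volume)) ∧
        (∀ x ∈ Set.Icc (0 : Fin d → ℝ) 1,
          |(∫ p, α p * max 0 (p.1 ⬝ᵥ (k • x) - p.2) ∂((gaussPi d).prod volume)) - k * h x| ≤ C) ∧
        ∀ a, Integrable (fun p => (p.1 a * α p) ^ 2) ((gaussPi d).prod volume) ∧
          ∫ p, (p.1 a * α p) ^ 2 ∂((gaussPi d).prod volume) ≤ C * k ^ d := by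
  have hL : d + 1 < 2 * d := by omega
  have hK0 := integral_ridgeKernel_ne_zero hL
  have hK := integrable_ridgeKernel hL
  set K₀ := ∫ z : Fin d → ℝ, ridgeKernel (2 * d) z with hK₀
  obtain ⟨C, hC, hL2⟩ := exists_integral_ridgeTransform_sq_le (d := d) (n := 2 * d + 1) (by omega)
  set C₁ := |K₀⁻¹| * (2 * ∫ z : Fin d → ℝ, |(1 + ‖z‖) * ridgeKernel (2 * d) z|) with hC₁
  have hC₁0 : 0 ≤ C₁ := by
    have : 0 ≤ ∫ z : Fin d → ℝ, |(1 + ‖z‖) * ridgeKernel (2 * d) z| :=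
      integral_nonneg fun z => abs_nonneg _
    positivity
  refine ⟨C₁ + K₀⁻¹ ^ 2 * (C * 2 * (2 * 3 ^ d)), by positivity, ?_⟩
  intro h hmem hlip k hk
  obtain ⟨H, hH, hH0, hHh⟩ := exists_lipschitz_extension hmem hlip hk
  set Q := Set.Icc (fun _ => -k : Fin d → ℝ) (fun _ => 2 * k) with hQ
  have hc : HasCompactSupport H := HasCompactSupport.intro (isCompact_Icc) hH0
  have hHi : Integrable fun y => (1 + ‖y‖) * H y :=
    ((by fun_prop : Continuous fun y : Fin d → ℝ => 1 + ‖y‖).mul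
      hH.continuous).integrable_of_hasCompactSupport (hc.mul_left)
  have hrep := integral_ridgeTransform_mul_relu (2 * d) hH.continuous.measurable hHi
  refine ⟨fun p => K₀⁻¹ * ridgeTransform (2 * d + 2) H p,
    (measurable_ridgeTransform _ hH.continuous.measurable).const_mul _, fun X => ?_, fun x hx => ?_,
    fun a => ?_⟩
  · simp_rw [mul_assoc]
    exact (hrep X).1.const_mul _
  · simp_rw [mul_assoc]
    rw [integral_const_mul, (hrep _).2, ← hHh x hx]
    have h1 := abs_integral_mul_kernel_sub_le (measurable_ridgeKernel _) hK hH (k • x)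
    rw [← hK₀] at h1
    have h2 : K₀⁻¹ * (∫ Y, H Y * ridgeKernel (2 * d) (Y - k • x)) - H (k • x) =
        K₀⁻¹ * ((∫ Y, H Y * ridgeKernel (2 * d) (Y - k • x)) - H (k • x) * K₀) := by
      field_simp
    rw [h2, abs_mul]
    have h3 := mul_le_mul_of_nonneg_left h1 (abs_nonneg K₀⁻¹)
    have h4 : 0 ≤ K₀⁻¹ ^ 2 * (C * 2 * (2 * 3 ^ d)) := by positivity
    linarith
  · set D : (Fin d → ℝ) → ℝ := fun y => lineDeriv ℝ H y (Pi.single a 1) with hD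
    have hDb := lineDeriv_bound hH (s := Q) isClosed_Icc hH0 a
    have hDm : Measurable D := measurable_lineDeriv hH.continuous
    have hQm : MeasurableSet Q := measurableSet_Icc
    have hQv : volume.real Q = (3 * k) ^ d := by
      rw [hQ, Measure.real, Real.volume_Icc_pi, ENNReal.toReal_prod]
      simp only [ENNReal.toReal_ofReal (by linarith : 0 ≤ 2 * k - -k)]
      rw [Finset.prod_const, card_univ, Fintype.card_fin]; ring
    have hQi : Integrable (Q.indicator fun _ => (2 : ℝ)) :=
      (integrable_indicator_iff hQm).2 (integrableOn_const isCompact_Icc.measure_lt_top.ne)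
    have hDi : Integrable D := hQi.mono' hDm.aestronglyMeasurable (Filter.Eventually.of_forall hDb)
    have hD1 : ∫ y, |D y| ≤ 2 * (3 * k) ^ d := by
      refine (integral_mono hDi.abs hQi hDb).trans (le_of_eq ?_)
      rw [integral_indicator hQm, setIntegral_const, hQv, smul_eq_mul]; ring
    have hD2 : ∀ y, |D y| ≤ 2 := fun y => (hDb y).trans (Set.indicator_le_self' (by simp) y)
    obtain ⟨h1, h2⟩ := hL2 hDm hDi hD2
    have h3 : ∀ p : (Fin d → ℝ) × ℝ, (p.1 a * (K₀⁻¹ * ridgeTransform (2 * d + 2) H p)) ^ 2 =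
        K₀⁻¹ ^ 2 * ridgeTransform (2 * d + 1) D p ^ 2 := fun p => by
      rw [hD, ← apply_mul_ridgeTransform (2 * d + 1) hH hc a p]; ring
    simp_rw [h3]
    refine ⟨h1.const_mul _, ?_⟩
    rw [integral_const_mul]
    have h4 := mul_le_mul_of_nonneg_left (h2.trans
      (mul_le_mul_of_nonneg_left hD1 (by positivity))) (sq_nonneg K₀⁻¹)
    refine h4.trans ?_
    rw [mul_pow, add_mul]
    have h5 : 0 ≤ C₁ * k ^ d := by positivity
    linarith

lemma integral_sum_abs_gaussPi_pos {d : ℕ} (hd : 0 < d) : 0 < ∫ w, ∑ a, |w a| ∂gaussPi d := by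
  rw [integral_finsetSum _ fun a _ => integrable_abs_eval_gaussPi a]
  refine Finset.sum_pos (fun a _ => ?_) ⟨⟨0, hd⟩, mem_univ _⟩
  rw [integral_comp_eval (μ := fun _ : Fin d => ProbabilityTheory.gaussianReal 0 1)
    (f := fun x : ℝ => |x|) (by fun_prop)]
  have hi : Integrable (fun x : ℝ => |x|) (ProbabilityTheory.gaussianReal 0 1) :=
    ((ProbabilityTheory.memLp_id_gaussianReal (μ := 0) (v := 1) 1).integrable le_rfl).abs
  have h0 : NullSingletonClass (ProbabilityTheory.gaussianReal 0 1) :=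
    ProbabilityTheory.nullSingletonClass_gaussianReal one_ne_zero
  rw [integral_pos_iff_support_of_nonneg (fun x => abs_nonneg x) hi]
  have : Function.support (fun x : ℝ => |x|) = {0}ᶜ := by ext x; simp
  rw [this, measure_compl (measurableSet_singleton 0) (by simp), measure_singleton, measure_univ]
  simp

/-- Mass of the set of ridges whose offset is within `r * ‖w‖₁` of `f w`. -/
lemma gaussPi_prod_offset {d : ℕ} {f : (Fin d → ℝ) → ℝ} (hf : Measurable f) {r : ℝ} (hr : 0 ≤ r) :
    MeasurableSet {p : (Fin d → ℝ) × ℝ | |p.2 - f p.1| ≤ r * ∑ a, |p.1 a|} ∧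
    ((gaussPi d).prod volume) {p : (Fin d → ℝ) × ℝ | |p.2 - f p.1| ≤ r * ∑ a, |p.1 a|} =
      ENNReal.ofReal (2 * r * ∫ w, ∑ a, |w a| ∂gaussPi d) := by
  have hm : MeasurableSet {p : (Fin d → ℝ) × ℝ | |p.2 - f p.1| ≤ r * ∑ a, |p.1 a|} :=
    measurableSet_le (measurable_snd.sub (hf.comp measurable_fst)).norm (by fun_prop)
  refine ⟨hm, ?_⟩
  rw [Measure.prod_apply hm, ← integral_const_mul, ofReal_integral_eq_lintegral_ofReal
    ((integrable_sum_abs_gaussPi d).const_mul _) (Filter.Eventually.of_forall fun w => by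
      dsimp only; positivity)]
  congr 1; ext w
  have : Prod.mk w ⁻¹' {p : (Fin d → ℝ) × ℝ | |p.2 - f p.1| ≤ r * ∑ a, |p.1 a|} =
      Metric.closedBall (f w) (r * ∑ a, |w a|) := by
    ext b; simp [Real.dist_eq]
  rw [this, Real.volume_closedBall]
  congr 1; ring

lemma exists_affine_of_large_offset {d : ℕ} {k : ℝ} (hk : 0 < k) {α : (Fin d → ℝ) × ℝ → ℝ}
    (hα : ∀ X, Integrable (fun p => α p * max 0 (p.1 ⬝ᵥ X - p.2)) ((gaussPi d).prod volume))
    {S : Set ((Fin d → ℝ) × ℝ)} (hS : S = {p | |p.2| ≤ k * ∑ a, |p.1 a|}) (hm : MeasurableSet S) :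
    ∃ (v : Fin d → ℝ) (v₀ : ℝ), ∀ X ∈ Set.Icc (0 : Fin d → ℝ) 1,
      ∫ p in Sᶜ, α p * max 0 (p.1 ⬝ᵥ (k • X) - p.2) ∂((gaussPi d).prod volume) = v ⬝ᵥ X + v₀ := by
  set A : (Fin d → ℝ) → ℝ := fun X =>
    ∫ p in Sᶜ, α p * max 0 (p.1 ⬝ᵥ (k • X) - p.2) ∂((gaussPi d).prod volume) with hA
  refine ⟨fun a => A (Pi.single a 1) - A 0, A 0, fun X hX => ?_⟩
  have key : ∀ w : Fin d → ℝ, ∀ b : ℝ, k * ∑ a, |w a| < |b| → ∀ X ∈ Set.Icc (0 : Fin d → ℝ) 1,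
      max 0 (w ⬝ᵥ (k • X) - b) = if 0 < b then 0 else k * (w ⬝ᵥ X) - b := by
    intro w b hb X hX
    have hX1 : ‖X‖ ≤ 1 := (pi_norm_le_iff_of_nonneg zero_le_one).2 fun a => by
      rw [Real.norm_of_nonneg (hX.1 a)]; exact hX.2 a
    have h1 : |w ⬝ᵥ X| ≤ ∑ a, |w a| := (abs_dotProduct_le_sum_mul_norm w X).trans
      (mul_le_of_le_one_right (Finset.sum_nonneg fun a _ => abs_nonneg _) hX1)
    have h2 := mul_le_mul_of_nonneg_left (abs_le.1 h1).1 hk.le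
    have h3 := mul_le_mul_of_nonneg_left (abs_le.1 h1).2 hk.le
    rw [dotProduct_smul, smul_eq_mul]
    split_ifs with h
    · rw [abs_of_pos h] at hb
      exact max_eq_left (by linarith)
    · rw [abs_of_nonpos (not_lt.1 h)] at hb
      exact max_eq_right (by linarith)
  have he : ∀ a : Fin d, (Pi.single a 1 : Fin d → ℝ) ∈ Set.Icc (0 : Fin d → ℝ) 1 := fun a => by
    refine ⟨fun i => ?_, fun i => ?_⟩ <;> rcases eq_or_ne i a with rfl | hi <;> simp [*]
  have hz : (0 : Fin d → ℝ) ∈ Set.Icc (0 : Fin d → ℝ) 1 := ⟨le_rfl, zero_le_one⟩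
  have hi : ∀ X, IntegrableOn (fun p => α p * max 0 (p.1 ⬝ᵥ (k • X) - p.2)) Sᶜ
    ((gaussPi d).prod volume) := fun X => (hα (k • X)).integrableOn
  have h1 : A X = ∫ p in Sᶜ, (∑ a, X a * (α p * max 0 (p.1 ⬝ᵥ (k • Pi.single a 1) - p.2) -
      α p * max 0 (p.1 ⬝ᵥ (k • (0 : Fin d → ℝ)) - p.2)) +
        α p * max 0 (p.1 ⬝ᵥ (k • (0 : Fin d → ℝ)) - p.2))
      ∂((gaussPi d).prod volume) := by
    refine setIntegral_congr_fun hm.compl fun p hp => ?_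
    have hb : k * ∑ a, |p.1 a| < |p.2| := by
      rw [hS] at hp; exact lt_of_not_ge hp
    simp only [key p.1 p.2 hb _ hX, key p.1 p.2 hb _ (he _), key p.1 p.2 hb _ hz]
    split_ifs
    · simp
    · simp only [dotProduct_single, dotProduct_zero]
      have : p.1 ⬝ᵥ X = ∑ a, X a * p.1 a := by
        unfold dotProduct; exact Finset.sum_congr rfl fun a _ => mul_comm _ _
      rw [this, mul_sub, mul_left_comm, Finset.mul_sum, Finset.mul_sum]
      have h2 : ∀ a, X a * (α p * (k * (p.1 a * 1) - p.2) - α p * (k * 0 - p.2)) =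
        k * (α p * (X a * p.1 a)) := fun a => by ring
      simp_rw [h2, ← Finset.mul_sum]; ring
  rw [show (∫ p in Sᶜ, α p * max 0 (p.1 ⬝ᵥ (k • X) - p.2) ∂((gaussPi d).prod volume)) =
      A X from rfl,
    h1, integral_add, integral_finsetSum]
  · congr 1
    refine Finset.sum_congr rfl fun a _ => ?_
    rw [integral_const_mul, integral_sub (hi _) (hi _), mul_comm]
  · exact fun a _ => ((hi _).sub (hi _)).const_mul _
  · exact integrable_finsetSum _ fun a _ => ((hi _).sub (hi _)).const_mul _
  · exact hi 0

/-- Approximation of `1`-Lipschitz functions on the cube by few ReLU ridges and an affine part. -/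
lemma exists_sparse_relu {d : ℕ} (hd : 2 ≤ d) : ∃ (M : ℕ) (C : ℝ), 0 < C ∧
    ∀ {h : (Fin d → ℝ) → ℝ}, (∀ x ∈ Set.Icc (0 : Fin d → ℝ) 1, h x ∈ Set.Icc (0 : ℝ) 1) →
      (∀ x ∈ Set.Icc (0 : Fin d → ℝ) 1, ∀ y ∈ Set.Icc (0 : Fin d → ℝ) 1,
        |h x - h y| ≤ ‖x - y‖) → ∀ κ : ℕ,
      ∃ (I : Type) (_ : Fintype I) (c b : I → ℝ) (u : I → Fin d → ℝ) (v : Fin d → ℝ) (v₀ : ℝ),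
        #{i | c i ≠ 0} ≤ M * 2 ^ (6 * κ * d) ∧ ∀ X ∈ Set.Icc (0 : Fin d → ℝ) 1,
          |h X - ∑ i, c i * max 0 (u i ⬝ᵥ X - b i) - (v ⬝ᵥ X + v₀)| ≤ C * (1 / 2) ^ (6 * κ) := by
  obtain ⟨M, C₂, hC₂, hsparse⟩ := exists_sparse_integral hd
  obtain ⟨C₁, hC₁, hrep⟩ := exists_relu_representation hd
  have hm₁ := integral_sum_abs_gaussPi_pos (d := d) (by omega)
  set m₁ := ∫ w, ∑ a, |w a| ∂gaussPi d with hm₁def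
  set B₀ : ℝ := 2 * m₁ * d * (d * C₁) with hB₀
  have hB₀0 : 0 ≤ B₀ := by positivity
  refine ⟨M, C₁ + C₂ * √(B₀ + 1), by positivity, ?_⟩
  intro h hmem hlip κ
  obtain ⟨k, hkdef⟩ : ∃ k : ℝ, k = 2 ^ (6 * κ) := ⟨_, rfl⟩
  have hk : 0 < k := by rw [hkdef]; positivity
  have hk1 : 1 ≤ k := by rw [hkdef]; exact one_le_pow₀ one_le_two
  obtain ⟨α, hα, hαi, hαh, hα2⟩ := hrep hmem hlip hk
  set μ := (gaussPi d).prod (volume : Measure ℝ) with hμ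
  set n₁ : (Fin d → ℝ) × ℝ → ℝ := fun p => ∑ a, |p.1 a| with hn₁
  have hn₁0 : ∀ p, 0 ≤ n₁ p := fun p => Finset.sum_nonneg fun a _ => abs_nonneg _
  have hn₁m : Measurable n₁ := by fun_prop
  set S : Set ((Fin d → ℝ) × ℝ) := {p | |p.2| ≤ k * ∑ a, |p.1 a|} with hS
  obtain ⟨hSm, hSμ⟩ := gaussPi_prod_offset (d := d) (f := fun _ => 0) measurable_const hk.le
  simp only [sub_zero] at hSm hSμ
  rw [← hS, ← hμ, ← hm₁def] at hSμ
  rw [← hS] at hSm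
  set V : ℝ := 2 * k * m₁ with hV
  have hV0 : 0 < V := by positivity
  have hSμ0 : μ S ≠ 0 := by rw [hSμ]; exact (ENNReal.ofReal_pos.2 hV0).ne'
  have hSμt : μ S ≠ ⊤ := by rw [hSμ]; exact ENNReal.ofReal_ne_top
  obtain ⟨P, hP⟩ : ∃ P, P = (μ S)⁻¹ • μ.restrict S := ⟨_, rfl⟩
  have hPprob : IsProbabilityMeasure P := by
    rw [hP]
    refine ⟨?_⟩
    rw [Measure.smul_apply, Measure.restrict_apply_univ, smul_eq_mul,
        ENNReal.inv_mul_cancel hSμ0 hSμt]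
  have hPint : ∀ F : (Fin d → ℝ) × ℝ → ℝ, ∫ p, F p ∂P = V⁻¹ * ∫ p in S, F p ∂μ := fun F => by
    rw [hP, integral_smul_measure, hSμ, ENNReal.toReal_inv, ENNReal.toReal_ofReal hV0.le,
        smul_eq_mul]
  have hPi : ∀ {F : (Fin d → ℝ) × ℝ → ℝ}, IntegrableOn F S μ → Integrable F P := fun hF => by
    rw [hP]; exact hF.smul_measure (ENNReal.inv_ne_top.2 hSμ0)
  set w' : (Fin d → ℝ) × ℝ → Fin d → ℝ := fun p => (n₁ p)⁻¹ • p.1 with hw'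
  set β : (Fin d → ℝ) × ℝ → ℝ := fun p => max (-1) (min 1 (p.2 / (k * n₁ p))) with hβ
  set α' : (Fin d → ℝ) × ℝ → ℝ := fun p => V * (n₁ p * α p) with hα'
  have hw'n : ∀ p, n₁ p • w' p = p.1 := fun p => by
    rcases eq_or_ne (n₁ p) 0 with h0 | h0
    · rw [h0, zero_smul]
      have := (Finset.sum_eq_zero_iff_of_nonneg fun a _ => abs_nonneg (p.1 a)).1 h0
      ext a; rw [abs_eq_zero.1 (this a (mem_univ a))]; rfl
    · rw [hw']; simp only; rw [smul_smul, mul_inv_cancel₀ h0, one_smul]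
  have hβn : ∀ p ∈ S, k * (n₁ p * β p) = p.2 := fun p hp => by
    have hp' : |p.2| ≤ k * n₁ p := hp
    rcases (hn₁0 p).eq_or_lt with h0 | h0
    · rw [← h0, mul_zero] at hp'
      rw [← h0, zero_mul, mul_zero, abs_nonpos_iff.1 hp']
    · have h1 : |p.2 / (k * n₁ p)| ≤ 1 := by
        rw [abs_div, abs_of_pos (by positivity : 0 < k * n₁ p)]
        exact div_le_one_of_le₀ hp' (by positivity)
      rw [hβ]; simp only
      rw [min_eq_right (abs_le.1 h1).2, max_eq_right (abs_le.1 h1).1]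
      field_simp
  have hsq : ∀ p, α' p ^ 2 ≤ V ^ 2 * (d * ∑ a, (p.1 a * α p) ^ 2) := fun p => by
    rw [hα']; simp only; rw [mul_pow]
    refine mul_le_mul_of_nonneg_left ?_ (sq_nonneg _)
    have h1 := sq_sum_le_card_mul_sum_sq (s := univ) (f := fun a => |p.1 a|)
    rw [card_univ, Fintype.card_fin] at h1
    simp_rw [sq_abs] at h1
    simp_rw [mul_pow, ← Finset.sum_mul, ← mul_assoc]
    exact mul_le_mul_of_nonneg_right h1 (sq_nonneg _)
  have hsumi : Integrable (fun p => V ^ 2 * (d * ∑ a, (p.1 a * α p) ^ 2)) μ :=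
    ((integrable_finsetSum _ fun a _ => (hα2 a).1).const_mul _).const_mul _
  have hα'm : Measurable α' := (hn₁m.mul hα).const_mul _
  have hα'i : Integrable (fun p => α' p ^ 2) μ :=
    hsumi.mono' (hα'm.pow_const 2).aestronglyMeasurable (Filter.Eventually.of_forall fun p => by
      rw [Real.norm_of_nonneg (sq_nonneg _)]; exact hsq p)
  have hα'B : ∫ p, α' p ^ 2 ∂P ≤ B₀ * k ^ (d + 1) := by
    rw [hPint]
    have h1 : ∫ p in S, α' p ^ 2 ∂μ ≤ V ^ 2 * (d * (d * (C₁ * k ^ d))) := by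
      refine (setIntegral_le_integral hα'i
          (Filter.Eventually.of_forall fun p => sq_nonneg _)).trans ?_
      refine (integral_mono hα'i hsumi hsq).trans ?_
      rw [integral_const_mul, integral_const_mul, integral_finsetSum _ fun a _ => (hα2 a).1]
      refine mul_le_mul_of_nonneg_left (mul_le_mul_of_nonneg_left ?_ (by positivity))
          (by positivity)
      refine (Finset.sum_le_card_nsmul _ _ _ fun a _ => (hα2 a).2).trans ?_
      rw [card_univ, Fintype.card_fin, nsmul_eq_mul]
    refine (mul_le_mul_of_nonneg_left h1 (by positivity)).trans (le_of_eq ?_)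
    rw [sq, ← mul_assoc, ← mul_assoc V⁻¹, inv_mul_cancel₀ hV0.ne', hB₀, hV]
    ring
  obtain ⟨v, v₀, hv⟩ := exists_affine_of_large_offset hk hαi hS hSm
  obtain ⟨I, hI, c, b, u, v', v₀', hcard, happ⟩ := hsparse κ P (w := w') (β := β) (α := α')
    (hn₁m.inv.smul measurable_fst)
    (measurable_const.max (measurable_const.min (measurable_snd.div (hn₁m.const_mul k)))) hα'm
    (fun p => by
      simp only [hw', Pi.smul_apply, smul_eq_mul, abs_mul, ← Finset.mul_sum]
      rw [abs_of_nonneg (inv_nonneg.2 (hn₁0 p))]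
      exact inv_mul_le_one)
    (fun p => abs_le.2 ⟨le_max_left _ _, max_le (by norm_num) (min_le_left _ _)⟩)
    (hPi hα'i.integrableOn) hα'B (by positivity) (fun j _ q _ => by
      obtain ⟨hTm, hTμ⟩ := gaussPi_prod_offset (d := d) (f := fun w => w ⬝ᵥ (k • cellCorner j q))
        (by unfold dotProduct; fun_prop) (r := k * (1 / 2) ^ j) (by positivity)
      rw [← hμ, ← hm₁def] at hTμ
      set T := {p : (Fin d → ℝ) × ℝ | |p.2 - p.1 ⬝ᵥ (k • cellCorner j q)| ≤
        k * (1 / 2) ^ j * ∑ a, |p.1 a|} with hT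
      have hTt : μ T ≠ ⊤ := by rw [hTμ]; exact ENNReal.ofReal_ne_top
      have hTi : Integrable (T.indicator fun _ => (1 : ℝ)) μ :=
        (integrable_indicator_iff hTm).2 (integrableOn_const hTt)
      have h1 : ∫ p in S, crossing (w' p) (β p) j (cellCorner j q) ∂μ ≤
          2 * (k * (1 / 2) ^ j) * m₁ := by
        refine (integral_mono_of_nonneg (g := T.indicator fun _ => (1 : ℝ))
          (Filter.Eventually.of_forall fun p => (crossing_mem _ _ _ _).1) hTi.integrableOn
          (ae_restrict_of_forall_mem hSm fun p hp => ?_)).trans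
          ((setIntegral_le_integral hTi (Filter.Eventually.of_forall fun p =>
            Set.indicator_nonneg (fun _ _ => zero_le_one) p)).trans (le_of_eq ?_))
        · by_cases hpT : p ∈ T
          · rw [Set.indicator_of_mem hpT]; exact (crossing_mem _ _ _ _).2
          · rw [Set.indicator_of_notMem hpT]
            refine le_of_eq (if_neg fun hcr => hpT ?_)
            have h2 : p.2 - p.1 ⬝ᵥ (k • cellCorner j q) =
                -((k * n₁ p) * (w' p ⬝ᵥ cellCorner j q - β p)) := by
              rw [← hβn p hp]
              conv_lhs => rw [← hw'n p]
              rw [smul_dotProduct, dotProduct_smul, smul_eq_mul, smul_eq_mul]; ring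
            have h3 := mul_le_mul_of_nonneg_left hcr (mul_nonneg hk.le (hn₁0 p))
            rw [hT, Set.mem_ofPred_eq]
            rw [h2, abs_neg, abs_mul, abs_of_nonneg (mul_nonneg hk.le (hn₁0 p))]
            exact h3.trans (le_of_eq (by ring))
        · rw [integral_indicator hTm, setIntegral_const, Measure.real, hTμ,
            ENNReal.toReal_ofReal (by positivity), smul_eq_mul, mul_one]
      rw [hPint]
      refine (mul_le_mul_of_nonneg_left h1 (by positivity)).trans (le_of_eq ?_)
      rw [hV]
      field_simp)
  refine ⟨I, hI, c, b, u, v' + k⁻¹ • v, v₀' + k⁻¹ * v₀, hcard, fun X hX => ?_⟩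
  have h1 : ∫ p, α' p * max 0 (w' p ⬝ᵥ X - β p) ∂P =
      k⁻¹ * ∫ p in S, α p * max 0 (p.1 ⬝ᵥ (k • X) - p.2) ∂μ := by
    rw [hPint, ← integral_const_mul, ← integral_const_mul]
    refine setIntegral_congr_fun hSm fun p hp => ?_
    have h2 : p.1 ⬝ᵥ (k • X) - p.2 = (k * n₁ p) * (w' p ⬝ᵥ X - β p) := by
      rw [← hβn p hp]
      conv_lhs => rw [← hw'n p]
      rw [smul_dotProduct, dotProduct_smul, smul_eq_mul, smul_eq_mul]; ring
    have h3 : max 0 (p.1 ⬝ᵥ (k • X) - p.2) = k * n₁ p * max 0 (w' p ⬝ᵥ X - β p) := by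
      rw [h2, mul_max_of_nonneg _ _ (mul_nonneg hk.le (hn₁0 p)), mul_zero]
    simp only [h3, hα']
    field_simp
  have h2 := happ X hX
  rw [h1] at h2
  have h3 := hαh X hX
  rw [← integral_add_compl hSm (hαi _), hv X hX] at h3
  have h4 : (1 / 2 : ℝ) ^ (6 * κ) = k⁻¹ := by rw [hkdef, one_div, inv_pow]
  have h5 : C₂ * √(B₀ * k ^ (d + 1) + 1) * (1 / 2) ^ (9 * κ + 3 * κ * d) ≤
      C₂ * √(B₀ + 1) * k⁻¹ := by
    have h5 : √(B₀ * k ^ (d + 1) + 1) ≤ √(B₀ + 1) * 2 ^ (3 * κ * (d + 1)) := by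
      rw [Real.sqrt_le_left (by positivity), mul_pow, Real.sq_sqrt (by positivity), ← pow_mul,
        show 3 * κ * (d + 1) * 2 = 6 * κ * (d + 1) by ring, pow_mul 2 (6 * κ), ← hkdef]
      nlinarith [one_le_pow₀ hk1 (n := d + 1)]
    have h6 : (2 : ℝ) ^ (3 * κ * (d + 1)) * (1 / 2) ^ (9 * κ + 3 * κ * d) = k⁻¹ := by
      rw [show 9 * κ + 3 * κ * d = 3 * κ * (d + 1) + 6 * κ by ring, pow_add, ← mul_assoc,
          ← mul_pow, h4]
      norm_num
    rw [← h6, ← mul_assoc]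
    refine mul_le_mul_of_nonneg_right ?_ (by positivity)
    exact (mul_le_mul_of_nonneg_left h5 hC₂.le).trans (le_of_eq (mul_assoc _ _ _).symm)
  rw [h4]
  set T := ∫ p in S, α p * max 0 (p.1 ⬝ᵥ (k • X) - p.2) ∂μ
  have h6 : |k⁻¹ * (T + (v ⬝ᵥ X + v₀)) - h X| ≤ C₁ * k⁻¹ := by
    have : k⁻¹ * (T + (v ⬝ᵥ X + v₀)) - h X = k⁻¹ * (T + (v ⬝ᵥ X + v₀) - k * h X) := by
      field_simp
    rw [this, abs_mul, abs_of_pos (inv_pos.2 hk), mul_comm]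
    exact mul_le_mul_of_nonneg_right h3 (by positivity)
  rw [add_dotProduct, smul_dotProduct, smul_eq_mul]
  have h7 := h2.trans h5
  rw [abs_le] at h6 h7 ⊢
  constructor <;> linarith [h6.1, h6.2, h7.1, h7.2]

lemma exists_piecewise_linear {g : ℝ → ℝ}
    (hg : ∀ s ∈ Set.Icc (0 : ℝ) 1, ∀ t ∈ Set.Icc (0 : ℝ) 1, |g s - g t| ≤ |s - t|)
    {k : ℕ} (hk : 0 < k)
    {s : ℝ} (hs : s ∈ Set.Icc (0 : ℝ) 1) :
    |g s - (∑ j ∈ range k, (g ((j + 1) / k) - g (j / k)) *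
      (max 0 (k * s - j) - max 0 (k * s - (j + 1)))
      + g 0)| ≤ 2 / k := by
  have hk' : (0 : ℝ) < k := by exact_mod_cast hk
  obtain ⟨t, ht⟩ : ∃ t, t = k * s := ⟨_, rfl⟩
  have ht0 : 0 ≤ t := by rw [ht]; exact mul_nonneg hk'.le hs.1
  have htk : t ≤ k := by rw [ht]; exact mul_le_of_le_one_right hk'.le hs.2
  have hst : s = t / k := by rw [ht]; field_simp
  have hI : ∀ x : ℝ, 0 ≤ x → x ≤ k → x / k ∈ Set.Icc (0 : ℝ) 1 := fun x h0 h1 =>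
    ⟨by positivity, div_le_one_of_le₀ h1 hk'.le⟩
  have hd : ∀ x y : ℝ, 0 ≤ x → x ≤ k → 0 ≤ y → y ≤ k → |g (x / k) - g (y / k)| ≤ |x - y| / k :=
    fun x y h0 h1 h2 h3 => (hg _ (hI x h0 h1) _ (hI y h2 h3)).trans (le_of_eq (by
      rw [← sub_div, abs_div, abs_of_pos hk']))
  rw [← ht, hst]
  set F : ℕ → ℝ := fun n => ∑ j ∈ range n, (g ((j + 1) / k) - g (j / k)) *
    (max 0 (t - j) - max 0 (t - (j + 1))) + g 0 with hF
  have hsucc : ∀ n, F (n + 1) = F n + (g ((n + 1) / k) - g (n / k)) *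
      (max 0 (t - n) - max 0 (t - (n + 1))) := fun n => by
    simp only [hF, sum_range_succ]; ring
  have key : ∀ n ≤ k, ((n : ℝ) ≤ t → F n = g (n / k)) ∧ (t ≤ n → |g (t / k) - F n| ≤ 2 / k) := by
    intro n
    induction n with
    | zero =>
      intro _
      refine ⟨fun _ => by simp [hF], fun h => ?_⟩
      have : t = 0 := le_antisymm (by exact_mod_cast h) ht0
      simp only [hF, this, zero_div, range_zero, sum_empty, zero_add, sub_self, abs_zero]
      positivity
    | succ n ih =>
      intro hn
      obtain ⟨ih1, ih2⟩ := ih (by omega)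
      have hn' : (n : ℝ) + 1 ≤ k := by exact_mod_cast hn
      have hn0 : (0 : ℝ) ≤ n := n.cast_nonneg
      rw [hsucc]
      push_cast
      refine ⟨fun h => ?_, fun h => ?_⟩
      · rw [ih1 (by linarith), max_eq_right (by linarith), max_eq_right (by linarith)]; ring
      · rw [max_eq_left (by linarith : t - (n + 1) ≤ 0), sub_zero]
        rcases le_total t n with h' | h'
        · rw [max_eq_left (by linarith), mul_zero, add_zero]; exact ih2 h'
        · rw [max_eq_right (by linarith), ih1 h']
          have h1 := hd t n ht0 htk hn0 (by linarith)
          have h2 := hd (n + 1) n (by linarith) hn' hn0 (by linarith)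
          rw [add_sub_cancel_left, abs_one] at h2
          have h3 : |t - n| / k ≤ 1 / k := by
            rw [abs_of_nonneg (by linarith)]; gcongr; linarith
          have h4 : |(g ((n + 1) / k) - g (n / k)) * (t - n)| ≤ 1 / k := by
            rw [abs_mul, abs_of_nonneg (by linarith : 0 ≤ t - n)]
            exact (mul_le_of_le_one_right (abs_nonneg _) (by linarith)).trans h2
          rw [← sub_sub]
          refine (abs_sub _ _).trans ?_
          rw [show (2 : ℝ) / k = 1 / k + 1 / k by ring]
          exact add_le_add (h1.trans h3) h4
  exact (key k le_rfl).2 htk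

/-- The number of units needed to approximate `1`-Lipschitz functions of `d` variables on the cube
to accuracy `δ / 2`, up to an affine function, is `O(δ⁻ᵈ)`. -/
lemma exists_relu_affine_approx (d : ℕ) : ∃ c : ℝ, 0 < c ∧
    ∀ {h : (Fin d → ℝ) → ℝ}, (∀ x ∈ Set.Icc (0 : Fin d → ℝ) 1, h x ∈ Set.Icc (0 : ℝ) 1) →
      (∀ x ∈ Set.Icc (0 : Fin d → ℝ) 1, ∀ y ∈ Set.Icc (0 : Fin d → ℝ) 1,
        |h x - h y| ≤ ‖x - y‖) → ∀ {δ : ℝ}, 0 < δ → δ ≤ 1 →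
      ∃ (I : Type) (_ : Fintype I) (c' b : I → ℝ) (u : I → Fin d → ℝ) (v : Fin d → ℝ) (v₀ : ℝ),
        (#{i | c' i ≠ 0} : ℝ) ≤ c * (δ⁻¹) ^ d ∧ ∀ X ∈ Set.Icc (0 : Fin d → ℝ) 1,
          |h X - ∑ i, c' i * max 0 (u i ⬝ᵥ X - b i) - (v ⬝ᵥ X + v₀)| ≤ δ / 2 := by
  rcases lt_or_ge d 2 with hd | hd
  · interval_cases d
    · refine ⟨1, one_pos, fun {h} _ _ δ hδ _ =>
        ⟨Empty, inferInstance, Empty.elim, Empty.elim, Empty.elim, 0, h 0,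
        by simp, fun X _ => ?_⟩⟩
      rw [Subsingleton.elim X 0]
      simp only [sub_self, univ_eq_empty, sum_empty, sub_zero, zero_dotProduct, zero_add, abs_zero]
      exact (half_pos hδ).le
    · refine ⟨10, by norm_num, fun {h} _ hlip δ hδ hδ1 => ?_⟩
      obtain ⟨k, hkdef⟩ : ∃ k : ℕ, k = ⌈4 / δ⌉₊ := ⟨_, rfl⟩
      have hk4 : 4 / δ ≤ k := by rw [hkdef]; exact Nat.le_ceil _
      have hk5 : (k : ℝ) < 4 / δ + 1 := by rw [hkdef]; exact Nat.ceil_lt_add_one (by positivity)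
      have hk0 : (0 : ℝ) < k := lt_of_lt_of_le (by positivity) hk4
      have hc : ∀ s ∈ Set.Icc (0 : ℝ) 1, (fun _ => s : Fin 1 → ℝ) ∈ Set.Icc (0 : Fin 1 → ℝ) 1 :=
        fun s hs => ⟨fun _ => hs.1, fun _ => hs.2⟩
      refine ⟨Fin k × Bool, inferInstance,
        fun p => (if p.2 then 1 else -1) * (h (fun _ => (p.1 + 1) / k) - h (fun _ => p.1 / k)),
        fun p => if p.2 then p.1 else p.1 + 1, fun _ _ => k, 0, h 0, ?_, fun X hX => ?_⟩
      · have h1 : (#{i : Fin k × Bool | (if i.2 then (1 : ℝ) else -1) *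
            (h (fun _ => (i.1 + 1) / k) - h (fun _ => i.1 / k)) ≠ 0} : ℝ) ≤ k * 2 := by
          have := card_le_univ (α := Fin k × Bool)
            {i : Fin k × Bool | (if i.2 then (1 : ℝ) else -1) *
            (h (fun _ => (i.1 + 1) / k) - h (fun _ => i.1 / k)) ≠ 0}
          rw [Fintype.card_prod, Fintype.card_fin, Fintype.card_bool] at this
          exact_mod_cast this
        refine h1.trans ?_
        have h2 : 1 ≤ δ⁻¹ := (one_le_inv₀ hδ).2 hδ1
        rw [div_eq_mul_inv] at hk5
        rw [pow_one]; linarith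
      · have h1 := exists_piecewise_linear (g := fun s => h fun _ => s) (fun s hs t ht => by
          refine (hlip _ (hc s hs) _ (hc t ht)).trans ?_
          refine (pi_norm_le_iff_of_nonneg (abs_nonneg _)).2 fun _ => le_rfl)
          (k := k) (by exact_mod_cast hk0) (s := X 0) ⟨hX.1 0, hX.2 0⟩
        have hX0 : (fun _ => X 0) = X := by ext i; rw [Subsingleton.elim i 0]
        rw [hX0] at h1
        have h2 : (2 : ℝ) / k ≤ δ / 2 := by
          rw [div_le_iff₀ hδ] at hk4
          rw [div_le_div_iff₀ hk0 two_pos]; linarith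
        refine le_trans (le_of_eq ?_) (h1.trans h2)
        rw [Fintype.sum_prod_type, Finset.sum_range, ← sub_sub (h X)]
        simp only [Fintype.sum_bool, zero_dotProduct, zero_add]
        congr 3
        refine Finset.sum_congr rfl fun j _ => ?_
        simp [dotProduct]
        ring
  · obtain ⟨M, C, hC, hap⟩ := exists_sparse_relu hd
    refine ⟨M * (64 * (2 * C + 1)) ^ d + 1, by positivity, fun {h} hmem hlip δ hδ hδ1 => ?_⟩
    have hδi : 1 ≤ δ⁻¹ := (one_le_inv₀ hδ).2 hδ1
    obtain ⟨n, hn1, hn2⟩ := exists_nat_pow_near (x := (2 * C + 1) * δ⁻¹) (y := 64)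
      (by nlinarith) (by norm_num)
    obtain ⟨I, hI, c, b, u, v, v₀, hcard, hX⟩ := hap hmem hlip (n + 1)
    have h64 : ∀ m : ℕ, (2 : ℝ) ^ (6 * m) = 64 ^ m := fun m => by rw [pow_mul]; norm_num
    refine ⟨I, hI, c, b, u, v, v₀, ?_, fun X hX' => (hX X hX').trans ?_⟩
    · have h1 : (#{i | c i ≠ 0} : ℝ) ≤ M * 2 ^ (6 * (n + 1) * d) := by exact_mod_cast hcard
      refine h1.trans ?_
      rw [pow_mul, h64, add_mul, mul_assoc (M : ℝ), ← mul_pow]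
      have h2 : ((64 : ℝ) ^ (n + 1)) ^ d ≤ (64 * (2 * C + 1) * δ⁻¹) ^ d := by
        refine pow_le_pow_left₀ (by positivity) ?_ d
        rw [pow_succ]; linarith
      have h3 := mul_le_mul_of_nonneg_left h2 (Nat.cast_nonneg (α := ℝ) M)
      have h4 : 0 ≤ (δ⁻¹) ^ d := by positivity
      linarith
    · rw [one_div, inv_pow, h64, ← div_eq_mul_inv, div_le_iff₀ (by positivity)]
      have h1 := mul_lt_mul_of_pos_right hn2 hδ
      rw [mul_assoc, inv_mul_cancel₀ hδ.ne', mul_one] at h1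
      linarith

/-- Absorb the affine part into two further ReLU units. -/
lemma exists_relu_network_eq {d : ℕ} {I : Type} [Fintype I] (c b : I → ℝ) (u : I → Fin d → ℝ)
    (v : Fin d → ℝ) (v₀ : ℝ) : ∃ (N : ℕ) (a' b' : Fin N → ℝ) (w' : Fin N → Fin d → ℝ),
      N = #{i | c i ≠ 0} + 2 ∧ ∀ X ∈ Set.Icc (0 : Fin d → ℝ) 1,
        ∑ j, a' j * max 0 (w' j ⬝ᵥ X + b' j) =
          ∑ i, c i * max 0 (u i ⬝ᵥ X - b i) + (v ⬝ᵥ X + v₀) := by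
  classical
  set s := ∑ a, |v a| with hs
  let J := {i // c i ≠ 0} ⊕ Bool
  let a₁ : J → ℝ := Sum.elim (fun i => c i) fun t => if t then 1 else v₀ - s
  let b₁ : J → ℝ := Sum.elim (fun i => -b i) fun t => if t then s else 1
  let w₁ : J → Fin d → ℝ := Sum.elim (fun i => u i) fun t => if t then v else 0
  let e : Fin (Fintype.card J) ≃ J := (Fintype.equivFin J).symm
  refine ⟨Fintype.card J, a₁ ∘ e, b₁ ∘ e, w₁ ∘ e, ?_, fun X hX => ?_⟩
  · rw [Fintype.card_sum, Fintype.card_bool, Fintype.card_subtype]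
  · rw [show (∑ j, (a₁ ∘ e) j * max 0 ((w₁ ∘ e) j ⬝ᵥ X + (b₁ ∘ e) j)) =
      ∑ j, a₁ j * max 0 (w₁ j ⬝ᵥ X + b₁ j) from
      e.sum_comp fun j => a₁ j * max 0 (w₁ j ⬝ᵥ X + b₁ j), Fintype.sum_sum_type]
    have hv : 0 ≤ v ⬝ᵥ X + s := by
      have hX1 : ‖X‖ ≤ 1 := (pi_norm_le_iff_of_nonneg zero_le_one).2 fun a => by
        rw [Real.norm_of_nonneg (hX.1 a)]; exact hX.2 a
      have h1 : |v ⬝ᵥ X| ≤ s := (abs_dotProduct_le_sum_mul_norm v X).trans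
        (mul_le_of_le_one_right (Finset.sum_nonneg fun a _ => abs_nonneg _) hX1)
      linarith [(abs_le.1 h1).1]
    congr 1
    · simp only [a₁, b₁, w₁, Sum.elim_inl, ← sub_eq_add_neg]
      rw [← Finset.sum_subtype (p := fun i => c i ≠ 0) (univ.filter fun i => c i ≠ 0) (by simp)
        fun i => c i * max 0 (u i ⬝ᵥ X - b i)]
      refine Finset.sum_filter_of_ne fun i _ hi h0 => hi ?_
      rw [h0, zero_mul]
    · simp [a₁, b₁, w₁, max_eq_right hv]

lemma exists_relu_network_approx (d : ℕ) : ∃ c : ℝ, 0 < c ∧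
    ∀ {h : (Fin d → ℝ) → ℝ}, (∀ x ∈ Set.Icc (0 : Fin d → ℝ) 1, h x ∈ Set.Icc (0 : ℝ) 1) →
      (∀ x ∈ Set.Icc (0 : Fin d → ℝ) 1, ∀ y ∈ Set.Icc (0 : Fin d → ℝ) 1,
        |h x - h y| ≤ ‖x - y‖) → ∀ {δ : ℝ}, 0 < δ → δ ≤ 1 →
      ∃ (N : ℕ) (a b : Fin N → ℝ) (w : Fin N → Fin d → ℝ),
        (N : ℝ) ≤ c * (δ⁻¹) ^ d ∧ ∀ X ∈ Set.Icc (0 : Fin d → ℝ) 1,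
          |h X - ∑ j, a j * max 0 (w j ⬝ᵥ X + b j)| ≤ δ / 2 := by
  obtain ⟨c, hc, happ⟩ := exists_relu_affine_approx d
  refine ⟨c + 2, by positivity, fun hmem hlip δ hδ hδ1 => ?_⟩
  obtain ⟨I, hI, c', b, u, v, v₀, hcard, hX⟩ := happ hmem hlip hδ hδ1
  obtain ⟨N, a', b', w', hN, heq⟩ := exists_relu_network_eq c' b u v v₀
  refine ⟨N, a', b', w', ?_, fun X hXmem => ?_⟩
  · have h1 : 1 ≤ (δ⁻¹) ^ d := one_le_pow₀ ((one_le_inv₀ hδ).2 hδ1)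
    rw [hN]; push_cast; linarith
  · rw [heq X hXmem, ← sub_sub]; exact hX X hXmem

/-- A function of the coordinates in `C` is approximated by a network reading only these. -/
lemma exists_relu_network_approx_of_local {ι : Type*} [Fintype ι] (C : Finset ι) {c : ℝ}
    (hc : ∀ {h : (Fin #C → ℝ) → ℝ},
      (∀ x ∈ Set.Icc (0 : Fin #C → ℝ) 1, h x ∈ Set.Icc (0 : ℝ) 1) →
      (∀ x ∈ Set.Icc (0 : Fin #C → ℝ) 1, ∀ y ∈ Set.Icc (0 : Fin #C → ℝ) 1,
        |h x - h y| ≤ ‖x - y‖) → ∀ {δ : ℝ}, 0 < δ → δ ≤ 1 →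
      ∃ (N : ℕ) (a b : Fin N → ℝ) (w : Fin N → Fin #C → ℝ),
        (N : ℝ) ≤ c * (δ⁻¹) ^ #C ∧ ∀ X ∈ Set.Icc (0 : Fin #C → ℝ) 1,
          |h X - ∑ j, a j * max 0 (w j ⬝ᵥ X + b j)| ≤ δ / 2)
    {θ : (ι → ℝ) → ℝ} (hloc : ∀ x y : ι → ℝ, (∀ v ∈ C, x v = y v) → θ x = θ y)
    (hmem : ∀ x ∈ Set.Icc (0 : ι → ℝ) 1, θ x ∈ Set.Icc (0 : ℝ) 1)
    (hlip : ∀ x ∈ Set.Icc (0 : ι → ℝ) 1, ∀ y ∈ Set.Icc (0 : ι → ℝ) 1, |θ x - θ y| ≤ ‖x - y‖)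
    {δ : ℝ} (hδ : 0 < δ) (hδ1 : δ ≤ 1) :
    ∃ (N : ℕ) (a b : Fin N → ℝ) (w : Fin N → ι → ℝ), (∀ j, ∀ v ∉ C, w j v = 0) ∧
      (N : ℝ) ≤ c * (δ⁻¹) ^ #C ∧ ∀ x ∈ Set.Icc (0 : ι → ℝ) 1,
        |θ x - ∑ j, a j * max 0 ((∑ v, w j v * x v) + b j)| ≤ δ / 2 := by
  classical
  let ext : (Fin #C → ℝ) → ι → ℝ := fun z v => if hv : v ∈ C then z (C.equivFin ⟨v, hv⟩) else 0
  have hext : ∀ z ∈ Set.Icc (0 : Fin #C → ℝ) 1, ext z ∈ Set.Icc (0 : ι → ℝ) 1 := fun z hz => by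
    refine ⟨fun v => ?_, fun v => ?_⟩ <;> simp only [ext] <;> split_ifs
    · exact hz.1 _
    · exact le_rfl
    · exact hz.2 _
    · exact zero_le_one
  have hdist : ∀ y z, ‖ext y - ext z‖ ≤ ‖y - z‖ := fun y z => by
    refine (pi_norm_le_iff_of_nonneg (norm_nonneg _)).2 fun v => ?_
    simp only [ext, Pi.sub_apply]
    split_ifs
    · exact norm_le_pi_norm (y - z) _
    · simp
  obtain ⟨N, a, b, w, hN, happ⟩ := hc (h := fun z => θ (ext z)) (fun z hz => hmem _ (hext z hz))
    (fun y hy z hz => (hlip _ (hext y hy) _ (hext z hz)).trans (hdist y z)) hδ hδ1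
  refine ⟨N, a, b, fun j => ext (w j), fun j v hv => dif_neg hv, hN, fun x hx => ?_⟩
  have hdot : ∀ j, ∑ v, ext (w j) v * x v = w j ⬝ᵥ fun i => x (C.equivFin.symm i) := fun j => by
    rw [dotProduct, ← C.equivFin.sum_comp, ← sum_subset (subset_univ C), ← sum_coe_sort C]
    · refine sum_congr rfl fun v _ => ?_
      simp [ext]
    · intro v _ hv
      simp [ext, hv]
  have h1 := happ (fun i => x (C.equivFin.symm i)) ⟨fun i => hx.1 _, fun i => hx.2 _⟩
  simp only [hdot]
  rwa [hloc x (ext fun i => x (C.equivFin.symm i)) fun v hv => by simp [ext, hv]]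

end

/-- **Single-level core of Theorem 2 / Corollary 1.**
For every multiset `S` of clique sizes there is a constant `c > 0` such that: for every graph
`G` on `Fin n` whose multiset of maximal-clique sizes is `S`, every `G`-compatible
`f : [0,1]^n → [0,1]` whose clique functions `θ_C : [0,1]^{|C|} → [0,1]` are `1`-Lipschitz
w.r.t. the sup norm can, for every `ε ∈ (0,1)`, be uniformly `ε`-approximated on the cube by a
sum `∑_j g_j(x_{C_j})` of shallow ReLU networks, `g_j` reading only the features of the clique
`C_j` and having `N_j` units, with `∑_j N_j ≤ c · ∑_j (ε/m)^{-|C_j|}` where `m` is the number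
of maximal cliques. -/
theorem compatible_function_shallow_approx (S : Multiset ℕ) :
    ∃ c : ℝ, 0 < c ∧
      ∀ (n : ℕ) (G : SimpleGraph (Fin n)),
        (maxCliques n G).val.map Finset.card = S →
        ∀ (f : (Fin n → ℝ) → ℝ) (θ : Finset (Fin n) → (Fin n → ℝ) → ℝ),
          (∀ C ∈ maxCliques n G, ∀ x y : Fin n → ℝ,
            (∀ v ∈ C, x v = y v) → θ C x = θ C y) →
          (∀ C ∈ maxCliques n G, ∀ x ∈ Set.Icc (0 : Fin n → ℝ) 1,
            θ C x ∈ Set.Icc (0 : ℝ) 1) →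
          (∀ C ∈ maxCliques n G, ∀ x ∈ Set.Icc (0 : Fin n → ℝ) 1,
            ∀ y ∈ Set.Icc (0 : Fin n → ℝ) 1, |θ C x - θ C y| ≤ ‖x - y‖) →
          (∀ x ∈ Set.Icc (0 : Fin n → ℝ) 1, f x ∈ Set.Icc (0 : ℝ) 1) →
          (∀ x ∈ Set.Icc (0 : Fin n → ℝ) 1, f x = ∑ C ∈ maxCliques n G, θ C x) →
          ∀ ε ∈ Set.Ioo (0 : ℝ) 1,
            ∃ (N : Finset (Fin n) → ℕ)
              (a b : (C : Finset (Fin n)) → Fin (N C) → ℝ)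
              (w : (C : Finset (Fin n)) → Fin (N C) → Fin n → ℝ),
              (∀ C ∈ maxCliques n G, ∀ (j : Fin (N C)), ∀ v ∉ C, w C j v = 0) ∧
              (∀ x ∈ Set.Icc (0 : Fin n → ℝ) 1,
                |f x - ∑ C ∈ maxCliques n G,
                  ∑ j : Fin (N C), a C j * max 0 ((∑ v, w C j v * x v) + b C j)| < ε) ∧
              ((∑ C ∈ maxCliques n G, (N C : ℝ)) ≤
                c * ∑ C ∈ maxCliques n G,
                  (ε / ((maxCliques n G).card : ℝ)) ^ (-(C.card : ℤ))) := by
  choose cd hcd hnet using exists_relu_network_approx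
  refine ⟨1 + ∑ d ∈ S.toFinset, cd d,
    add_pos_of_pos_of_nonneg one_pos (sum_nonneg fun d _ => (hcd d).le), ?_⟩
  intro n G hS f θ hloc hmem hlip _ hf ε hε
  set m := #(maxCliques n G) with hm
  have hδ : ∀ C ∈ maxCliques n G, 0 < ε / m ∧ ε / m ≤ 1 := fun C hC => by
    have h1 : (1 : ℝ) ≤ m := by exact_mod_cast card_pos.2 ⟨C, hC⟩
    exact ⟨div_pos hε.1 (by linarith), div_le_one_of_le₀ (hε.2.le.trans h1) (by linarith)⟩
  have hex : ∀ C : Finset (Fin n), ∃ (N : ℕ) (a b : Fin N → ℝ) (w : Fin N → Fin n → ℝ),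
      C ∈ maxCliques n G → (∀ j, ∀ v ∉ C, w j v = 0) ∧ (N : ℝ) ≤ cd #C * ((ε / m)⁻¹) ^ #C ∧
        ∀ x ∈ Set.Icc (0 : Fin n → ℝ) 1,
          |θ C x - ∑ j, a j * max 0 ((∑ v, w j v * x v) + b j)| ≤ ε / m / 2 := fun C => by
    by_cases hC : C ∈ maxCliques n G
    · obtain ⟨N, a, b, w, h⟩ := exists_relu_network_approx_of_local C (hnet #C) (hloc C hC)
        (hmem C hC) (hlip C hC) (hδ C hC).1 (hδ C hC).2
      exact ⟨N, a, b, w, fun _ => h⟩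
    · exact ⟨0, 0, 0, 0, fun h => absurd h hC⟩
  choose N a b w h using hex
  refine ⟨N, a, b, w, fun C hC => (h C hC).1, fun x hx => ?_, ?_⟩
  · rw [hf x hx, ← sum_sub_distrib]
    refine ((abs_sum_le_sum_abs _ _).trans
      (sum_le_card_nsmul _ _ _ fun C hC => (h C hC).2.2 x hx)).trans_lt ?_
    rw [nsmul_eq_mul, ← hm]
    have h0 := hε.1
    rcases eq_or_ne (m : ℝ) 0 with h1 | h1
    · rw [h1, zero_mul]; exact h0
    · rw [show (m : ℝ) * (ε / m / 2) = ε / 2 by field_simp]; exact half_lt_self h0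
  · rw [mul_sum]
    refine sum_le_sum fun C hC => (h C hC).2.1.trans ?_
    rw [zpow_neg, zpow_natCast, ← inv_pow]
    have hCS : #C ∈ S.toFinset := by
      rw [Multiset.mem_toFinset, ← hS]
      exact Multiset.mem_map_of_mem _ hC
    have h1 := single_le_sum (f := cd) (fun d _ => (hcd d).le) hCS
    have h2 := (hδ C hC).1
    gcongr
    linarith
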